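/- arXiv:1308.5853 — 2 statements merged into one kernel-verified Lean document; each statement's English description precedes it below -/
import Mathlib

section
/- Let a countable group G act freely on a set X, let Φ = (ℓ, φ, 𝒵, Γ, 𝟙) be a chart for G with ℋ = 𝟙 = {{1_G}}, let 0 < ε < 1/4, let q satisfy 12ε < q < 1/(24ℓ), and let A ⊆ ℤ^ℓ × Γ be a centered rectangle. Assume φ(𝒵) generates G. If E_1, E_2, … is an infinite sequence of (Φ, A, ε)-sub-rectangular equivalence relations on X which are pairwise (Φ, q·A)-orthogonal, then for all x, y ∈ X with G·x = G·y there is m ∈ ℕ such that x E_n y for all n ≥ m. -/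
open Pointwise

/-- Points of `ℤ^ℓ × Γ`. -/
abbrev Vec (ℓ : ℕ) (Γ : Type*) := (Fin ℓ → ℤ) × Γ

/-- A rectangle in `ℤ^ℓ × Γ`, recorded by its integer center and its radius vector.
The `Γ`-coordinate of points is unrestricted. -/
structure Rect (ℓ : ℕ) where
  center : Fin ℓ → ℤ
  radius : Fin ℓ → ℕ

namespace Rect

variable {ℓ : ℕ}

/-- The set of points of `ℤ^ℓ × Γ` belonging to the rectangle. -/
def carrier (A : Rect ℓ) (Γ : Type*) : Set (Vec ℓ Γ) :=
  {b | ∀ i, |b.1 i - A.center i| ≤ (A.radius i : ℤ)}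

/-- A rectangle is centered if its center is the origin. -/
def IsCentered (A : Rect ℓ) : Prop := A.center = 0

/-- `A ⊑ B` : a translate of `A` is contained in `B`, i.e. `L_i(A) ≤ L_i(B)` for all `i`. -/
def le (A B : Rect ℓ) : Prop := ∀ i, A.radius i ≤ B.radius i

/-- `λ · A` : the rectangle with the same center and `L_i(λ·A) = ⌊λ L_i(A)⌋`. -/
noncomputable def smul (lam : ℝ) (A : Rect ℓ) : Rect ℓ :=
  ⟨A.center, fun i => (⌊lam * (A.radius i : ℝ)⌋).toNat⟩

/-- `A + 𝐯`, the translate of `A` by `𝐯` (only the `ℤ^ℓ` part of `𝐯` matters). -/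
def translate {Γ : Type*} (A : Rect ℓ) (v : Vec ℓ Γ) : Rect ℓ :=
  ⟨fun i => A.center i + v.1 i, A.radius⟩

/-- `Aⁱ` : `A` flattened in the `i`-th direction. -/
def face (A : Rect ℓ) (i : Fin ℓ) : Rect ℓ :=
  ⟨A.center, Function.update A.radius i 0⟩

/-- `Aⁱ + sign·L_i(A)·𝐞_i`, the face of `A` perpendicular to `𝐞_i` in direction `sign`. -/
def faceRect (A : Rect ℓ) (i : Fin ℓ) (sign : ℤ) : Rect ℓ :=
  ⟨Function.update A.center i (A.center i + sign * (A.radius i : ℤ)),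
   Function.update A.radius i 0⟩

end Rect

/-- The conjugate subgroup `g H g⁻¹`. -/
def conjSubgroup {G : Type*} [Group G] (g : G) (H : Subgroup G) : Subgroup G :=
  Subgroup.map (MulAut.conj g).toMonoidHom H

/-- A chart `Φ = (ℓ, φ, 𝒵, Γ, ℋ)` for a group `G`. -/
structure Chart (G : Type*) [Group G] (ℓ : ℕ) (Γ : Type*) [AddCommGroup Γ] where
  /-- the finite collection `ℋ` of pairwise conjugate subgroups of `G` -/
  H : Finset (Subgroup G)
  /-- the centered rectangle `𝒵` -/
  Z : Rect ℓ
  /-- the domain of `φ`, a centered rectangle -/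
  D : Rect ℓ
  /-- the map `φ` (only its values on `D.carrier Γ` are relevant) -/
  φ : Vec ℓ Γ → G
  Γ_finite : Finite Γ
  H_conj : ∀ H₁ ∈ H, ∀ H₂ ∈ H, ∃ g : G, conjSubgroup g H₁ = H₂
  Z_centered : Z.IsCentered
  Z_pos : ∀ i, 0 < Z.radius i
  D_centered : D.IsCentered
  D_large : (Rect.smul 3 Z).le D
  φ_injOn : Set.InjOn φ (D.carrier Γ)
  φ_zero : φ 0 = 1
  coset_inj : ∀ r ∈ D.carrier Γ, ∀ s ∈ D.carrier Γ, ∀ H₀ ∈ H,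
    (φ s)⁻¹ * φ r ∈ H₀ → r = s
  mul_mem : ∀ r ∈ D.carrier Γ, ∀ s ∈ D.carrier Γ, ∀ H₀ ∈ H,
    ((fun z => r + s + z) '' Z.carrier Γ ⊆ D.carrier Γ) →
    ∃ z ∈ Z.carrier Γ, (φ (r + s + z))⁻¹ * (φ r * φ s) ∈ H₀
  mul_inv_mem : ∀ r ∈ D.carrier Γ, ∀ s ∈ D.carrier Γ, ∀ H₀ ∈ H,
    ((fun z => r - s + z) '' Z.carrier Γ ⊆ D.carrier Γ) →
    ∃ z ∈ Z.carrier Γ, (φ (r - s + z))⁻¹ * (φ r * (φ s)⁻¹) ∈ H₀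
  inv_mul_mem : ∀ r ∈ D.carrier Γ, ∀ s ∈ D.carrier Γ, ∀ H₀ ∈ H,
    ((fun z => -r + s + z) '' Z.carrier Γ ⊆ D.carrier Γ) →
    ∃ z ∈ Z.carrier Γ, (φ (-r + s + z))⁻¹ * ((φ r)⁻¹ * φ s) ∈ H₀
  inv_mem : ∀ s ∈ D.carrier Γ, ∀ H₀ ∈ H,
    ((fun z => -s + z) '' Z.carrier Γ ⊆ D.carrier Γ) →
    ∃ z ∈ Z.carrier Γ, (φ (-s + z))⁻¹ * (φ s)⁻¹ ∈ H₀

section ChartAction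

variable {G : Type*} [Group G] {ℓ : ℕ} {Γ : Type*} [AddCommGroup Γ]

/-- `X^ℋ = {x ∈ X : Stab(x) ∈ ℋ}`. -/
def XH (Φ : Chart G ℓ Γ) (X : Type*) [MulAction G X] : Set X :=
  {x | MulAction.stabilizer G x ∈ Φ.H}

variable {X : Type*} [MulAction G X]

/-- `φ(S)·x`. -/
def chartImg (Φ : Chart G ℓ Γ) (S : Set (Vec ℓ Γ)) (x : X) : Set X :=
  (fun v => Φ.φ v • x) '' S

/-- `φ(S)·T` for a set `T ⊆ X`. -/
def chartImgSet (Φ : Chart G ℓ Γ) (S : Set (Vec ℓ Γ)) (T : Set X) : Set X :=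
  ⋃ y ∈ T, chartImg Φ S y

/-- `R` is `(Φ, ε)`-roughly `A` at `x`. -/
def RoughlyAt (Φ : Chart G ℓ Γ) (A : Rect ℓ) (ε : ℝ) (R : Set X) (x : X) : Prop :=
  0 < ε ∧ ε < 1 ∧ x ∈ XH Φ X ∧
  (Rect.smul 2 A).carrier Γ ⊆ Φ.D.carrier Γ ∧
  (Rect.smul 2 Φ.Z).le (Rect.smul ε A) ∧
  chartImg Φ ((Rect.smul (1 - ε) A).carrier Γ) x ⊆ R ∧
  R ⊆ chartImg Φ ((Rect.smul (1 + ε) A).carrier Γ) x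

/-- `R` is `(Φ, ε)`-roughly `A` (at some base point of `X^ℋ`). -/
def Roughly (Φ : Chart G ℓ Γ) (A : Rect ℓ) (ε : ℝ) (R : Set X) : Prop :=
  ∃ x : X, RoughlyAt Φ A ε R x

/-- The class `[x]_E`. -/
def eqClass {X : Type*} (E : X → X → Prop) (x : X) : Set X := {y | E x y}

/-- `E` is `(Φ, A, ε)`-rectangular. -/
def IsRectangular (Φ : Chart G ℓ Γ) (A : Rect ℓ) (ε : ℝ) (E : X → X → Prop) : Prop :=
  A.IsCentered ∧ 0 < ε ∧ ε < 1 ∧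
  (∀ x : X, ¬ (∃ y ∈ eqClass E x, y ∈ XH Φ X) → eqClass E x = {x}) ∧
  (∀ x : X, (∃ y ∈ eqClass E x, y ∈ XH Φ X) →
    ∃ (δ : ℝ) (B : Rect ℓ), 0 < δ ∧ Roughly Φ B δ (eqClass E x) ∧
      A.le B ∧ (Rect.smul ((2 : ℝ) ^ (22 * ℓ)) B).carrier Γ ⊆ Φ.D.carrier Γ ∧
      (Rect.smul (2 * δ) B).le (Rect.smul ε A))

/-- `E` is `(Φ, A, ε)`-sub-rectangular. -/
def IsSubRectangular (Φ : Chart G ℓ Γ) (A : Rect ℓ) (ε : ℝ) (E : X → X → Prop) : Prop :=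
  ∃ F : X → X → Prop, Equivalence F ∧ (∀ x y, F x y → E x y) ∧ IsRectangular Φ A ε F

/-- The `E`-saturation of a set. -/
def eSat {X : Type*} (E : X → X → Prop) (S : Set X) : Set X := {y | ∃ s ∈ S, E s y}

/-- The `(Φ, i, A)`-boundary `∂_i^Φ(E, A)`. -/
def bdry (Φ : Chart G ℓ Γ) (E : X → X → Prop) (A : Rect ℓ) (i : Fin ℓ) : Set X :=
  {x | x ∈ XH Φ X ∧
    Disjoint (eSat E (chartImg Φ ((A.faceRect i (-1)).carrier Γ) x))
             (eSat E (chartImg Φ ((A.faceRect i 1).carrier Γ) x))}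

/-- `E` and `F` are `(Φ, A)`-orthogonal. -/
def ChartOrthogonal (Φ : Chart G ℓ Γ) (A : Rect ℓ) (E F : X → X → Prop) : Prop :=
  A.IsCentered ∧ (Rect.smul ((30 * ℓ : ℕ) : ℝ) A).carrier Γ ⊆ Φ.D.carrier Γ ∧
  ∀ i : Fin ℓ,
    Disjoint (chartImgSet Φ ((Rect.smul ((30 * ℓ : ℕ) : ℝ) A).carrier Γ) (bdry Φ E A i))
             (chartImgSet Φ ((Rect.smul ((30 * ℓ : ℕ) : ℝ) A).carrier Γ) (bdry Φ F A i))

end ChartAction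

/-- The picture of a rough tiling by boxes near the origin of `ℤ^ℓ × Γ`: inside the window of radius
`12 P`, every `F`-class is, up to an error `e`, a box that is long compared with the window, and no
point is an `E`-boundary point for boxes of radius `Q` (whose faces are known up to an error `z`). -/
structure RoughBoxTiling {ℓ : ℕ} {Γ : Type*} (P Q z e : Fin ℓ → ℤ)
    (F E : Vec ℓ Γ → Vec ℓ Γ → Prop) : Prop where
  z_nonneg : ∀ i, 0 ≤ z i
  z_le : ∀ i, z i ≤ e i
  e_small : ∀ i, 6 * e i ≤ Q i
  Q_pos : ∀ i, 0 < Q i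
  P_eq : ∀ i, P i = ℓ * Q i
  F_equiv : Equivalence F
  E_equiv : Equivalence E
  F_le_E : ∀ u v, F u v → E u v
  box : ∀ u : Vec ℓ Γ, (∀ i, |u.1 i| ≤ 12 * P i) → ∃ lo hi : Fin ℓ → ℤ,
    (∀ i, lo i + 24 * P i ≤ hi i) ∧
    (∀ v : Vec ℓ Γ, (∀ i, |v.1 i| ≤ 12 * P i) → (∀ i, lo i ≤ v.1 i ∧ v.1 i ≤ hi i) → F u v) ∧
    (∀ v : Vec ℓ Γ, (∀ i, |v.1 i| ≤ 12 * P i) → F u v →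
      ∀ i, lo i - e i ≤ v.1 i ∧ v.1 i ≤ hi i + e i)
  not_bdry : ∀ (u : Vec ℓ Γ) (i : Fin ℓ), (∀ k, |u.1 k| ≤ 10 * P k) → ∃ v w : Vec ℓ Γ, E v w ∧
    (∀ k, k ≠ i → |v.1 k - u.1 k| ≤ Q k + z k ∧ |w.1 k - u.1 k| ≤ Q k + z k) ∧
    |v.1 i - (u.1 i - Q i)| ≤ z i ∧ |w.1 i - (u.1 i + Q i)| ≤ z i

namespace RoughBoxTiling

variable {ℓ : ℕ} {Γ : Type*} {P Q z e : Fin ℓ → ℤ} {F E : Vec ℓ Γ → Vec ℓ Γ → Prop}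

theorem Q_le_P (h : RoughBoxTiling P Q z e F E) (i : Fin ℓ) : Q i ≤ P i := by
  have hℓ : (1 : ℤ) ≤ ℓ := by exact_mod_cast i.pos
  rw [h.P_eq i]
  nlinarith [h.Q_pos i]

theorem neg [AddCommGroup Γ] (h : RoughBoxTiling P Q z e F E) :
    RoughBoxTiling P Q z e (fun u v => F (-u) (-v)) (fun u v => E (-u) (-v)) where
  z_nonneg := h.z_nonneg
  z_le := h.z_le
  e_small := h.e_small
  Q_pos := h.Q_pos
  P_eq := h.P_eq
  F_equiv := ⟨fun _ => h.F_equiv.refl _, fun h' => h.F_equiv.symm h',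
    fun h₁ h₂ => h.F_equiv.trans h₁ h₂⟩
  E_equiv := ⟨fun _ => h.E_equiv.refl _, fun h' => h.E_equiv.symm h',
    fun h₁ h₂ => h.E_equiv.trans h₁ h₂⟩
  F_le_E := fun u v h' => h.F_le_E _ _ h'
  box := by
    intro u hu
    obtain ⟨lo, hi, hlong, hin, hout⟩ := h.box (-u) (by simpa using hu)
    refine ⟨fun i => -hi i, fun i => -lo i, fun i => ?_, fun v hv hb => ?_, fun v hv hF i => ?_⟩
    · have := hlong i; dsimp only; omega
    · refine hin (-v) (by simpa using hv) fun i => ?_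
      have hi' := hb i
      simp only [Prod.fst_neg, Pi.neg_apply] at hi' ⊢
      omega
    · have := hout (-v) (by simpa using hv) hF i
      simp only [Prod.fst_neg, Pi.neg_apply] at this ⊢
      omega
  not_bdry := by
    intro u i hu
    obtain ⟨v, w, hE, hk, hv, hw⟩ := h.not_bdry (-u) i (by simpa using hu)
    refine ⟨-w, -v, by simpa using h.E_equiv.symm hE, fun k hki => ?_, ?_, ?_⟩
    · have := hk k hki
      simp only [Prod.fst_neg, Pi.neg_apply, abs_le] at this ⊢
      omega
    all_goals
      simp only [Prod.fst_neg, Pi.neg_apply, abs_le] at hv hw ⊢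
      omega

/-- Inside the box of the `F`-class of `u`, one can move `u` to a prescribed `i`-th coordinate. -/
theorem exists_move_in_box (h : RoughBoxTiling P Q z e F E) (u : Vec ℓ Γ) (i : Fin ℓ)
    {lo hi : Fin ℓ → ℤ} (hu : ∀ k, |u.1 k| ≤ 11 * P k)
    (hlong : ∀ k, lo k + 24 * P k ≤ hi k)
    (hin : ∀ v : Vec ℓ Γ, (∀ k, |v.1 k| ≤ 12 * P k) →
      (∀ k, lo k ≤ v.1 k ∧ v.1 k ≤ hi k) → F u v)
    (hnear : ∀ k, lo k - e k ≤ u.1 k ∧ u.1 k ≤ hi k + e k)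
    (t : ℤ) (ht : |t| ≤ 8 * P i) (hut : u.1 i ≤ t) (hthi : t ≤ hi i) :
    ∃ v : Vec ℓ Γ, F u v ∧ |v.1 i - t| ≤ e i ∧ ∀ k, k ≠ i → |v.1 k - u.1 k| ≤ e k := by
  have hb : ∀ k, 0 ≤ e k ∧ e k ≤ P k := fun k => by
    have := h.z_nonneg k; have := h.z_le k; have := h.e_small k; have := h.Q_le_P k; omega
  refine ⟨(fun k => max (lo k) (min (hi k) (if k = i then t else u.1 k)), u.2),
    hin _ (fun k => ?_) (fun k => ?_), ?_, fun k hk => ?_⟩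
  · have := hu k; have := hlong k; have := hnear k; have := hb k
    rw [abs_le] at *
    dsimp only
    split_ifs with hk
    · subst hk; omega
    · omega
  · have := hlong k; have := hb k
    dsimp only
    omega
  · have := hlong i; have := hnear i; have := hb i
    rw [abs_le] at *
    simp only [if_true]
    omega
  · have := hlong k; have := hnear k; have := hb k
    rw [abs_le]
    simp only [if_neg hk]
    omega

theorem exists_move_up (h : RoughBoxTiling P Q z e F E) (u : Vec ℓ Γ) (i : Fin ℓ)
    (hu : ∀ k, |u.1 k| ≤ 8 * P k) (t : ℤ) (ht : |t| ≤ 8 * P i) (hut : u.1 i ≤ t) :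
    ∃ v : Vec ℓ Γ, E u v ∧ |v.1 i - t| ≤ 3 * Q i ∧ ∀ k, k ≠ i → |v.1 k - u.1 k| ≤ 3 * Q k := by
  have hb : ∀ k, 0 ≤ z k ∧ z k ≤ e k ∧ 6 * e k ≤ Q k ∧ Q k ≤ P k ∧ 0 < Q k := fun k =>
    ⟨h.z_nonneg k, h.z_le k, h.e_small k, h.Q_le_P k, h.Q_pos k⟩
  have hu12 : ∀ k, |u.1 k| ≤ 12 * P k := fun k => by have := hu k; have := hb k; omega
  have hu11 : ∀ k, |u.1 k| ≤ 11 * P k := fun k => by have := hu k; have := hb k; omega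
  obtain ⟨lo, hi, hlong, hin, hout⟩ := h.box u hu12
  have hnear := hout u hu12 (h.F_equiv.refl u)
  by_cases hthi : t ≤ hi i
  · obtain ⟨v, hF, hvi, hvk⟩ :=
      h.exists_move_in_box u i hu11 hlong hin hnear t ht hut hthi
    refine ⟨v, h.F_le_E _ _ hF, ?_, fun k hk => ?_⟩
    · have := hb i; omega
    · have := hb k; have := hvk k hk; omega
  push Not at hthi
  -- the point at which the class of `u` ends, moved inside the class in the other directions
  let c : Vec ℓ Γ := (fun k => if k = i then hi i else
    max (lo k + (Q k + z k + e k)) (min (hi k - (Q k + z k + e k)) (u.1 k)), u.2)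
  have hci : c.1 i = hi i := by simp [c]
  have hck : ∀ k, k ≠ i → c.1 k =
      max (lo k + (Q k + z k + e k)) (min (hi k - (Q k + z k + e k)) (u.1 k)) := fun k hk => by
    simp [c, hk]
  have hc : ∀ k, |c.1 k| ≤ 8 * P k + Q k + z k + 2 * e k := by
    intro k
    have := hb k; have := hlong k; have := hnear k; have := hu k
    rw [abs_le] at *
    by_cases hk : k = i
    · subst hk; rw [hci]; omega
    · rw [hck k hk]; omega
  obtain ⟨v, w, hE, hvw, hvi, hwi⟩ := h.not_bdry c i fun k => by
    have := hc k; have := hb k; omega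
  rw [abs_le] at hvi hwi
  rw [hci] at hvi hwi
  have huv : F u v := by
    refine hin v (fun k => ?_) (fun k => ?_)
    · have := hb k; have hck' := hc k
      rw [abs_le] at *
      by_cases hk : k = i
      · subst hk; rw [hci] at hck'; omega
      · have := (hvw k hk).1
        rw [abs_le] at this
        omega
    · have := hb k; have := hlong k
      by_cases hk : k = i
      · subst hk; omega
      · have := (hvw k hk).1
        rw [abs_le, hck k hk] at this
        omega
  have huw : E u w := h.E_equiv.trans (h.F_le_E _ _ huv) hE
  have hw11 : ∀ k, |w.1 k| ≤ 11 * P k := by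
    intro k
    have := hb k; have hck' := hc k
    rw [abs_le] at *
    by_cases hk : k = i
    · subst hk; rw [hci] at hck'; omega
    · have := (hvw k hk).2
      rw [abs_le] at this
      omega
  have hwu : ∀ k, k ≠ i → |w.1 k - u.1 k| ≤ 2 * Q k + 2 * z k + 2 * e k := by
    intro k hk
    have := hb k; have := hlong k; have := hnear k; have := (hvw k hk).2
    rw [abs_le] at *
    rw [hck k hk] at this
    omega
  by_cases hwt : t ≤ w.1 i
  · refine ⟨w, huw, ?_, fun k hk => ?_⟩
    · have := hb i
      rw [abs_le]; omega
    · have := hb k; have := hwu k hk; omega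
  push Not at hwt
  have hw12 : ∀ k, |w.1 k| ≤ 12 * P k := fun k => by have := hw11 k; have := hb k; omega
  obtain ⟨lo', hi', hlong', hin', hout'⟩ := h.box w hw12
  have hnear' := hout' w hw12 (h.F_equiv.refl w)
  by_cases hthi' : t ≤ hi' i
  · obtain ⟨v', hF, hvi', hvk'⟩ :=
      h.exists_move_in_box w i hw11 hlong' hin' hnear' t ht hwt.le hthi'
    refine ⟨v', h.E_equiv.trans huw (h.F_le_E _ _ hF), ?_, fun k hk => ?_⟩
    · have := hb i; omega
    · have := hb k; have := hvk' k hk; have := hwu k hk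
      rw [abs_le] at *
      omega
  push Not at hthi'
  exfalso
  let p : Vec ℓ Γ :=
    (fun k => if k = i then hi i else max (lo' k) (min (hi' k) (w.1 k)), u.2)
  have hpi : p.1 i = hi i := by simp [p]
  have hpk : ∀ k, k ≠ i → p.1 k = max (lo' k) (min (hi' k) (w.1 k)) := fun k hk => by
    simp [p, hk]
  have hp12 : ∀ k, |p.1 k| ≤ 12 * P k := by
    intro k
    have := hb k; have := hlong' k; have := hnear' k; have := hw11 k; have := hnear k
    have := hu k
    rw [abs_le] at *
    by_cases hk : k = i
    · subst hk; rw [hpi]; omega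
    · rw [hpk k hk]; omega
  have hup : F u p := by
    refine hin p hp12 fun k => ?_
    have := hb k; have := hlong k
    by_cases hk : k = i
    · subst hk; rw [hpi]; omega
    · have hwk := (hvw k hk).2; have := hlong' k; have := hnear' k
      rw [abs_le, hck k hk] at hwk
      rw [hpk k hk]
      omega
  have hwp : F w p := by
    refine hin' p hp12 fun k => ?_
    have := hb k; have := hlong' k
    by_cases hk : k = i
    · subst hk
      have := hnear' k; have := hnear k; have := hu k
      rw [abs_le] at *
      rw [hpi]; omega
    · rw [hpk k hk]
      omega
  have := hout w hw12 (h.F_equiv.trans hup (h.F_equiv.symm hwp)) i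
  have := hb i
  omega

theorem exists_move [AddCommGroup Γ] (h : RoughBoxTiling P Q z e F E) (u : Vec ℓ Γ) (i : Fin ℓ)
    (hu : ∀ k, |u.1 k| ≤ 8 * P k) (t : ℤ) (ht : |t| ≤ 8 * P i) :
    ∃ v : Vec ℓ Γ, E u v ∧ |v.1 i - t| ≤ 3 * Q i ∧ ∀ k, k ≠ i → |v.1 k - u.1 k| ≤ 3 * Q k := by
  rcases le_total (u.1 i) t with hut | hut
  · exact h.exists_move_up u i hu t ht hut
  · obtain ⟨v, hE, hvi, hvk⟩ := h.neg.exists_move_up (-u) i (by simpa using hu) (-t)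
      (by simpa using ht) (by simpa using hut)
    refine ⟨-v, by simpa using hE, ?_, fun k hk => ?_⟩
    · rw [abs_le] at *
      simp only [Prod.fst_neg, Pi.neg_apply]
      omega
    · have := hvk k hk
      rw [abs_le] at *
      simp only [Prod.fst_neg, Pi.neg_apply] at this ⊢
      omega

/-- Moving one coordinate at a time, the `E`-class of the origin comes close to every point of the
window. -/
theorem exists_near [AddCommGroup Γ] (h : RoughBoxTiling P Q z e F E) (t : Fin ℓ → ℤ)
    (ht : ∀ k, |t k| ≤ 5 * P k) (s : Finset (Fin ℓ)) :
    ∃ u : Vec ℓ Γ, E 0 u ∧ ∀ k, (k ∉ s → |u.1 k| ≤ 3 * (s.card * Q k)) ∧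
      (k ∈ s → |u.1 k - t k| ≤ 3 * (s.card * Q k)) := by
  classical
  induction s using Finset.induction_on with
  | empty => exact ⟨0, h.E_equiv.refl _, by simp⟩
  | insert i s his ih =>
    obtain ⟨u, hE, hu⟩ := ih
    have hcard : ∀ k, 0 ≤ (s.card : ℤ) * Q k ∧ (s.card : ℤ) * Q k ≤ P k := fun k => by
      have hQ := h.Q_pos k
      refine ⟨by positivity, ?_⟩
      rw [h.P_eq k]
      have : (s.card : ℤ) ≤ ℓ := by exact_mod_cast (Finset.card_le_univ s).trans_eq (by simp)
      gcongr
    have hu8 : ∀ k, |u.1 k| ≤ 8 * P k := by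
      intro k
      have hk := hu k; have := ht k; have := hcard k
      by_cases hks : k ∈ s
      · have := hk.2 hks
        rw [abs_le] at *
        omega
      · have := hk.1 hks
        omega
    obtain ⟨v, hEv, hvi, hvk⟩ := h.exists_move u i hu8 (t i) (by
      have := ht i; have := hcard i; omega)
    refine ⟨v, h.E_equiv.trans hE hEv, fun k => ?_⟩
    have hk := hu k; have := hcard k
    rw [Finset.card_insert_of_notMem his, Nat.cast_add, Nat.cast_one, add_mul, one_mul]
    by_cases hki : k = i
    · subst hki
      refine ⟨fun hk' => absurd (Finset.mem_insert_self _ _) hk', fun _ => by omega⟩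
    · have hv := hvk k hki
      rw [Finset.mem_insert, or_iff_right hki]
      refine ⟨fun hks => ?_, fun hks => ?_⟩
      · have := hk.1 hks
        rw [abs_le] at *
        omega
      · have := hk.2 hks
        rw [abs_le] at *
        omega

theorem rel_zero [AddCommGroup Γ] (h : RoughBoxTiling P Q z e F E) (y : Vec ℓ Γ)
    (hy : ∀ k, |y.1 k| ≤ z k) : E 0 y := by
  have hb : ∀ k, 0 ≤ z k ∧ z k ≤ e k ∧ 6 * e k ≤ Q k ∧ Q k ≤ P k ∧ 0 < Q k := fun k =>
    ⟨h.z_nonneg k, h.z_le k, h.e_small k, h.Q_le_P k, h.Q_pos k⟩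
  have hy12 : ∀ k, |y.1 k| ≤ 12 * P k := fun k => by have := hy k; have := hb k; omega
  obtain ⟨lo, hi, hlong, hin, hout⟩ := h.box y hy12
  have hnear := hout y hy12 (h.F_equiv.refl y)
  obtain ⟨u, hE, hu⟩ := h.exists_near
    (fun k => max (lo k + 3 * P k) (min (hi k - 3 * P k) (y.1 k)))
    (fun k => by
      have := hb k; have := hlong k; have := hnear k; have := hy k
      rw [abs_le] at *
      omega) Finset.univ
  have hu' : ∀ k, |u.1 k - max (lo k + 3 * P k) (min (hi k - 3 * P k) (y.1 k))| ≤ 3 * P k := by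
    intro k
    have := (hu k).2 (Finset.mem_univ k)
    rwa [Finset.card_fin, ← h.P_eq k] at this
  refine h.E_equiv.trans hE (h.E_equiv.symm (h.F_le_E _ _ (hin u (fun k => ?_) fun k => ?_)))
  · have := hb k; have := hlong k; have := hnear k; have := hy k; have := hu' k
    rw [abs_le] at *
    omega
  · have := hb k; have := hlong k; have := hu' k
    rw [abs_le] at *
    omega

end RoughBoxTiling

namespace Rect

variable {ℓ : ℕ} {Γ : Type*}

theorem smul_radius {lam : ℝ} (hlam : 0 ≤ lam) (A : Rect ℓ) (i : Fin ℓ) :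
    ((smul lam A).radius i : ℤ) = ⌊lam * (A.radius i : ℝ)⌋ :=
  Int.toNat_of_nonneg (Int.floor_nonneg.2 (by positivity))

theorem mem_smul_carrier {lam : ℝ} (hlam : 0 ≤ lam) (A : Rect ℓ) (b : Vec ℓ Γ) :
    b ∈ (smul lam A).carrier Γ ↔
      ∀ i, |b.1 i - A.center i| ≤ ⌊lam * (A.radius i : ℝ)⌋ := by
  simp only [← smul_radius hlam]
  rfl

theorem mem_carrier_of_isCentered {A : Rect ℓ} (hA : A.IsCentered) (b : Vec ℓ Γ) :
    b ∈ A.carrier Γ ↔ ∀ i, |b.1 i| ≤ (A.radius i : ℤ) := by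
  rw [IsCentered] at hA
  simp [carrier, hA]

theorem floor_le_of_smul_le_smul {lam mu : ℝ} (hlam : 0 ≤ lam) (hmu : 0 ≤ mu) {A B : Rect ℓ}
    (h : (smul lam A).le (smul mu B)) (i : Fin ℓ) :
    ⌊lam * (A.radius i : ℝ)⌋ ≤ ⌊mu * (B.radius i : ℝ)⌋ := by
  rw [← smul_radius hlam, ← smul_radius hmu]
  exact_mod_cast h i

end Rect

section ChartLocal

variable {G : Type*} [Group G] {ℓ : ℕ} {Γ : Type*} [AddCommGroup Γ] {Φ : Chart G ℓ Γ}

theorem Chart.exists_mul_eq (hH : Φ.H = {(⊥ : Subgroup G)}) {r s : Vec ℓ Γ}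
    (hr : r ∈ Φ.D.carrier Γ) (hs : s ∈ Φ.D.carrier Γ)
    (h : ∀ z ∈ Φ.Z.carrier Γ, r + s + z ∈ Φ.D.carrier Γ) :
    ∃ z ∈ Φ.Z.carrier Γ, Φ.φ r * Φ.φ s = Φ.φ (r + s + z) := by
  obtain ⟨z, hz, hm⟩ := Φ.mul_mem r hr s hs ⊥ (by simp [hH]) (Set.image_subset_iff.2 h)
  exact ⟨z, hz, (inv_mul_eq_one.1 (Subgroup.mem_bot.1 hm)).symm⟩

theorem Chart.exists_inv_mul_eq (hH : Φ.H = {(⊥ : Subgroup G)}) {r s : Vec ℓ Γ}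
    (hr : r ∈ Φ.D.carrier Γ) (hs : s ∈ Φ.D.carrier Γ)
    (h : ∀ z ∈ Φ.Z.carrier Γ, -r + s + z ∈ Φ.D.carrier Γ) :
    ∃ z ∈ Φ.Z.carrier Γ, (Φ.φ r)⁻¹ * Φ.φ s = Φ.φ (-r + s + z) := by
  obtain ⟨z, hz, hm⟩ := Φ.inv_mul_mem r hr s hs ⊥ (by simp [hH]) (Set.image_subset_iff.2 h)
  exact ⟨z, hz, (inv_mul_eq_one.1 (Subgroup.mem_bot.1 hm)).symm⟩

theorem Chart.exists_inv_eq (hH : Φ.H = {(⊥ : Subgroup G)}) {s : Vec ℓ Γ}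
    (hs : s ∈ Φ.D.carrier Γ) (h : ∀ z ∈ Φ.Z.carrier Γ, -s + z ∈ Φ.D.carrier Γ) :
    ∃ z ∈ Φ.Z.carrier Γ, (Φ.φ s)⁻¹ = Φ.φ (-s + z) := by
  obtain ⟨z, hz, hm⟩ := Φ.inv_mem s hs ⊥ (by simp [hH]) (Set.image_subset_iff.2 h)
  exact ⟨z, hz, (inv_mul_eq_one.1 (Subgroup.mem_bot.1 hm)).symm⟩

variable {X : Type*} [MulAction G X]

theorem mem_XH_of_free (hfree : ∀ (g : G) (x : X), g • x = x → g = 1)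
    (hH : Φ.H = {(⊥ : Subgroup G)}) (x : X) : x ∈ XH Φ X := by
  simp only [XH, Set.mem_ofPred_eq, hH, Finset.mem_singleton]
  exact (Subgroup.eq_bot_iff_forall _).2 fun g hg => hfree g x hg

/-- A roughly rectangular set is, in the coordinates `v ↦ φ(v)·x`, a box up to an error. -/
theorem RoughlyAt.exists_box (hfree : ∀ (g : G) (x : X), g • x = x → g = 1)
    (hH : Φ.H = {(⊥ : Subgroup G)}) {B : Rect ℓ} {δ : ℝ} {R : Set X} {c : X}
    (hR : RoughlyAt Φ B δ R c)
    (hB : ∀ b : Vec ℓ Γ, (∀ i, |b.1 i - B.center i| ≤ 4 * (B.radius i : ℤ)) → b ∈ Φ.D.carrier Γ)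
    (W : Fin ℓ → ℤ) (hW : ∀ v : Vec ℓ Γ, (∀ i, |v.1 i| ≤ W i) → v ∈ Φ.D.carrier Γ)
    (hWB : ∀ i, 2 * W i ≤ B.radius i) (x : X) (u : Vec ℓ Γ) (hu : ∀ i, |u.1 i| ≤ W i)
    (huR : Φ.φ u • x ∈ R) :
    ∃ lo hi : Fin ℓ → ℤ,
      (∀ i, hi i - lo i = 2 * (⌊(1 - δ) * (B.radius i : ℝ)⌋ - Φ.Z.radius i)) ∧
      (∀ v : Vec ℓ Γ, (∀ i, |v.1 i| ≤ W i) → (∀ i, lo i ≤ v.1 i ∧ v.1 i ≤ hi i) →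
        Φ.φ v • x ∈ R) ∧
      (∀ v : Vec ℓ Γ, (∀ i, |v.1 i| ≤ W i) → Φ.φ v • x ∈ R → ∀ i,
        lo i - (⌊(1 + δ) * (B.radius i : ℝ)⌋ - ⌊(1 - δ) * (B.radius i : ℝ)⌋ + 2 * Φ.Z.radius i)
          ≤ v.1 i ∧
        v.1 i ≤ hi i +
          (⌊(1 + δ) * (B.radius i : ℝ)⌋ - ⌊(1 - δ) * (B.radius i : ℝ)⌋ + 2 * Φ.Z.radius i)) := by
  obtain ⟨hδ0, hδ1, -, -, hZB, hsub, hsup⟩ := hR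
  have hZ : ∀ b : Vec ℓ Γ, b ∈ Φ.Z.carrier Γ ↔ ∀ i, |b.1 i| ≤ (Φ.Z.radius i : ℤ) :=
    Rect.mem_carrier_of_isCentered Φ.Z_centered
  have hZB' : ∀ i, 2 * (Φ.Z.radius i : ℤ) ≤ B.radius i := by
    intro i
    have h1 := Rect.floor_le_of_smul_le_smul (by norm_num) hδ0.le hZB i
    have h2 : ⌊δ * (B.radius i : ℝ)⌋ ≤ (B.radius i : ℤ) := by
      refine Int.floor_le_iff.2 ?_
      have : δ * (B.radius i : ℝ) ≤ 1 * B.radius i := by gcongr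
      push_cast
      linarith
    have h3 : 2 * (Φ.Z.radius i : ℤ) ≤ ⌊2 * (Φ.Z.radius i : ℝ)⌋ := by
      rw [Int.le_floor]; push_cast; exact le_rfl
    omega
  have hfl : ∀ i, ⌊(1 + δ) * (B.radius i : ℝ)⌋ ≤ 2 * (B.radius i : ℤ) := by
    intro i
    refine Int.floor_le_iff.2 ?_
    have : δ * (B.radius i : ℝ) ≤ 1 * B.radius i := by gcongr
    push_cast
    linarith
  obtain ⟨b, hb, hbu⟩ := hsup huR
  rw [Rect.mem_smul_carrier (by linarith)] at hb
  have hbD : b ∈ Φ.D.carrier Γ := hB b fun i => by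
    have := hb i; have := hfl i; omega
  obtain ⟨z, hz, hzeq⟩ := Chart.exists_inv_mul_eq hH (hW u hu) hbD fun z hz => hB _ fun i => by
    have := hb i; have := hfl i; have := (hZ z).1 hz i; have := hZB' i; have := hu i
    have := hWB i
    simp only [Prod.fst_add, Prod.fst_neg, Pi.add_apply, Pi.neg_apply]
    rw [abs_le] at *
    omega
  generalize hd : -u + b + z = d at hzeq
  have hdc : ∀ i, |d.1 i - B.center i| ≤ 3 * (B.radius i : ℤ) := fun i => by
    have := hb i; have := hfl i; have := (hZ z).1 hz i; have := hZB' i; have := hu i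
    have := hWB i
    rw [← hd]
    simp only [Prod.fst_add, Prod.fst_neg, Pi.add_apply, Pi.neg_apply]
    rw [abs_le] at *
    omega
  have hx : Φ.φ d • c = x := by
    dsimp only at hbu
    rw [← hzeq, mul_smul, hbu, inv_smul_smul]
  have hdD : d ∈ Φ.D.carrier Γ := hB d fun i => by have := hdc i; omega
  have hvd : ∀ v : Vec ℓ Γ, (∀ i, |v.1 i| ≤ W i) → ∃ z ∈ Φ.Z.carrier Γ,
      v + d + z ∈ Φ.D.carrier Γ ∧ Φ.φ v • x = Φ.φ (v + d + z) • c := by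
    intro v hv
    have hD : ∀ z ∈ Φ.Z.carrier Γ, v + d + z ∈ Φ.D.carrier Γ := fun z hz => hB _ fun i => by
      have := hdc i; have := (hZ z).1 hz i; have := hZB' i; have := hv i; have := hWB i
      simp only [Prod.fst_add, Pi.add_apply]
      rw [abs_le] at *
      omega
    obtain ⟨z, hz, hzeq⟩ := Chart.exists_mul_eq hH (hW v hv) hdD hD
    exact ⟨z, hz, hD z hz, by rw [← hzeq, mul_smul, hx]⟩
  refine ⟨fun i => B.center i - ⌊(1 - δ) * (B.radius i : ℝ)⌋ - d.1 i + Φ.Z.radius i,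
    fun i => B.center i + ⌊(1 - δ) * (B.radius i : ℝ)⌋ - d.1 i - Φ.Z.radius i,
    fun i => by ring, fun v hv hvb => ?_, fun v hv hvR i => ?_⟩
  · obtain ⟨z, hz, -, heq⟩ := hvd v hv
    rw [heq]
    refine hsub ⟨_, (Rect.mem_smul_carrier (by linarith) _ _).2 fun i => ?_, rfl⟩
    have hi := hvb i; have := (hZ z).1 hz i
    simp only [Prod.fst_add, Pi.add_apply] at hi ⊢
    rw [abs_le] at *
    omega
  · obtain ⟨z, hz, hzD, heq⟩ := hvd v hv
    obtain ⟨b', hb', hb'v⟩ := hsup hvR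
    rw [Rect.mem_smul_carrier (by linarith)] at hb'
    have hb'D : b' ∈ Φ.D.carrier Γ := hB b' fun i => by
      have := hb' i; have := hfl i; omega
    have hφ : Φ.φ b' = Φ.φ (v + d + z) := by
      dsimp only at hb'v
      rw [heq] at hb'v
      exact (inv_mul_eq_one.1 (hfree _ c (by rw [mul_smul, hb'v, inv_smul_smul]))).symm
    have hb'eq := Φ.φ_injOn hb'D hzD hφ
    have hi := hb' i; have := (hZ z).1 hz i
    rw [hb'eq] at hi
    simp only [Prod.fst_add, Pi.add_apply] at hi ⊢
    rw [abs_le] at *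
    omega

/-- If `x` is not close to the boundary of `E`, then no point near `x` is a boundary point. -/
theorem exists_rel_of_notMem_bdry (hfree : ∀ (g : G) (x : X), g • x = x → g = 1)
    (hH : Φ.H = {(⊥ : Subgroup G)}) {A : Rect ℓ} (hA : A.IsCentered) {E : X → X → Prop}
    (hE : Equivalence E) (hZA : ∀ i, Φ.Z.radius i ≤ A.radius i) (hℓ : 0 < ℓ)
    (hD : (Rect.smul ((30 * ℓ : ℕ) : ℝ) A).carrier Γ ⊆ Φ.D.carrier Γ) {x : X} {i : Fin ℓ}
    (hx : x ∉ chartImgSet Φ ((Rect.smul ((30 * ℓ : ℕ) : ℝ) A).carrier Γ) (bdry Φ E A i))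
    (u : Vec ℓ Γ) (hu : ∀ k, |u.1 k| ≤ 10 * (ℓ * (A.radius k : ℤ))) :
    ∃ v w : Vec ℓ Γ, E (Φ.φ v • x) (Φ.φ w • x) ∧
      (∀ k, k ≠ i → |v.1 k - u.1 k| ≤ A.radius k + Φ.Z.radius k ∧
        |w.1 k - u.1 k| ≤ A.radius k + Φ.Z.radius k) ∧
      |v.1 i - (u.1 i - A.radius i)| ≤ Φ.Z.radius i ∧
      |w.1 i - (u.1 i + A.radius i)| ≤ Φ.Z.radius i := by
  have hZ : ∀ b : Vec ℓ Γ, b ∈ Φ.Z.carrier Γ ↔ ∀ i, |b.1 i| ≤ (Φ.Z.radius i : ℤ) :=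
    Rect.mem_carrier_of_isCentered Φ.Z_centered
  have hmem : ∀ v : Vec ℓ Γ, (∀ k, |v.1 k| ≤ 30 * (ℓ * (A.radius k : ℤ))) →
      v ∈ (Rect.smul ((30 * ℓ : ℕ) : ℝ) A).carrier Γ := fun v hv => by
    rw [Rect.mem_smul_carrier (by positivity)]
    intro k
    rw [hA, Pi.zero_apply, sub_zero, Int.le_floor]
    have : ((|v.1 k| : ℤ) : ℝ) ≤ ((30 * (ℓ * (A.radius k : ℤ)) : ℤ) : ℝ) := by exact_mod_cast hv k
    refine this.trans_eq ?_
    push_cast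
    ring
  have hb : ∀ k, (A.radius k : ℤ) ≤ ℓ * (A.radius k : ℤ) ∧ (Φ.Z.radius k : ℤ) ≤ A.radius k :=
    fun k => ⟨le_mul_of_one_le_left (by positivity) (by exact_mod_cast hℓ), by
      exact_mod_cast hZA k⟩
  have huD : u ∈ Φ.D.carrier Γ := hD (hmem u fun k => by
    have := hb k; have := hu k; omega)
  have huz : ∀ z ∈ Φ.Z.carrier Γ, -u + z ∈ (Rect.smul ((30 * ℓ : ℕ) : ℝ) A).carrier Γ :=
    fun z hz => hmem _ fun k => by
      have := hb k; have := hu k; have := (hZ z).1 hz k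
      simp only [Prod.fst_add, Prod.fst_neg, Pi.add_apply, Pi.neg_apply]
      rw [abs_le] at *
      omega
  obtain ⟨z, hz, hzeq⟩ := Chart.exists_inv_eq hH huD fun z hz => hD (huz z hz)
  have hnb : Φ.φ u • x ∉ bdry Φ E A i := fun hmem' => hx <| by
    refine Set.mem_biUnion hmem' ⟨-u + z, huz z hz, ?_⟩
    dsimp only
    rw [← hzeq, inv_smul_smul]
  have hface : ∀ (f : Vec ℓ Γ) (s : ℤ), |s| ≤ 1 → f ∈ (A.faceRect i s).carrier Γ →
      ∃ v : Vec ℓ Γ, Φ.φ f • Φ.φ u • x = Φ.φ v • x ∧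
        (∀ k, k ≠ i → |v.1 k - u.1 k| ≤ A.radius k + Φ.Z.radius k) ∧
        |v.1 i - (u.1 i + s * A.radius i)| ≤ Φ.Z.radius i := by
    intro f s hs hf
    have hfi : f.1 i = s * A.radius i := by
      have := hf i
      simpa [Rect.faceRect, show A.center = 0 from hA, sub_eq_zero] using this
    have hfk : ∀ k, k ≠ i → |f.1 k| ≤ A.radius k := fun k hk => by
      have := hf k
      simpa [Rect.faceRect, hk, show A.center = 0 from hA] using this
    have hfA : ∀ k, |f.1 k| ≤ A.radius k := fun k => by
      by_cases hk : k = i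
      · subst hk
        rw [hfi, abs_mul, Nat.abs_cast]
        exact mul_le_of_le_one_left (by positivity) hs
      · exact hfk k hk
    obtain ⟨z, hz, hzeq⟩ := Chart.exists_mul_eq hH (r := f) (s := u)
      (hD (hmem f fun k => by have := hb k; have := hfA k; omega)) huD
      fun z hz => hD (hmem _ fun k => by
        have := hb k; have := hu k; have := (hZ z).1 hz k; have := hfA k
        simp only [Prod.fst_add, Pi.add_apply]
        rw [abs_le] at *
        omega)
    refine ⟨f + u + z, by rw [← hzeq, mul_smul], fun k hk => ?_, ?_⟩
    · have := (hZ z).1 hz k; have := hfA k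
      simp only [Prod.fst_add, Pi.add_apply]
      rw [abs_le] at *
      omega
    · have := (hZ z).1 hz i
      simp only [Prod.fst_add, Pi.add_apply, hfi]
      rw [abs_le] at *
      omega
  have hnd : ¬ Disjoint (eSat E (chartImg Φ ((A.faceRect i (-1)).carrier Γ) (Φ.φ u • x)))
      (eSat E (chartImg Φ ((A.faceRect i 1).carrier Γ) (Φ.φ u • x))) :=
    fun hd => hnb ⟨mem_XH_of_free hfree hH _, hd⟩
  obtain ⟨y, ⟨_, ⟨f, hf, rfl⟩, hfy⟩, ⟨_, ⟨g, hg, rfl⟩, hgy⟩⟩ := Set.not_disjoint_iff.1 hnd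
  obtain ⟨v, hv, hvk, hvi⟩ := hface f (-1) (by simp) hf
  obtain ⟨w, hw, hwk, hwi⟩ := hface g 1 (by simp) hg
  dsimp only at hfy hgy
  rw [hv] at hfy
  rw [hw] at hgy
  refine ⟨v, w, hE.trans hfy (hE.symm hgy), fun k hk => ⟨hvk k hk, hwk k hk⟩, ?_, ?_⟩
  · rwa [neg_one_mul, ← sub_eq_add_neg] at hvi
  · rwa [one_mul] at hwi

theorem RoughlyAt.two_mul_radius_le {B : Rect ℓ} {δ : ℝ} {R : Set X} {c : X}
    (hR : RoughlyAt Φ B δ R c) (i : Fin ℓ) :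
    2 * (Φ.Z.radius i : ℤ) ≤ ⌊δ * (B.radius i : ℝ)⌋ := by
  obtain ⟨hδ0, -, -, -, hZB, -⟩ := hR
  refine le_trans ?_ (Rect.floor_le_of_smul_le_smul (by norm_num) hδ0.le hZB i)
  rw [Int.le_floor]
  push_cast
  exact le_rfl

theorem two_mul_floor_le_floor_two_mul (t : ℝ) : 2 * ⌊t⌋ ≤ ⌊2 * t⌋ := by
  rw [Int.le_floor]
  push_cast
  linarith [Int.floor_le t]

/-- Near a point that is far from the boundaries of `E`, a sub-rectangular equivalence relation
looks like a rough tiling by boxes. -/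
theorem IsSubRectangular.exists_roughBoxTiling
    (hfree : ∀ (g : G) (x : X), g • x = x → g = 1) (hH : Φ.H = {(⊥ : Subgroup G)})
    {ε q : ℝ} (hε0 : 0 < ε) (hq1 : 12 * ε < q) (hq2 : q < 1 / (24 * (ℓ : ℝ))) (hℓ : 0 < ℓ)
    {A : Rect ℓ} (hA : A.IsCentered) {E : X → X → Prop} (hE : Equivalence E)
    (hsub : IsSubRectangular Φ A ε E)
    (hD : (Rect.smul ((30 * ℓ : ℕ) : ℝ) (Rect.smul q A)).carrier Γ ⊆ Φ.D.carrier Γ) {x : X}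
    (hx : ∀ i, x ∉ chartImgSet Φ ((Rect.smul ((30 * ℓ : ℕ) : ℝ) (Rect.smul q A)).carrier Γ)
      (bdry Φ E (Rect.smul q A) i)) :
    ∃ (P Q e : Fin ℓ → ℤ) (F : X → X → Prop),
      RoughBoxTiling (Γ := Γ) P Q (fun i => Φ.Z.radius i) e
        (fun u v => F (Φ.φ u • x) (Φ.φ v • x)) (fun u v => E (Φ.φ u • x) (Φ.φ v • x)) := by
  obtain ⟨F, hF, hFE, -, -, -, -, hrect⟩ := hsub
  have hclass : ∀ y : X, ∃ (δ : ℝ) (B : Rect ℓ), Roughly Φ B δ (eqClass F y) ∧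
      A.le B ∧ (Rect.smul ((2 : ℝ) ^ (22 * ℓ)) B).carrier Γ ⊆ Φ.D.carrier Γ ∧
      (Rect.smul (2 * δ) B).le (Rect.smul ε A) := fun y => by
    obtain ⟨δ, B, -, h⟩ := hrect y ⟨y, hF.refl y, mem_XH_of_free hfree hH y⟩
    exact ⟨δ, B, h⟩
  have hq0 : 0 ≤ q := by linarith
  set Q : Fin ℓ → ℤ := fun i => ((Rect.smul q A).radius i : ℤ) with hQdef
  have hQ : ∀ i, Q i = ⌊q * (A.radius i : ℝ)⌋ := Rect.smul_radius hq0 A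
  set K : Fin ℓ → ℤ := fun i => ⌊ε * (A.radius i : ℝ)⌋ with hKdef
  have hKQ : ∀ i, 12 * K i ≤ Q i := by
    intro i
    rw [hQ, Int.le_floor]
    push_cast
    have h1 : (K i : ℝ) ≤ ε * A.radius i := Int.floor_le _
    have h2 : 12 * ε * (A.radius i : ℝ) ≤ q * A.radius i := by gcongr
    linarith
  have hQA : ∀ i, 24 * (ℓ * Q i) ≤ A.radius i := by
    intro i
    have h1 : (Q i : ℝ) ≤ q * A.radius i := by rw [hQ]; exact Int.floor_le _
    have hℓ' : (0 : ℝ) < ℓ := by exact_mod_cast hℓ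
    have h2 : q * (24 * ℓ) ≤ 1 := ((lt_div_iff₀ (by positivity)).1 hq2).le
    have h3 : (24 * (ℓ * Q i) : ℝ) ≤ A.radius i := calc
      (24 * (ℓ * Q i) : ℝ) ≤ 24 * (ℓ * (q * A.radius i)) := by gcongr
      _ = q * (24 * ℓ) * A.radius i := by ring
      _ ≤ 1 * A.radius i := by gcongr
      _ = A.radius i := one_mul _
    exact_mod_cast h3
  have hK : ∀ i, 4 * (Φ.Z.radius i : ℤ) ≤ K i := by
    intro i
    obtain ⟨δ, B, ⟨c, hR⟩, -, -, hδ⟩ := hclass x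
    have h1 := hR.two_mul_radius_le i
    have h2 := Rect.floor_le_of_smul_le_smul (by linarith [hR.1]) hε0.le hδ i
    have h3 := two_mul_floor_le_floor_two_mul (δ * B.radius i)
    rw [← mul_assoc] at h3
    simp only [hKdef]
    omega
  have hZ1 : ∀ i, 1 ≤ (Φ.Z.radius i : ℤ) := fun i => by exact_mod_cast Φ.Z_pos i
  have hQP : ∀ i, Q i ≤ ℓ * Q i := fun i =>
    le_mul_of_one_le_left (Int.natCast_nonneg _) (by exact_mod_cast hℓ)
  refine ⟨fun i => ℓ * Q i, Q, fun i => 2 * K i, F,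
    { z_nonneg := fun i => Int.natCast_nonneg _
      z_le := fun i => by have := hK i; have := hZ1 i; omega
      e_small := fun i => by have := hKQ i; omega
      Q_pos := fun i => by have := hKQ i; have := hK i; have := hZ1 i; omega
      P_eq := fun i => rfl
      F_equiv := ⟨fun _ => hF.refl _, fun h => hF.symm h, fun h₁ h₂ => hF.trans h₁ h₂⟩
      E_equiv := ⟨fun _ => hE.refl _, fun h => hE.symm h, fun h₁ h₂ => hE.trans h₁ h₂⟩
      F_le_E := fun u v h => hFE _ _ h
      box := ?_
      not_bdry := ?_ }⟩
  · intro u hu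
    obtain ⟨δ, B, ⟨c, hR⟩, hAB, hBD, hδ⟩ := hclass (Φ.φ u • x)
    have hAB' : ∀ i, (A.radius i : ℤ) ≤ B.radius i := fun i => by exact_mod_cast hAB i
    have hB : ∀ b : Vec ℓ Γ, (∀ i, |b.1 i - B.center i| ≤ 4 * (B.radius i : ℤ)) →
        b ∈ Φ.D.carrier Γ := fun b hb => hBD <| by
      rw [Rect.mem_smul_carrier (by positivity)]
      refine fun i => (hb i).trans ?_
      rw [Int.le_floor]
      push_cast
      gcongr
      calc (4 : ℝ) = 2 ^ 2 := by norm_num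
        _ ≤ 2 ^ (22 * ℓ) := pow_le_pow_right₀ (by norm_num) (by omega)
    obtain ⟨lo, hi, hlen, hin, hout⟩ := hR.exists_box hfree hH hB (fun i => 12 * (ℓ * Q i))
      (fun v hv => hD <| by
        rw [Rect.mem_smul_carrier (by positivity)]
        intro i
        have hv' : |v.1 i| ≤ 30 * (ℓ * Q i) := by
          have := hv i
          have : 0 ≤ Q i := Int.natCast_nonneg _
          have := hQP i
          omega
        rw [show (Rect.smul q A).center = 0 from hA, Pi.zero_apply, sub_zero, Int.le_floor]
        have : ((|v.1 i| : ℤ) : ℝ) ≤ ((30 * (ℓ * Q i) : ℤ) : ℝ) := by exact_mod_cast hv'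
        refine this.trans_eq ?_
        simp only [hQdef]
        push_cast
        ring)
      (fun i => by have := hQA i; have := hAB' i; omega) x u hu (hF.refl _)
    have hbd : ∀ i, B.radius i - ⌊δ * (B.radius i : ℝ)⌋ - 1 ≤ ⌊(1 - δ) * (B.radius i : ℝ)⌋ ∧
        ⌊(1 + δ) * (B.radius i : ℝ)⌋ = B.radius i + ⌊δ * (B.radius i : ℝ)⌋ ∧
        2 * (Φ.Z.radius i : ℤ) ≤ ⌊δ * (B.radius i : ℝ)⌋ ∧ 2 * ⌊δ * (B.radius i : ℝ)⌋ ≤ K i := by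
      intro i
      refine ⟨?_, ?_, hR.two_mul_radius_le i, ?_⟩
      · rw [Int.le_floor]
        push_cast
        linarith [Int.lt_floor_add_one (δ * (B.radius i : ℝ))]
      · rw [add_mul, one_mul, Int.floor_natCast_add]
      · have h2 := Rect.floor_le_of_smul_le_smul (by linarith [hR.1]) hε0.le hδ i
        have h3 := two_mul_floor_le_floor_two_mul (δ * B.radius i)
        rw [← mul_assoc] at h3
        exact h3.trans h2
    refine ⟨lo, hi, fun i => ?_, hin, fun v hv h i => ?_⟩
    · obtain ⟨h1, h2, h3, h4⟩ := hbd i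
      have := hlen i; have := hQA i; have := hAB' i; have := hKQ i; have := hQP i
      have := hZ1 i
      omega
    · obtain ⟨h1, h2, h3, h4⟩ := hbd i
      have := hout v hv h i; have := hK i; have := hZ1 i
      omega
  · intro u i hu
    refine exists_rel_of_notMem_bdry hfree hH (A := Rect.smul q A) hA hE (fun k => ?_) hℓ hD
      (hx i) u hu
    have : (Φ.Z.radius k : ℤ) ≤ Q k := by
      have := hKQ k; have := hK k; have := hZ1 k; omega
    exact Int.ofNat_le.1 this

end ChartLocal

/-- **Lemma 6.2 (orthogonal sequences stabilize on orbits).**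
Let `G` act freely on `X`, let `Φ = (ℓ, φ, 𝒵, Γ, 𝟙)` be a chart for `G` with `ℋ = 𝟙`,
let `0 < ε < 1/4`, let `q` satisfy `12ε < q < 1/(24ℓ)`, and let `A` be a centered rectangle.
Assume `φ(𝒵)` generates `G`. If `E_1, E_2, …` is an infinite sequence of
`(Φ, A, ε)`-sub-rectangular equivalence relations on `X` which are pairwise
`(Φ, q·A)`-orthogonal, then for all `x, y ∈ X` with `G·x = G·y` there is `m` such that
`x E_n y` for all `n ≥ m`. -/
theorem orthogonal_sequence {G X : Type*} [Group G] [Countable G] [MulAction G X]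
    (hfree : ∀ (g : G) (x : X), g • x = x → g = 1)
    {ℓ : ℕ} {Γ : Type*} [AddCommGroup Γ] (Φ : Chart G ℓ Γ)
    (hH : Φ.H = {(⊥ : Subgroup G)})
    (ε q : ℝ) (hε0 : 0 < ε) (hε : ε < 1 / 4)
    (hq1 : 12 * ε < q) (hq2 : q < 1 / (24 * (ℓ : ℝ)))
    (A : Rect ℓ) (hA : A.IsCentered)
    (hgen : Subgroup.closure (Φ.φ '' (Φ.Z.carrier Γ)) = (⊤ : Subgroup G))
    (E : ℕ → X → X → Prop) (hEeq : ∀ n, Equivalence (E n))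
    (hsub : ∀ n, IsSubRectangular Φ A ε (E n))
    (horth : ∀ m n, m ≠ n → ChartOrthogonal Φ (Rect.smul q A) (E m) (E n)) :
    ∀ x y : X, (∃ g : G, g • x = y) → ∃ m : ℕ, ∀ n ≥ m, E n x y := by
  have hℓ : 0 < ℓ := by
    rcases Nat.eq_zero_or_pos ℓ with rfl | h
    · simp only [Nat.cast_zero, mul_zero, div_zero] at hq2
      linarith
    · exact h
  have hgenerator : ∀ g ∈ Φ.φ '' (Φ.Z.carrier Γ), ∀ x : X, ∃ m : ℕ, ∀ n ≥ m, E n x (g • x) := by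
    rintro _ ⟨z, hz, rfl⟩ x
    have hfin : {n | ∃ i, x ∈ chartImgSet Φ
        ((Rect.smul ((30 * ℓ : ℕ) : ℝ) (Rect.smul q A)).carrier Γ)
        (bdry Φ (E n) (Rect.smul q A) i)}.Finite := by
      rw [Set.ofPred_exists]
      refine Set.finite_iUnion fun i => Set.Subsingleton.finite fun n hn m hm => ?_
      by_contra hnm
      exact Set.disjoint_left.1 ((horth n m hnm).2.2 i) hn hm
    obtain ⟨b, hb⟩ := hfin.bddAbove
    refine ⟨b + 1, fun n hn => ?_⟩
    obtain ⟨P, Q, e, F, htiling⟩ := (hsub n).exists_roughBoxTiling hfree hH hε0 hq1 hq2 hℓ hA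
      (hEeq n) (horth 0 1 zero_ne_one).2.1 (x := x) fun i hi => by
        have := hb ⟨i, hi⟩
        omega
    simpa [Φ.φ_zero] using
      htiling.rel_zero z ((Rect.mem_carrier_of_isCentered Φ.Z_centered z).1 hz)
  have hall : ∀ g : G, ∀ x : X, ∃ m : ℕ, ∀ n ≥ m, E n x (g • x) := by
    intro g
    have hg : g ∈ Subgroup.closure (Φ.φ '' (Φ.Z.carrier Γ)) := hgen ▸ Subgroup.mem_top g
    induction hg using Subgroup.closure_induction with
    | mem g hg => exact hgenerator g hg
    | one => exact fun x => ⟨0, fun n _ => by simpa using (hEeq n).refl x⟩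
    | mul g h _ _ ihg ihh =>
      intro x
      obtain ⟨m₁, h₁⟩ := ihh x
      obtain ⟨m₂, h₂⟩ := ihg (h • x)
      refine ⟨max m₁ m₂, fun n hn => ?_⟩
      rw [mul_smul]
      exact (hEeq n).trans (h₁ n (le_of_max_le_left hn)) (h₂ n (le_of_max_le_right hn))
    | inv g _ ih =>
      intro x
      obtain ⟨m, hm⟩ := ih (g⁻¹ • x)
      refine ⟨m, fun n hn => (hEeq n).symm ?_⟩
      simpa using hm n hn
  rintro x _ ⟨g, rfl⟩
  exact hall g x
end

section
/- Let G be a countable group acting in a Borel fashion on a Polish space X, let Φ = (ℓ, φ, 𝒵, Γ, ℋ) be a chart for G, let A ⊆ ℤ^ℓ × Γ be a centered rectangle, and let ε, q ∈ ℝ and b ∈ ℕ be positive numbers satisfying 2^{40ℓ}·A ⊆ dom(φ), 2·36²·2^{14ℓ}·𝒵 ⊑ ε·A, and 8ε < q < (1/4)·306⁻¹·ℓ⁻¹·b⁻¹·2^{−22ℓ²}. Let E_1, …, E_s be Borel equivalence relations on X, each (Φ, A, ε)-sub-rectangular, such that for every x ∈ X^ℋ there are at most b integers t ∈ {1, …,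 s} with φ(8·2^{14ℓ}·A)·x ⊄ [x]_{E_t}. Then there exists a finite Borel (Φ, A, ε)-rectangular equivalence relation F on X which is (Φ, q·A)-orthogonal to each E_t. Furthermore, if X is zero-dimensional, the action is continuous and free, ℋ = 𝟙, and each E_t is G-clopen, then F can be chosen to be G-clopen as well. -/
open Pointwise

/-! ### Boolean algebras of sets adapted to a group action -/

/-- A translation-invariant Boolean algebra of subsets of `X` which is closed under gluing along
countable covers and contains enough sets to separate points from finite sets. Borel sets are
one example, clopen sets of a free continuous zero-dimensional action another. -/
structure LocalAlgebra (G X : Type*) [Group G] [MulAction G X] where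
  /-- membership in the algebra -/
  M : Set X → Prop
  univ : M Set.univ
  compl : ∀ {s}, M s → M sᶜ
  inter : ∀ {s t}, M s → M t → M (s ∩ t)
  smul : ∀ (g : G) {s}, M s → M {x | g • x ∈ s}
  glue : ∀ (P : ℕ → Set X) (B : Set X), (∀ n, M (P n)) → (∀ x, ∃ n, x ∈ P n) →
    (∀ n, M (B ∩ P n)) → M B
  fixed : ∀ g : G, M {x | g • x = x}
  separates : ∃ U : ℕ → Set X, (∀ n, M (U n)) ∧
    ∀ (x : X) (T : Set X), T.Finite → x ∉ T → ∃ n, x ∈ U n ∧ Disjoint (U n) T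

namespace LocalAlgebra

variable {G X : Type*} [Group G] [MulAction G X] (𝒜 : LocalAlgebra G X)

lemma not {p : X → Prop} (h : 𝒜.M {x | p x}) : 𝒜.M {x | ¬ p x} := 𝒜.compl h

lemma and {p r : X → Prop} (hp : 𝒜.M {x | p x}) (hr : 𝒜.M {x | r x}) :
    𝒜.M {x | p x ∧ r x} := 𝒜.inter hp hr

lemma or {p r : X → Prop} (hp : 𝒜.M {x | p x}) (hr : 𝒜.M {x | r x}) :
    𝒜.M {x | p x ∨ r x} := by
  have := 𝒜.not (𝒜.and (𝒜.not hp) (𝒜.not hr))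
  convert this using 3
  tauto

lemma imp {p r : X → Prop} (hp : 𝒜.M {x | p x}) (hr : 𝒜.M {x | r x}) :
    𝒜.M {x | p x → r x} := by
  have := 𝒜.or (𝒜.not hp) hr
  convert this using 3
  tauto

lemma iff {p r : X → Prop} (hp : 𝒜.M {x | p x}) (hr : 𝒜.M {x | r x}) :
    𝒜.M {x | p x ↔ r x} := by
  have := 𝒜.and (𝒜.imp hp hr) (𝒜.imp hr hp)
  convert this using 3
  tauto

lemma const (p : Prop) : 𝒜.M {_x : X | p} := by
  by_cases h : p
  · simpa [h] using 𝒜.univ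
  · simpa [h] using 𝒜.compl 𝒜.univ

lemma forall_mem {ι : Type*} {S : Set ι} (hS : S.Finite) {p : ι → X → Prop}
    (h : ∀ i ∈ S, 𝒜.M {x | p i x}) : 𝒜.M {x | ∀ i ∈ S, p i x} := by
  induction S, hS using Set.Finite.induction_on with
  | empty => simpa using 𝒜.univ
  | insert _ _ ih =>
    simp only [Set.forall_mem_insert] at h ⊢
    exact 𝒜.and h.1 (ih h.2)

lemma exists_mem {ι : Type*} {S : Set ι} (hS : S.Finite) {p : ι → X → Prop}
    (h : ∀ i ∈ S, 𝒜.M {x | p i x}) : 𝒜.M {x | ∃ i ∈ S, p i x} := by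
  have := 𝒜.not (𝒜.forall_mem hS fun i hi => 𝒜.not (h i hi))
  convert this using 3
  push Not
  rfl

lemma forall_fin {ι : Type*} [Finite ι] {p : ι → X → Prop}
    (h : ∀ i, 𝒜.M {x | p i x}) : 𝒜.M {x | ∀ i, p i x} := by
  simpa using 𝒜.forall_mem (Set.finite_univ (α := ι)) fun i _ => h i

lemma pred_smul {p : X → Prop} (h : 𝒜.M {x | p x}) (g : G) : 𝒜.M {x | p (g • x)} :=
  𝒜.smul g h

lemma smul_eq (g h : G) : 𝒜.M {x | g • x = h • x} := by
  have := 𝒜.fixed (h⁻¹ * g)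
  convert this using 3
  rw [mul_smul, inv_smul_eq_iff]

/-- A quantifier ranging over finitely many translates of the variable preserves membership. -/
lemma exists_near {p : X → X → Prop} (S : Set G) (hS : S.Finite)
    (hp : ∀ x y, p x y → ∃ g ∈ S, y = g • x) (h : ∀ g : G, 𝒜.M {x | p x (g • x)}) :
    𝒜.M {x | ∃ y, p x y} := by
  have := 𝒜.exists_mem hS fun g _ => h g
  convert this using 3 with x
  constructor
  · rintro ⟨y, hy⟩
    obtain ⟨g, hg, rfl⟩ := hp x y hy
    exact ⟨g, hg, hy⟩
  · rintro ⟨g, -, hy⟩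
    exact ⟨_, hy⟩

/-- Functions all of whose fibers belong to the algebra. -/
def Fibered {β : Type*} (f : X → β) : Prop := ∀ b, 𝒜.M {x | f x = b}

variable {𝒜}

lemma Fibered.glue {β : Type*} [Countable β] {f : X → β} (hf : 𝒜.Fibered f)
    {p : β → X → Prop} (h : ∀ b, 𝒜.M {x | p b x}) : 𝒜.M {x | p (f x) x} := by
  rcases isEmpty_or_nonempty β with hβ | hβ
  · convert 𝒜.univ
    ext x
    exact (hβ.false (f x)).elim
  · obtain ⟨e, he⟩ := exists_surjective_nat β
    refine 𝒜.glue (fun n => {x | f x = e n}) _ (fun n => hf _) (fun x => ?_) fun n => ?_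
    · obtain ⟨n, hn⟩ := he (f x)
      exact ⟨n, hn.symm⟩
    · convert 𝒜.and (h (e n)) (hf (e n)) using 1
      ext x
      simp only [Set.mem_inter_iff, Set.mem_ofPred_eq]
      constructor
      · rintro ⟨h1, h2⟩; exact ⟨h2 ▸ h1, h2⟩
      · rintro ⟨h1, h2⟩; exact ⟨h2 ▸ h1, h2⟩

lemma Fibered.pred {β : Type*} [Countable β] {f : X → β} (hf : 𝒜.Fibered f)
    (p : β → Prop) : 𝒜.M {x | p (f x)} :=
  hf.glue (p := fun b _ => p b) fun _ => 𝒜.const _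

lemma Fibered.comp_smul {β : Type*} {f : X → β} (hf : 𝒜.Fibered f) (g : G) :
    𝒜.Fibered fun x => f (g • x) := fun b => 𝒜.pred_smul (hf b) g

lemma Fibered.pred₂ {β γ : Type*} [Countable β] [Countable γ] {f : X → β} {h : X → γ}
    (hf : 𝒜.Fibered f) (hh : 𝒜.Fibered h) (p : β → γ → Prop) : 𝒜.M {x | p (f x) (h x)} :=
  hf.glue (p := fun b x => p b (h x)) fun _ => hh.pred _

variable (𝒜)

/-- A ranking by natural numbers which distinguishes points related by a given finite set. -/
lemma exists_rank (W : Set G) (hW : W.Finite) :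
    ∃ n : X → ℕ, 𝒜.Fibered n ∧ ∀ x, ∀ w ∈ W, n (w • x) = n x → w • x = x := by
  classical
  obtain ⟨U, hU, hsep⟩ := 𝒜.separates
  let P : ℕ → X → Prop := fun k x => x ∈ U k ∧ ∀ w ∈ W, ¬ w • x = x → ¬ w • x ∈ U k
  have hP : ∀ k, 𝒜.M {x | P k x} := fun k =>
    𝒜.and (hU k) (𝒜.forall_mem hW fun w _ => 𝒜.imp (𝒜.not (𝒜.fixed w))
      (𝒜.not (𝒜.smul w (hU k))))
  have hcov : ∀ x, ∃ k, P k x := by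
    intro x
    obtain ⟨k, hk, hd⟩ := hsep x ((fun w : G => w • x) '' W \ {x}) ((hW.image _).sdiff)
      (by simp)
    refine ⟨k, hk, fun w hw hne hmem => ?_⟩
    exact Set.disjoint_left.1 hd hmem ⟨⟨w, hw, rfl⟩, hne⟩
  refine ⟨fun x => Nat.find (hcov x), fun k => ?_, fun x w hw h => ?_⟩
  · have := 𝒜.and (hP k) (𝒜.forall_mem (Set.finite_Iio k) fun m _ => 𝒜.not (hP m))
    convert this using 3 with x
    rw [Nat.find_eq_iff]
    rfl
  · by_contra hne
    have h1 := (Nat.find_spec (hcov x)).2 w hw hne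
    have h2 := (Nat.find_spec (hcov (w • x))).1
    dsimp only at h
    rw [h] at h2
    exact h1 h2

/-- Recursion along a rank function using finitely many translates stays in the algebra. -/
lemma exists_recursive {β Θ V : Type*} [Countable β] [Countable Θ] [Finite V]
    {n : X → ℕ} (hn : 𝒜.Fibered n) {θ : X → Θ} (hθ : 𝒜.Fibered θ) (γ : V → G)
    (rule : Θ → (V → Option β) → β) :
    ∃ f : X → β, 𝒜.Fibered f ∧ ∀ x, f x =
      rule (θ x) fun v => if n (γ v • x) < n x then some (f (γ v • x)) else none := by
  classical
  let f : X → β := (measure n).wf.fix fun x ih =>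
    rule (θ x) fun v => if h : n (γ v • x) < n x then some (ih (γ v • x) h) else none
  have hf : ∀ x, f x =
      rule (θ x) fun v => if n (γ v • x) < n x then some (f (γ v • x)) else none := by
    intro x
    have := (measure n).wf.fix_eq (fun x ih =>
      rule (θ x) fun v => if h : n (γ v • x) < n x then some (ih (γ v • x) h) else none) x
    simpa only [dite_eq_ite] using this
  refine ⟨f, ?_, hf⟩
  have key : ∀ k b, 𝒜.M {x | n x = k ∧ f x = b} := by
    intro k
    induction k using Nat.strong_induction_on with
    | _ k ih =>
      intro b
      have hpat : 𝒜.Fibered fun x => fun v =>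
          if n (γ v • x) < k then some (f (γ v • x)) else none := by
        intro c
        simp only [funext_iff]
        refine 𝒜.forall_fin fun v => ?_
        have hlt : 𝒜.M {x | n (γ v • x) < k} := (hn.comp_smul (γ v)).pred (· < k)
        rcases hc : c v with _ | d
        · convert 𝒜.not hlt using 3 with x
          simp
        · have := 𝒜.exists_mem (Set.finite_Iio k) fun m hm => 𝒜.pred_smul (ih m hm d) (γ v)
          convert this using 3 with x
          constructor
          · intro hx
            split_ifs at hx with hlt
            exact ⟨_, hlt, rfl, by simpa using hx⟩
          · rintro ⟨m, hm, rfl, rfl⟩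
            exact if_pos hm
      have := 𝒜.and (hn k) (Fibered.pred₂ hθ hpat fun t c => rule t c = b)
      convert this using 3 with x
      refine and_congr_right fun hx => ?_
      rw [hf x, hx]
  intro b
  simpa using hn.glue (p := fun k x => n x = k ∧ f x = b) fun k => key k b

end LocalAlgebra

/-! ### Approximate coordinates supplied by a chart -/

section Coordinates

variable {G : Type*} [Group G] {ℓ : ℕ} {Γ : Type*} [AddCommGroup Γ] (Φ : Chart G ℓ Γ)

lemma Chart.mem_dom {v : Vec ℓ Γ} :
    v ∈ Φ.D.carrier Γ ↔ ∀ j, |v.1 j| ≤ (Φ.D.radius j : ℤ) := by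
  have h : Φ.D.center = 0 := Φ.D_centered
  simp [Rect.carrier, h]

lemma Chart.abs_le_of_mem_Z {v : Vec ℓ Γ} (hv : v ∈ Φ.Z.carrier Γ) (j : Fin ℓ) :
    |v.1 j| ≤ (Φ.Z.radius j : ℤ) := by
  have h : Φ.Z.center = 0 := Φ.Z_centered
  simpa [h] using hv j

variable {Φ} {X : Type*} [MulAction G X]

lemma Chart.coord_inj {x : X} (hx : x ∈ XH Φ X) {v w : Vec ℓ Γ}
    (hv : ∀ j, |v.1 j| ≤ (Φ.D.radius j : ℤ)) (hw : ∀ j, |w.1 j| ≤ (Φ.D.radius j : ℤ))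
    (h : Φ.φ v • x = Φ.φ w • x) : v = w := by
  refine Φ.coset_inj v (Φ.mem_dom.2 hv) w (Φ.mem_dom.2 hw) _ hx ?_
  rw [MulAction.mem_stabilizer_iff, mul_smul, h, inv_smul_smul]

lemma smul_eq_of_inv_mul_mem_stabilizer {x : X} {g h : G}
    (H : h⁻¹ * g ∈ MulAction.stabilizer G x) : g • x = h • x := by
  rw [MulAction.mem_stabilizer_iff, mul_smul, inv_smul_eq_iff] at H
  exact H

lemma Chart.coord_mul {x : X} (hx : x ∈ XH Φ X) {r s : Vec ℓ Γ}
    (hr : ∀ j, |r.1 j| ≤ (Φ.D.radius j : ℤ)) (hs : ∀ j, |s.1 j| ≤ (Φ.D.radius j : ℤ))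
    (hrs : ∀ j, |r.1 j + s.1 j| + Φ.Z.radius j ≤ (Φ.D.radius j : ℤ)) :
    ∃ w : Vec ℓ Γ, (∀ j, |w.1 j - (r.1 j + s.1 j)| ≤ (Φ.Z.radius j : ℤ)) ∧
      Φ.φ r • Φ.φ s • x = Φ.φ w • x := by
  obtain ⟨z, hz, h⟩ := Φ.mul_mem r (Φ.mem_dom.2 hr) s (Φ.mem_dom.2 hs) _ hx (by
    rintro _ ⟨z, hz, rfl⟩
    rw [Φ.mem_dom]
    intro j
    have h1 := hrs j
    have h2 := Φ.abs_le_of_mem_Z hz j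
    have h3 := abs_add_le (r.1 j + s.1 j) (z.1 j)
    simp only [Prod.fst_add, Pi.add_apply]
    omega)
  refine ⟨r + s + z, fun j => ?_, ?_⟩
  · simpa using Φ.abs_le_of_mem_Z hz j
  · rw [← mul_smul]
    exact smul_eq_of_inv_mul_mem_stabilizer h

/-- Change of base point: coordinates relative to `y` become coordinates relative to
`x = φ(d)·y`. -/
lemma Chart.coord_rebase {x y : X} (hx : x ∈ XH Φ X) {d g : Vec ℓ Γ} (hxy : x = Φ.φ d • y)
    (hd : ∀ j, |d.1 j| ≤ (Φ.D.radius j : ℤ)) (hg : ∀ j, |g.1 j| ≤ (Φ.D.radius j : ℤ))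
    (hdg : ∀ j, |g.1 j - d.1 j| + Φ.Z.radius j ≤ (Φ.D.radius j : ℤ)) :
    ∃ w : Vec ℓ Γ, (∀ j, |w.1 j - (g.1 j - d.1 j)| ≤ (Φ.Z.radius j : ℤ)) ∧
      Φ.φ g • y = Φ.φ w • x := by
  obtain ⟨z, hz, h⟩ := Φ.mul_inv_mem g (Φ.mem_dom.2 hg) d (Φ.mem_dom.2 hd) _ hx (by
    rintro _ ⟨z, hz, rfl⟩
    rw [Φ.mem_dom]
    intro j
    have h1 := hdg j
    have h2 := Φ.abs_le_of_mem_Z hz j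
    have h3 := abs_add_le (g.1 j - d.1 j) (z.1 j)
    simp only [Prod.fst_add, Pi.add_apply, Prod.fst_sub, Pi.sub_apply]
    omega)
  refine ⟨g - d + z, fun j => ?_, ?_⟩
  · simpa using Φ.abs_le_of_mem_Z hz j
  · have := smul_eq_of_inv_mul_mem_stabilizer h
    rwa [mul_smul, hxy, inv_smul_smul, ← hxy] at this

lemma Chart.coord_inv {x y : X} (hx : x ∈ XH Φ X) {d : Vec ℓ Γ} (hxy : x = Φ.φ d • y)
    (hd : ∀ j, |d.1 j| + Φ.Z.radius j ≤ (Φ.D.radius j : ℤ)) :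
    ∃ w : Vec ℓ Γ, (∀ j, |w.1 j + d.1 j| ≤ (Φ.Z.radius j : ℤ)) ∧ y = Φ.φ w • x := by
  obtain ⟨w, hw, h⟩ := Chart.coord_rebase hx hxy (g := 0)
    (fun j => by have := hd j; omega) (fun j => by simp) (fun j => by simpa using hd j)
  refine ⟨w, fun j => by simpa using hw j, ?_⟩
  rwa [Φ.φ_zero, one_smul] at h

/-- Two base points with a common chart point are close to each other. -/
lemma Chart.coord_common {y y' : X} (hy : y ∈ XH Φ X) {r s : Vec ℓ Γ}
    (h : Φ.φ r • y' = Φ.φ s • y)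
    (hr : ∀ j, |r.1 j| ≤ (Φ.D.radius j : ℤ)) (hs : ∀ j, |s.1 j| ≤ (Φ.D.radius j : ℤ))
    (hrs : ∀ j, |s.1 j - r.1 j| + Φ.Z.radius j ≤ (Φ.D.radius j : ℤ)) :
    ∃ w : Vec ℓ Γ, (∀ j, |w.1 j - (s.1 j - r.1 j)| ≤ (Φ.Z.radius j : ℤ)) ∧
      y' = Φ.φ w • y := by
  obtain ⟨z, hz, h'⟩ := Φ.inv_mul_mem r (Φ.mem_dom.2 hr) s (Φ.mem_dom.2 hs) _ hy (by
    rintro _ ⟨z, hz, rfl⟩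
    rw [Φ.mem_dom]
    intro j
    have h1 := hrs j
    have h2 := Φ.abs_le_of_mem_Z hz j
    have h3 := abs_add_le (s.1 j - r.1 j) (z.1 j)
    have h4 : (-r + s + z).1 j = s.1 j - r.1 j + z.1 j := by
      simp only [Prod.fst_add, Pi.add_apply, Prod.fst_neg, Pi.neg_apply]; ring
    rw [h4]
    omega)
  refine ⟨-r + s + z, fun j => ?_, ?_⟩
  · have h4 : (-r + s + z).1 j - (s.1 j - r.1 j) = z.1 j := by
      simp only [Prod.fst_add, Pi.add_apply, Prod.fst_neg, Pi.neg_apply]; ring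
    rw [h4]
    exact Φ.abs_le_of_mem_Z hz j
  · have := smul_eq_of_inv_mul_mem_stabilizer h'
    rwa [mul_smul, ← h, inv_smul_smul] at this

lemma Vec.finite_box (Φ : Chart G ℓ Γ) (r : Fin ℓ → ℤ) :
    {v : Vec ℓ Γ | ∀ j, |v.1 j| ≤ r j}.Finite := by
  have := Φ.Γ_finite
  refine ((Set.Finite.pi' fun j => Set.finite_Icc (-(r j)) (r j)).prod
    (Set.finite_univ (α := Γ))).subset ?_
  intro v hv
  exact ⟨fun j => abs_le.1 (hv j), trivial⟩

end Coordinates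

/-! ### Pigeonhole tools -/

lemma exists_cube_index {ℓ : ℕ} (R c : Fin ℓ → ℤ) (N : ℕ) (hc : ∀ j, 0 < c j)
    (hR : ∀ j, 4 * R j ≤ N * c j) :
    ∃ idx : (Fin ℓ → ℤ) → (Fin ℓ → Fin (N + 1)), ∀ u u' : Fin ℓ → ℤ,
      (∀ j, |u j| ≤ R j) → (∀ j, |u' j| ≤ R j) → idx u = idx u' →
        ∀ j, 2 * |u j - u' j| < c j := by
  refine ⟨fun u j => Fin.ofNat (N + 1) (2 * (u j + R j) / c j).toNat, ?_⟩
  intro u u' hu hu' h j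
  have bound : ∀ v : Fin ℓ → ℤ, (∀ j, |v j| ≤ R j) →
      0 ≤ 2 * (v j + R j) / c j ∧ 2 * (v j + R j) / c j < N + 1 := by
    intro v hv
    have h1 := abs_le.1 (hv j)
    constructor
    · exact Int.ediv_nonneg (by omega) (hc j).le
    · refine Int.ediv_lt_of_lt_mul (hc j) ?_
      have := hR j
      have := hc j
      linarith
  have h1 := bound u hu
  have h2 := bound u' hu'
  have h3 := congrArg Fin.val (congrFun h j)
  simp only [Fin.ofNat] at h3
  rw [Nat.mod_eq_of_lt (by omega), Nat.mod_eq_of_lt (by omega)] at h3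
  have h4 : 2 * (u j + R j) / c j = 2 * (u' j + R j) / c j := by omega
  have h5 := Int.mul_ediv_add_emod (2 * (u j + R j)) (c j)
  have h6 := Int.mul_ediv_add_emod (2 * (u' j + R j)) (c j)
  have h7 := Int.emod_lt_of_pos (2 * (u j + R j)) (hc j)
  have h8 := Int.emod_lt_of_pos (2 * (u' j + R j)) (hc j)
  have h9 := Int.emod_nonneg (2 * (u j + R j)) (hc j).ne'
  have h10 := Int.emod_nonneg (2 * (u' j + R j)) (hc j).ne'
  rw [h4] at h5
  rcases abs_cases (u j - u' j) with ⟨h12, _⟩ | ⟨h12, _⟩ <;> rw [h12] <;> linarith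

/-- A family of integers which is `r`-clustered within each of finitely many keys is covered by
one center per key. -/
lemma exists_centers {ι κ : Type*} [Finite κ] (S : Set ι) (f : ι → ℤ) (key : ι → κ) (r : ℤ)
    (h : ∀ s ∈ S, ∀ t ∈ S, key s = key t → |f s - f t| ≤ r) :
    ∃ C : Finset ℤ, C.card ≤ Nat.card κ ∧ ∀ s ∈ S, ∃ c ∈ C, |f s - c| ≤ r := by
  classical
  have := Fintype.ofFinite κ
  let rep : κ → ℤ := fun k => if h : ∃ s ∈ S, key s = k then f h.choose else 0
  refine ⟨Finset.univ.image rep, ?_, fun s hs => ⟨rep (key s), by simp, ?_⟩⟩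
  · rw [Nat.card_eq_fintype_card]
    exact Finset.card_image_le
  · have hex : ∃ t ∈ S, key t = key s := ⟨s, hs, rfl⟩
    simp only [rep, dif_pos hex]
    exact h s hs _ hex.choose_spec.1 hex.choose_spec.2.symm

/-- A long enough integer interval contains a point far from two given finite sets. -/
lemma exists_int_avoiding (lo L : ℤ) (C₁ C₂ : Finset ℤ) (r₁ r₂ N₁ N₂ : ℤ)
    (h₁ : 0 ≤ r₁) (h₂ : 0 ≤ r₂) (hN₁ : (C₁.card : ℤ) ≤ N₁) (hN₂ : (C₂.card : ℤ) ≤ N₂)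
    (hL : (2 * r₁ + 1) * N₁ + (2 * r₂ + 1) * N₂ ≤ L) :
    ∃ τ, lo ≤ τ ∧ τ ≤ lo + L ∧ (∀ c ∈ C₁, r₁ < |τ - c|) ∧ ∀ c ∈ C₂, r₂ < |τ - c| := by
  classical
  by_contra hcon
  push Not at hcon
  have hcov : Finset.Icc lo (lo + L) ⊆
      C₁.biUnion (fun c => Finset.Icc (c - r₁) (c + r₁)) ∪
      C₂.biUnion (fun c => Finset.Icc (c - r₂) (c + r₂)) := by
    intro τ hτ
    rw [Finset.mem_Icc] at hτ
    rw [Finset.mem_union, Finset.mem_biUnion, Finset.mem_biUnion]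
    by_cases hc : ∀ c ∈ C₁, r₁ < |τ - c|
    · obtain ⟨c, hc, hle⟩ := hcon τ hτ.1 hτ.2 hc
      rw [abs_le] at hle
      exact Or.inr ⟨c, hc, Finset.mem_Icc.2 (by omega)⟩
    · push Not at hc
      obtain ⟨c, hc, hle⟩ := hc
      rw [abs_le] at hle
      exact Or.inl ⟨c, hc, Finset.mem_Icc.2 (by omega)⟩
  have hcard := (Finset.card_le_card hcov).trans (Finset.card_union_le _ _)
  have hle : ∀ (C : Finset ℤ) (r : ℤ), 0 ≤ r →
      ((C.biUnion (fun c => Finset.Icc (c - r) (c + r))).card : ℤ) ≤ (2 * r + 1) * C.card := by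
    intro C r hr
    have := Finset.card_biUnion_le_card_mul C (fun c => Finset.Icc (c - r) (c + r))
      (2 * r + 1).toNat (fun c _ => by rw [Int.card_Icc]; omega)
    have h3 : ((2 * r + 1).toNat : ℤ) = 2 * r + 1 := Int.toNat_of_nonneg (by omega)
    calc _ ≤ ((C.card * (2 * r + 1).toNat : ℕ) : ℤ) := by exact_mod_cast this
      _ = _ := by push_cast [h3]; ring
  have e1 := hle C₁ r₁ h₁
  have e2 := hle C₂ r₂ h₂
  rw [Int.card_Icc] at hcard
  have e3 := mul_le_mul_of_nonneg_left hN₁ (show 0 ≤ 2 * r₁ + 1 by omega)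
  have e4 := mul_le_mul_of_nonneg_left hN₂ (show 0 ≤ 2 * r₂ + 1 by omega)
  have e5 : (lo + L + 1 - lo).toNat ≥ L + 1 := by omega
  zify at hcard
  omega

/-! ### Counting the boundary levels of rectangular relations -/

/-- The comparable length scales of the construction, coordinate by coordinate: `k` is the radius
at which boundaries are tested, `e` the error allowed for rough rectangles, `a` the least radius of
a rectangle, and `L = K a` the size of the largest rectangles. -/
structure Scales {G : Type*} [Group G] {ℓ : ℕ} {Γ : Type*} [AddCommGroup Γ] (Φ : Chart G ℓ Γ)
    (K b : ℕ) (a e k L : Fin ℓ → ℤ) : Prop where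
  z_pos : ∀ j, 1 ≤ (Φ.Z.radius j : ℤ)
  z_e : ∀ j, 1000 * (Φ.Z.radius j : ℤ) ≤ e j
  e_k : ∀ j, 8 * e j ≤ k j
  k_le : ∀ j, k j ≤ ℓ * k j
  k_a : ∀ j, 1000 * (ℓ * k j) ≤ a j
  a_L : ∀ j, 4096 * a j ≤ L j
  L_eq : ∀ j, L j = K * a j
  L_D : ∀ j, 100 * L j ≤ Φ.D.radius j
  count : ∀ j, (2 * (4 * a j) + 1) * (2 * 65 ^ ℓ) +
    (2 * (63 * (ℓ * k j) + 5 * k j) + 1) * (b * ((48 * K + 1) ^ ℓ * 2 ^ ℓ)) ≤ L j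

section Boundary

variable {G : Type*} [Group G] {ℓ : ℕ} {Γ : Type*} [AddCommGroup Γ] {Φ : Chart G ℓ Γ}
  {X : Type*} [MulAction G X]

/-- `v` lies on the face perpendicular to `𝐞_i`, in direction `σ`, of the box of radius `k`. -/
def OnFace (k : Fin ℓ → ℤ) (i : Fin ℓ) (σ : ℤ) (v : Vec ℓ Γ) : Prop :=
  v.1 i = σ * k i ∧ ∀ j, j ≠ i → |v.1 j| ≤ k j

/-- Elementwise form of membership in the boundary `∂_i`. -/
def OnBoundary (Φ : Chart G ℓ Γ) (E : X → X → Prop) (k : Fin ℓ → ℤ) (i : Fin ℓ) (x : X) : Prop :=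
  x ∈ XH Φ X ∧ ∀ v w : Vec ℓ Γ, OnFace k i (-1) v → OnFace k i 1 w →
    ¬ E (Φ.φ v • x) (Φ.φ w • x)

/-- `U` is sandwiched, in coordinates at `y`, between two boxes with common center `m` and radii
`I` and `O` differing by at most `e + 1`. -/
structure IsRoughBox (Φ : Chart G ℓ Γ) (a e : Fin ℓ → ℤ) (U : Set X) (y : X)
    (m I O : Fin ℓ → ℤ) : Prop where
  base : y ∈ XH Φ X
  inner : ∀ v : Vec ℓ Γ, (∀ j, |v.1 j - m j| ≤ I j) → Φ.φ v • y ∈ U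
  outer : ∀ p ∈ U, ∃ v : Vec ℓ Γ, (∀ j, |v.1 j - m j| ≤ O j) ∧ p = Φ.φ v • y
  error : ∀ j, O j ≤ I j + e j + 1
  large : ∀ j, a j ≤ O j
  dom : ∀ j, |m j| + 4 * O j ≤ Φ.D.radius j

variable {K b : ℕ} {a e k L : Fin ℓ → ℤ}

/-- All linear relations between the scales in one coordinate. -/
lemma Scales.lin (hS : Scales Φ K b a e k L)
    (j : Fin ℓ) :
    1 ≤ (Φ.Z.radius j : ℤ) ∧ 1000 * (Φ.Z.radius j : ℤ) ≤ e j ∧ 8 * e j ≤ k j ∧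
      k j ≤ ℓ * k j ∧ 1000 * (ℓ * k j) ≤ a j ∧ 4096 * a j ≤ L j ∧
      100 * L j ≤ Φ.D.radius j :=
  ⟨hS.z_pos j, hS.z_e j, hS.e_k j, hS.k_le j, hS.k_a j, hS.a_L j, hS.L_D j⟩

/-- A boundary point lies close to a face of any rough box contained in a single class. -/
lemma OnBoundary.near_face (hS : Scales Φ K b a e k L)
    {E : X → X → Prop} {i : Fin ℓ} {x y : X} {U : Set X}
    {m I O : Fin ℓ → ℤ} (hx : OnBoundary Φ E k i x) (hU : IsRoughBox Φ a e U y m I O)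
    (hUE : ∀ p ∈ U, ∀ p' ∈ U, E p p') {c : Vec ℓ Γ} (hc : ∀ j, |c.1 j - m j| ≤ O j)
    (hxc : x = Φ.φ c • y) : I i - k i - Φ.Z.radius i < |c.1 i - m i| := by
  by_contra hcon
  push Not at hcon
  have move : ∀ σ : ℤ, (σ = 1 ∨ σ = -1) → ∃ v : Vec ℓ Γ, OnFace k i σ v ∧ Φ.φ v • x ∈ U := by
    intro σ hσ
    let v : Vec ℓ Γ := (fun j => if j = i then σ * k i else
      if c.1 j ≤ m j then k j else - k j, 0)
    have hvk : ∀ j, |v.1 j| ≤ k j := by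
      intro j
      have := hS.lin j
      rw [abs_le]
      by_cases hj : j = i
      · subst hj
        simp only [v, if_true]
        rcases hσ with rfl | rfl <;> omega
      · simp only [v, if_neg hj]
        split_ifs <;> omega
    have hshift : ∀ j, |v.1 j + c.1 j - m j| ≤ I j - Φ.Z.radius j := by
      intro j
      have h1 := hS.lin j
      have h2 := hU.error j
      have h3 := hU.large j
      have h4 := abs_le.1 (hc j)
      rw [abs_le]
      by_cases hj : j = i
      · subst hj
        have h5 := abs_le.1 hcon
        simp only [v, if_true]
        rcases hσ with rfl | rfl <;> omega
      · simp only [v, if_neg hj]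
        split_ifs <;> omega
    refine ⟨v, ⟨by simp [v], fun j _ => hvk j⟩, ?_⟩
    have hdom : ∀ j, |c.1 j| ≤ Φ.D.radius j ∧ |v.1 j| ≤ Φ.D.radius j ∧
        |v.1 j + c.1 j| + Φ.Z.radius j ≤ Φ.D.radius j := by
      intro j
      have h1 := hS.lin j
      have h2 := hU.dom j
      have h3 := hU.large j
      have h4 := hU.error j
      have h5 := abs_le.1 (hc j)
      have h6 := abs_le.1 (hvk j)
      have h7 := neg_abs_le (m j)
      have h8 := le_abs_self (m j)
      refine ⟨abs_le.2 ?_, abs_le.2 ?_, ?_⟩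
      · omega
      · omega
      · have : |v.1 j + c.1 j| ≤ Φ.D.radius j - Φ.Z.radius j := abs_le.2 (by omega)
        omega
    obtain ⟨w, hw, hw'⟩ := Chart.coord_mul hU.base (r := v) (s := c)
      (fun j => (hdom j).2.1) (fun j => (hdom j).1) (fun j => (hdom j).2.2)
    rw [hxc, hw']
    refine hU.inner w fun j => ?_
    have h1 := abs_le.1 (hw j)
    have h2 := abs_le.1 (hshift j)
    exact abs_le.2 (by omega)
  obtain ⟨v, hv, hvU⟩ := move (-1) (Or.inr rfl)
  obtain ⟨w, hw, hwU⟩ := move 1 (Or.inl rfl)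
  exact hx.2 v w hv hw (hUE _ hvU _ hwU)

end Boundary

section BoundaryLevels

variable {G : Type*} [Group G] {ℓ : ℕ} {Γ : Type*} [AddCommGroup Γ] {Φ : Chart G ℓ Γ}
  {X : Type*} [MulAction G X]

/-- `w` points well into the orthant of `ℤ^ℓ` described by the signs `η`. -/
def InOrthant (a : Fin ℓ → ℤ) (η : Fin ℓ → Bool) (w : Vec ℓ Γ) : Prop :=
  ∀ j, (η j = true → a j ≤ 5 * w.1 j ∧ 5 * w.1 j ≤ 4 * a j) ∧
    (η j = false → a j ≤ -(5 * w.1 j) ∧ -(5 * w.1 j) ≤ 4 * a j)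

/-- Moving from `x` into the orthant `η` stays in the class of `x`. -/
def IsInward (Φ : Chart G ℓ Γ) (a : Fin ℓ → ℤ) (F : X → X → Prop) (η : Fin ℓ → Bool)
    (x : X) : Prop :=
  ∀ w : Vec ℓ Γ, InOrthant a η w → F x (Φ.φ w • x)

variable {K b : ℕ} {a e k L : Fin ℓ → ℤ}

lemma InOrthant.abs_le {Γ : Type*} (ha : ∀ j, 0 ≤ a j) {η : Fin ℓ → Bool} {w : Vec ℓ Γ}
    (hw : InOrthant a η w) (j : Fin ℓ) : |w.1 j| ≤ a j := by
  have h1 := hw j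
  have h2 := ha j
  rw [_root_.abs_le]
  cases h : η j
  · have := h1.2 h; omega
  · have := h1.1 h; omega


lemma IsRoughBox.coord_add (hS : Scales Φ K b a e k L)
    {y : X} {U : Set X} {m I O : Fin ℓ → ℤ}
    (hU : IsRoughBox Φ a e U y m I O) {c : Vec ℓ Γ} (hc : ∀ j, |c.1 j - m j| ≤ O j)
    {w : Vec ℓ Γ} (hw : ∀ j, |w.1 j| ≤ a j) :
    ∃ v : Vec ℓ Γ, (∀ j, |v.1 j - (w.1 j + c.1 j)| ≤ (Φ.Z.radius j : ℤ)) ∧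
      (∀ j, |v.1 j| ≤ Φ.D.radius j) ∧ Φ.φ w • Φ.φ c • y = Φ.φ v • y := by
  have hdom : ∀ j, |c.1 j| ≤ Φ.D.radius j ∧ |w.1 j| ≤ Φ.D.radius j ∧
      |w.1 j + c.1 j| + Φ.Z.radius j ≤ Φ.D.radius j := by
    intro j
    have h1 := hS.lin j
    have h2 := hU.dom j
    have h3 := hU.large j
    have h5 := _root_.abs_le.1 (hc j)
    have h6 := _root_.abs_le.1 (hw j)
    have h7 := neg_abs_le (m j)
    have h8 := le_abs_self (m j)
    refine ⟨_root_.abs_le.2 ?_, _root_.abs_le.2 ?_, ?_⟩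
    · omega
    · omega
    · have : |w.1 j + c.1 j| ≤ Φ.D.radius j - Φ.Z.radius j := _root_.abs_le.2 (by omega)
      omega
  obtain ⟨v, hv, hv'⟩ := Chart.coord_mul hU.base (r := w) (s := c)
    (fun j => (hdom j).2.1) (fun j => (hdom j).1) (fun j => (hdom j).2.2)
  refine ⟨v, hv, fun j => ?_, hv'⟩
  have h1 := (hdom j).2.2
  have h2 := abs_sub_abs_le_abs_sub (v.1 j) (w.1 j + c.1 j)
  have h3 := hv j
  omega

lemma IsRoughBox.exists_isInward (hS : Scales Φ K b a e k L)
    {F : X → X → Prop} {x y : X} (hxx : F x x)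
    {m I O : Fin ℓ → ℤ} (hU : IsRoughBox Φ a e (eqClass F x) y m I O) :
    ∃ η, IsInward Φ a F η x := by
  obtain ⟨c, hc, hxc⟩ := hU.outer x hxx
  refine ⟨fun j => decide (c.1 j ≤ m j), fun w hw => ?_⟩
  have hwa := hw.abs_le fun j => by have := hS.lin j; omega
  obtain ⟨v, hv, -, hv'⟩ := hU.coord_add hS hc hwa
  rw [hxc, hv', ← hxc]
  refine hU.inner v fun j => ?_
  have h1 := hS.lin j
  have h3 := hU.large j
  have h4 := hU.error j
  have h5 := abs_le.1 (hc j)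
  have h6 := abs_le.1 (hv j)
  have h7 := hw j
  rw [abs_le]
  by_cases h : c.1 j ≤ m j
  · have := h7.1 (by simpa using h)
    omega
  · have := h7.2 (by simpa using h)
    omega

/-- Nearby points with a common inward orthant are equivalent. -/
lemma IsInward.related (hS : Scales Φ K b a e k L)
    {F : X → X → Prop} (hF : Equivalence F) {η : Fin ℓ → Bool} {x x' y : X}
    (hx : x ∈ XH Φ X) (hx' : x' ∈ XH Φ X) (hη : IsInward Φ a F η x) (hη' : IsInward Φ a F η x')
    {d d' : Vec ℓ Γ} (hd : ∀ j, |d.1 j| ≤ 12 * L j) (hd' : ∀ j, |d'.1 j| ≤ 12 * L j)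
    (hxd : x = Φ.φ d • y) (hxd' : x' = Φ.φ d' • y)
    (hdd : ∀ j, 2 * |d.1 j - d'.1 j| < a j) : F x x' := by
  let g : Vec ℓ Γ := (fun j => if η j then max (d.1 j) (d'.1 j) + a j / 4
    else min (d.1 j) (d'.1 j) - a j / 4, 0)
  have key : ∀ (x₀ : X) (d₀ : Vec ℓ Γ), x₀ ∈ XH Φ X → IsInward Φ a F η x₀ →
      (∀ j, |d₀.1 j| ≤ 12 * L j) → x₀ = Φ.φ d₀ • y →
      (∀ j, (η j = true → d₀.1 j + a j / 4 ≤ g.1 j ∧ 2 * g.1 j ≤ 2 * d₀.1 j + 2 * (a j / 4) + a j)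
        ∧ (η j = false → g.1 j ≤ d₀.1 j - a j / 4 ∧
          2 * d₀.1 j - 2 * (a j / 4) - a j ≤ 2 * g.1 j)) →
      F x₀ (Φ.φ g • y) := by
    intro x₀ d₀ hx₀ hη₀ hd₀ hxd₀ hg
    have hlin : ∀ j, |g.1 j - d₀.1 j| ≤ a j := by
      intro j
      have h1 := hS.lin j
      have h2 := hg j
      rw [abs_le]
      cases h : η j
      · have := h2.2 h; omega
      · have := h2.1 h; omega
    obtain ⟨w, hw, hw'⟩ := Chart.coord_rebase hx₀ hxd₀ (g := g)
      (fun j => by have := hS.lin j; have := hd₀ j; omega)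
      (fun j => by
        have := hS.lin j; have := abs_le.1 (hd₀ j); have := abs_le.1 (hlin j)
        rw [abs_le]; omega)
      (fun j => by have := hS.lin j; have := hlin j; omega)
    rw [hw']
    refine hη₀ w fun j => ?_
    have h1 := hS.lin j
    have h2 := hg j
    have h3 := abs_le.1 (hw j)
    constructor
    · intro h; have := h2.1 h; omega
    · intro h; have := h2.2 h; omega
  refine hF.trans (key x d hx hη hd hxd fun j => ?_)
    (hF.symm (key x' d' hx' hη' hd' hxd' fun j => ?_))
  all_goals
    have h1 : -(a j) < 2 * (d.1 j - d'.1 j) ∧ 2 * (d.1 j - d'.1 j) < a j := by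
      have := hdd j
      have := neg_abs_le (d.1 j - d'.1 j)
      have := le_abs_self (d.1 j - d'.1 j)
      omega
    constructor
    · intro h
      simp only [g, h, if_true]
      omega
    · intro h
      simp only [g, h, Bool.false_eq_true, if_false]
      omega

/-- An inward boundary point of a rough box lies near the face it points away from. -/
lemma OnBoundary.coord_of_isInward (hS : Scales Φ K b a e k L)
    {F : X → X → Prop} (hF : Equivalence F) {i : Fin ℓ}
    {x x' y : X} {m I O : Fin ℓ → ℤ} (hU : IsRoughBox Φ a e (eqClass F x) y m I O)
    (hxx' : F x x') (hx' : OnBoundary Φ F k i x') {η : Fin ℓ → Bool} (hη : IsInward Φ a F η x')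
    {c : Vec ℓ Γ} (hc : ∀ j, |c.1 j - m j| ≤ O j) (hxc : x' = Φ.φ c • y) :
    (η i = true → c.1 i < m i - (I i - k i - Φ.Z.radius i)) ∧
      (η i = false → m i + (I i - k i - Φ.Z.radius i) < c.1 i) := by
  have hnear := hx'.near_face hS hU
    (fun p hp p' hp' => hF.trans (hF.symm hp) hp') hc hxc
  let w : Vec ℓ Γ := (fun j => if η j then a j / 2 else -(a j / 2), 0)
  have hw : InOrthant a η w := by
    intro j
    have h1 := hS.lin j
    constructor
    · intro h; simp only [w, h, if_true]; omega
    · intro h; simp only [w, h, Bool.false_eq_true, if_false]; omega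
  have hwa := hw.abs_le fun j => by have := hS.lin j; omega
  obtain ⟨v, hv, hvD, hv'⟩ := hU.coord_add hS hc hwa
  obtain ⟨u, hu, hu'⟩ := hU.outer _ (hF.trans hxx' (hη w hw))
  have huv : v = u := by
    refine Chart.coord_inj hU.base hvD (fun j => ?_) ?_
    · have h2 := hU.dom j
      have h3 := hU.large j
      have h5 := abs_le.1 (hu j)
      have h7 := neg_abs_le (m j)
      have h8 := le_abs_self (m j)
      have h1 := hS.lin j
      exact abs_le.2 (by omega)
    · rw [← hv', ← hu', ← hxc]
  subst huv
  have h1 := hS.lin i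
  have h2 := abs_le.1 (hu i)
  have h3 := abs_le.1 (hv i)
  have h4 := hU.error i
  constructor
  · intro h
    have h5 : w.1 i = a i / 2 := by simp [w, h]
    rcases lt_abs.1 hnear with h6 | h6 <;> omega
  · intro h
    have h5 : w.1 i = -(a i / 2) := by simp [w, h]
    rcases lt_abs.1 hnear with h6 | h6 <;> omega

lemma OnBoundary.levels_close (hS : Scales Φ K b a e k L)
    {F : X → X → Prop} (hF : Equivalence F) {i : Fin ℓ}
    {x x' y y₀ : X} {m I O : Fin ℓ → ℤ} (hU : IsRoughBox Φ a e (eqClass F x) y₀ m I O)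
    (hxx' : F x x') (hx : OnBoundary Φ F k i x) (hx' : OnBoundary Φ F k i x')
    {η : Fin ℓ → Bool} (hη : IsInward Φ a F η x) (hη' : IsInward Φ a F η x')
    {d d' : Vec ℓ Γ} (hd : ∀ j, |d.1 j| ≤ 12 * L j) (hd' : ∀ j, |d'.1 j| ≤ 12 * L j)
    (hxd : x = Φ.φ d • y) (hxd' : x' = Φ.φ d' • y) : |d.1 i - d'.1 i| ≤ 5 * k i := by
  obtain ⟨c, hc, hxc⟩ := hU.outer x (hF.refl x)
  obtain ⟨c', hc', hxc'⟩ := hU.outer x' hxx'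
  have hf := hx.coord_of_isInward hS hF hU (hF.refl x) hη hc hxc
  have hf' := hx'.coord_of_isInward hS hF hU hxx' hη' hc' hxc'
  have hcD : ∀ j, -(Φ.D.radius j : ℤ) ≤ c.1 j ∧ c.1 j ≤ Φ.D.radius j ∧
      -(Φ.D.radius j : ℤ) ≤ c'.1 j ∧ c'.1 j ≤ Φ.D.radius j ∧
      -(Φ.D.radius j - 2 * Φ.Z.radius j : ℤ) ≤ c'.1 j - c.1 j ∧
      c'.1 j - c.1 j ≤ Φ.D.radius j - 2 * Φ.Z.radius j := by
    intro j
    have h1 := hS.lin j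
    have h2 := hU.dom j
    have h3 := hU.large j
    have h5 := abs_le.1 (hc j)
    have h6 := abs_le.1 (hc' j)
    have h7 := neg_abs_le (m j)
    have h8 := le_abs_self (m j)
    omega
  have hcc : ∀ j, |c'.1 j - c.1 j| + 2 * Φ.Z.radius j ≤ Φ.D.radius j := fun j => by
    have : |c'.1 j - c.1 j| ≤ Φ.D.radius j - 2 * Φ.Z.radius j :=
      abs_le.2 ⟨(hcD j).2.2.2.2.1, (hcD j).2.2.2.2.2⟩
    omega
  obtain ⟨w, hw, hw'⟩ := Chart.coord_rebase hx.1 hxc (g := c')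
    (fun j => abs_le.2 ⟨(hcD j).1, (hcD j).2.1⟩)
    (fun j => abs_le.2 ⟨(hcD j).2.2.1, (hcD j).2.2.2.1⟩)
    (fun j => by have := hcc j; omega)
  have hdd : ∀ j, |d'.1 j - d.1 j| ≤ 24 * L j := fun j => by
    have h1 := abs_le.1 (hd j)
    have h2 := abs_le.1 (hd' j)
    exact abs_le.2 (by omega)
  obtain ⟨u, hu, hu'⟩ := Chart.coord_rebase hx.1 hxd (g := d')
    (fun j => by have := hS.lin j; have := hd j; omega)
    (fun j => by have := hS.lin j; have := hd' j; omega)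
    (fun j => by have := hS.lin j; have := hdd j; omega)
  have hwu : w = u := by
    refine Chart.coord_inj hx.1 (fun j => ?_) (fun j => ?_) ?_
    · have h2 := abs_sub_abs_le_abs_sub (w.1 j) (c'.1 j - c.1 j)
      have := hw j; have := hcc j; omega
    · have h2 := abs_sub_abs_le_abs_sub (u.1 j) (d'.1 j - d.1 j)
      have := hu j; have := hdd j; have := hS.lin j; omega
    · rw [← hw', ← hu', ← hxc', ← hxd']
  subst hwu
  have h1 := hS.lin i
  have h2 := abs_le.1 (hu i)
  have h3 := abs_le.1 (hw i)
  have h4 := abs_le.1 (hc i)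
  have h5 := abs_le.1 (hc' i)
  have h6 := hU.error i
  rw [abs_le]
  cases h : η i
  · have := hf.2 h; have := hf'.2 h; omega
  · have := hf.1 h; have := hf'.1 h; omega

lemma OnBoundary.not_related_near (hS : Scales Φ K b a e k L)
    {E : X → X → Prop} (hE : Equivalence E) {i : Fin ℓ}
    {y : X} (hy : y ∈ XH Φ X) {d : Vec ℓ Γ} (hd : ∀ j, |d.1 j| ≤ 12 * L j)
    (h : OnBoundary Φ E k i (Φ.φ d • y)) :
    ∃ v : Vec ℓ Γ, (∀ j, |v.1 j| ≤ 16 * L j) ∧ ¬ E y (Φ.φ v • y) := by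
  by_contra hcon
  push Not at hcon
  have move : ∀ σ : ℤ, (σ = 1 ∨ σ = -1) →
      ∃ v : Vec ℓ Γ, OnFace k i σ v ∧ E y (Φ.φ v • Φ.φ d • y) := by
    intro σ hσ
    let v : Vec ℓ Γ := (fun j => σ * k j, 0)
    have hv : ∀ j, |v.1 j| ≤ k j := by
      intro j
      have := hS.lin j
      simp only [v]
      rw [abs_le]
      rcases hσ with rfl | rfl <;> omega
    have hvd : ∀ j, |v.1 j + d.1 j| ≤ 13 * L j := fun j => by
      have := hS.lin j
      have h1 := abs_le.1 (hd j)
      have h2 := abs_le.1 (hv j)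
      exact abs_le.2 (by omega)
    obtain ⟨w, hw, hw'⟩ := Chart.coord_mul hy (r := v) (s := d)
      (fun j => by have := hS.lin j; have := hv j; omega)
      (fun j => by have := hS.lin j; have := hd j; omega)
      (fun j => by have := hS.lin j; have := hvd j; omega)
    refine ⟨v, ⟨rfl, fun j _ => hv j⟩, ?_⟩
    rw [hw']
    refine hcon w fun j => ?_
    have h2 := abs_sub_abs_le_abs_sub (w.1 j) (v.1 j + d.1 j)
    have := hw j; have := hvd j; have := hS.lin j; omega
  obtain ⟨v, hv, hvU⟩ := move (-1) (Or.inr rfl)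
  obtain ⟨w, hw, hwU⟩ := move 1 (Or.inl rfl)
  exact h.2 v w hv hw (hE.trans (hE.symm hvU) hwU)

/-- Near a point `y`, the boundaries of the relations `E t` occupy few levels. -/
lemma exists_boundary_centers (hS : Scales Φ K b a e k L)
    {s : ℕ} {E F : Fin s → X → X → Prop}
    (hE : ∀ t, Equivalence (E t)) (hF : ∀ t, Equivalence (F t))
    (hFE : ∀ t x x', F t x x' → E t x x')
    (hbox : ∀ t, ∀ x ∈ XH Φ X, ∃ y m I O, IsRoughBox Φ a e (eqClass (F t) x) y m I O)
    {y : X} (hy : y ∈ XH Φ X)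
    (hb : Nat.card {t : Fin s //
      ∃ v : Vec ℓ Γ, (∀ j, |v.1 j| ≤ 16 * L j) ∧ ¬ E t y (Φ.φ v • y)} ≤ b)
    (i : Fin ℓ) :
    ∃ C : Finset ℤ, C.card ≤ b * ((48 * K + 1) ^ ℓ * 2 ^ ℓ) ∧
      ∀ t, ∀ d : Vec ℓ Γ, (∀ j, |d.1 j| ≤ 12 * L j) → OnBoundary Φ (E t) k i (Φ.φ d • y) →
        ∃ c ∈ C, |d.1 i - c| ≤ 5 * k i := by
  classical
  obtain ⟨idx, hidx⟩ := exists_cube_index (fun j => 12 * L j) a (48 * K)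
    (fun j => by have := hS.lin j; omega)
    (fun j => by have := hS.L_eq j; push_cast; rw [this]; apply le_of_eq; ring)
  have hη : ∀ t x, ∃ η, x ∈ XH Φ X → IsInward Φ a (F t) η x := by
    intro t x
    by_cases hx : x ∈ XH Φ X
    · obtain ⟨y, m, I, O, hU⟩ := hbox t x hx
      obtain ⟨η, h⟩ := hU.exists_isInward hS ((hF t).refl x)
      exact ⟨η, fun _ => h⟩
    · exact ⟨fun _ => true, fun h => (hx h).elim⟩
  choose η hη using hη
  let T := {t : Fin s // ∃ v : Vec ℓ Γ, (∀ j, |v.1 j| ≤ 16 * L j) ∧ ¬ E t y (Φ.φ v • y)}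
  let S : Set (T × Vec ℓ Γ) :=
    {p | (∀ j, |p.2.1 j| ≤ 12 * L j) ∧ OnBoundary Φ (E p.1.1) k i (Φ.φ p.2 • y)}
  have hEF : ∀ t x, OnBoundary Φ (E t) k i x → OnBoundary Φ (F t) k i x :=
    fun t x h => ⟨h.1, fun v w hv hw hvw => h.2 v w hv hw (hFE _ _ _ hvw)⟩
  obtain ⟨C, hC, hC'⟩ := exists_centers S (fun p => p.2.1 i)
    (fun p => (p.1, idx p.2.1, η p.1.1 (Φ.φ p.2 • y))) (5 * k i) (by
      rintro ⟨t, d⟩ ⟨hd, hB⟩ ⟨t', d'⟩ ⟨hd', hB'⟩ hkey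
      simp only [Prod.mk.injEq] at hkey
      obtain ⟨rfl, h2, h3⟩ := hkey
      have hin := hη t.1 _ hB.1
      have hin' := hη t.1 _ hB'.1
      simp only [← h3] at hin'
      have hrel := hin.related hS (hF t.1) hB.1 hB'.1 hin' hd hd' rfl rfl
        (hidx _ _ hd hd' h2)
      obtain ⟨y₀, m, I, O, hU⟩ := hbox t.1 _ hB.1
      exact (hEF _ _ hB).levels_close hS (hF t.1) hU hrel (hEF _ _ hB') hin hin' hd hd' rfl rfl)
  refine ⟨C, hC.trans ?_, fun t d hd hB => ?_⟩
  · rw [Nat.card_prod, Nat.card_prod, Nat.card_fun, Nat.card_fun]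
    simp only [Nat.card_eq_fintype_card (α := Fin _), Fintype.card_fin,
      Nat.card_eq_fintype_card (α := Bool), Fintype.card_bool]
    exact Nat.mul_le_mul_right _ hb
  · exact hC' (⟨t, hB.not_related_near hS (hE t) hy hd⟩, d) ⟨hd, hB⟩

end BoundaryLevels

/-! ### Marker points and the levels attached to them -/

namespace LocalAlgebra

variable {G X : Type*} [Group G] [MulAction G X] {𝒜 : LocalAlgebra G X}

lemma fibered_prop {p : X → Prop} (h : 𝒜.M {x | p x}) : 𝒜.Fibered p := by
  intro b
  by_cases hb : b
  · simpa [hb] using h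
  · simpa [hb] using 𝒜.not h

lemma fibered_pi {ι β : Type*} [Finite ι] {f : ι → X → β} (h : ∀ i, 𝒜.Fibered (f i)) :
    𝒜.Fibered fun x i => f i x := by
  intro b
  simp only [funext_iff]
  exact 𝒜.forall_fin fun i => h i (b i)

lemma Fibered.prodMk {β γ : Type*} {f : X → β} {h : X → γ} (hf : 𝒜.Fibered f)
    (hh : 𝒜.Fibered h) : 𝒜.Fibered fun x => (f x, h x) := by
  intro b
  simp only [Prod.ext_iff]
  exact 𝒜.and (hf b.1) (hh b.2)

end LocalAlgebra

section Markers

variable {G : Type*} [Group G] {ℓ : ℕ} {Γ : Type*} [AddCommGroup Γ] {Φ : Chart G ℓ Γ}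
  {X : Type*} [MulAction G X]

lemma OnBoundary.mem_algebra (𝒜 : LocalAlgebra G X) (hXH : 𝒜.M (XH Φ X)) {E : X → X → Prop}
    (hE : ∀ g : G, 𝒜.M {x | E x (g • x)}) (k : Fin ℓ → ℤ) (i : Fin ℓ) :
    𝒜.M {x | OnBoundary Φ E k i x} := by
  have hfin : ∀ σ : ℤ, {v : Vec ℓ Γ | OnFace k i σ v}.Finite := by
    intro σ
    refine (Vec.finite_box Φ fun j => max (k j) |σ * k i|).subset fun v hv j => ?_
    by_cases hj : j = i
    · subst hj
      rw [hv.1]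
      exact le_max_right _ _
    · exact (hv.2 j hj).trans (le_max_left _ _)
  have hE' : ∀ g h : G, 𝒜.M {x | E (g • x) (h • x)} := by
    intro g h
    simpa [mul_smul] using 𝒜.pred_smul (hE (h * g⁻¹)) g
  have := 𝒜.and hXH (𝒜.forall_mem (hfin (-1)) fun v _ => 𝒜.forall_mem (hfin 1) fun w _ =>
    𝒜.not (hE' (Φ.φ v) (Φ.φ w)))
  convert this using 3 with x
  exact and_congr_right fun _ => ⟨fun h v hv w hw => h v w hv hw, fun h v w hv hw => h v hv w hw⟩

/-- Marker points `Y` with a rank `n` and, for each marker and direction, an upper and a lower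
level `τ`; levels of nearby markers are far apart, and far from the boundaries of all `E t`. -/
structure IsMarking (Φ : Chart G ℓ Γ) {s : ℕ} (E : Fin s → X → X → Prop) (a k L : Fin ℓ → ℤ)
    (n : X → ℕ) (Y : Set X) (τ : X → Fin ℓ → Bool → ℤ) : Prop where
  sub : ∀ y ∈ Y, y ∈ XH Φ X
  rank_inj : ∀ x, ∀ v : Vec ℓ Γ, (∀ j, |v.1 j| ≤ 16 * L j) →
    n (Φ.φ v • x) = n x → Φ.φ v • x = x
  cover : ∀ x ∈ XH Φ X, ∃ y ∈ Y, ∃ v : Vec ℓ Γ, (∀ j, |v.1 j| < 2 * L j) ∧ x = Φ.φ v • y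
  upper : ∀ y ∈ Y, ∀ i, 2 * L i ≤ τ y i true ∧ τ y i true ≤ 3 * L i
  lower : ∀ y ∈ Y, ∀ i, -(3 * L i) ≤ τ y i false ∧ τ y i false ≤ -(2 * L i)
  sep : ∀ y ∈ Y, ∀ u : Vec ℓ Γ, (∀ j, |u.1 j| ≤ 16 * L j) → Φ.φ u • y ∈ Y →
    n (Φ.φ u • y) < n y → ∀ i σ σ', 4 * a i < |τ y i σ - (u.1 i + τ (Φ.φ u • y) i σ')|
  avoid : ∀ y ∈ Y, ∀ d : Vec ℓ Γ, (∀ j, |d.1 j| ≤ 12 * L j) → ∀ t i σ,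
    OnBoundary Φ (E t) k i (Φ.φ d • y) → 63 * (ℓ * k i) < |τ y i σ - d.1 i|

variable {K b : ℕ} {a e k L : Fin ℓ → ℤ}

lemma exists_markers (hS : Scales Φ K b a e k L)
    (𝒜 : LocalAlgebra G X) (hXH : 𝒜.M (XH Φ X)) {n : X → ℕ}
    (hn : 𝒜.Fibered n)
    (hrank : ∀ x, ∀ v : Vec ℓ Γ, (∀ j, |v.1 j| ≤ 16 * L j) →
      n (Φ.φ v • x) = n x → Φ.φ v • x = x) :
    ∃ Y : Set X, 𝒜.M Y ∧ (∀ y ∈ Y, y ∈ XH Φ X) ∧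
      (∀ y ∈ Y, ∀ v : Vec ℓ Γ, (∀ j, |v.1 j| ≤ L j) → Φ.φ v • y ∈ Y → Φ.φ v • y = y) ∧
      ∀ x ∈ XH Φ X, ∃ y ∈ Y, ∃ v : Vec ℓ Γ, (∀ j, |v.1 j| < 2 * L j) ∧ x = Φ.φ v • y := by
  classical
  have hfin : Finite {v : Vec ℓ Γ // ∀ j, |v.1 j| ≤ L j} := (Vec.finite_box Φ L).to_subtype
  let γ : {v : Vec ℓ Γ // ∀ j, |v.1 j| ≤ L j} × Bool → G :=
    fun v => if v.2 then Φ.φ v.1.1 else (Φ.φ v.1.1)⁻¹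
  obtain ⟨f, hf, hrec⟩ := 𝒜.exists_recursive (β := Prop) hn
    (LocalAlgebra.fibered_prop (p := fun x => x ∈ XH Φ X) hXH) γ
    (fun t p => t ∧ ∀ v, p v ≠ some True)
  have hrec' : ∀ x, f x ↔ x ∈ XH Φ X ∧ ∀ v, n (γ v • x) < n x → ¬ f (γ v • x) := by
    intro x
    refine (iff_of_eq (hrec x)).trans (and_congr_right fun _ => forall_congr' fun v => ?_)
    by_cases h : n (γ v • x) < n x <;> simp [h]
  refine ⟨{x | f x}, hf.pred (fun p => p), fun y hy => ((hrec' y).1 hy).1, ?_, ?_⟩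
  · intro y hy v hv hvY
    by_contra hne
    have hne' : n (Φ.φ v • y) ≠ n y := fun h =>
      hne (hrank y v (fun j => by have := hv j; have := hS.lin j; omega) h)
    rcases lt_or_gt_of_ne hne' with h | h
    · exact ((hrec' y).1 hy).2 (⟨v, hv⟩, true) (by simpa [γ] using h) (by simpa [γ] using hvY)
    · exact ((hrec' _).1 hvY).2 (⟨v, hv⟩, false) (by simpa [γ] using h) (by simpa [γ] using hy)
  · intro x hx
    by_cases hfx : f x
    · refine ⟨x, hfx, 0, fun j => ?_, by rw [Φ.φ_zero, one_smul]⟩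
      have := hS.lin j
      simp only [Prod.fst_zero, Pi.zero_apply, abs_zero]
      omega
    · have h1 : ∃ v, f (γ v • x) := by
        by_contra hcon
        push Not at hcon
        exact hfx ((hrec' x).2 ⟨hx, fun v _ => hcon v⟩)
      obtain ⟨⟨v, σ⟩, hv⟩ := h1
      have hbd := v.2
      refine ⟨_, hv, ?_⟩
      have hy := ((hrec' _).1 hv).1
      cases σ
      · refine ⟨v.1, fun j => ?_, by simp [γ]⟩
        have := hbd j; have := hS.lin j; omega
      · obtain ⟨w, hw, hw'⟩ := Chart.coord_inv hy (d := v.1) (y := x) (by simp [γ])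
          (fun j => by have := hbd j; have := hS.lin j; omega)
        refine ⟨w, fun j => ?_, hw'⟩
        have h2 := abs_le.1 (hbd j)
        have h3 := abs_le.1 (hw j)
        have := hS.lin j
        rw [abs_lt]
        omega

lemma exists_marking (hS : Scales Φ K b a e k L)
    (𝒜 : LocalAlgebra G X) (hXH : 𝒜.M (XH Φ X))
    {s : ℕ} {E F : Fin s → X → X → Prop}
    (hE : ∀ t, Equivalence (E t)) (hEM : ∀ t, ∀ g : G, 𝒜.M {x | E t x (g • x)})
    (hF : ∀ t, Equivalence (F t))
    (hFE : ∀ t x x', F t x x' → E t x x')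
    (hbox : ∀ t, ∀ x ∈ XH Φ X, ∃ y m I O, IsRoughBox Φ a e (eqClass (F t) x) y m I O)
    (hb : ∀ y ∈ XH Φ X, Nat.card {t : Fin s //
      ∃ v : Vec ℓ Γ, (∀ j, |v.1 j| ≤ 16 * L j) ∧ ¬ E t y (Φ.φ v • y)} ≤ b) :
    ∃ (n : X → ℕ) (Y : Set X) (τ : X → Fin ℓ → Bool → ℤ), 𝒜.Fibered n ∧ 𝒜.M Y ∧
      𝒜.Fibered τ ∧ IsMarking Φ E a k L n Y τ := by
  classical
  obtain ⟨n, hn, hrank⟩ := 𝒜.exists_rank (Φ.φ '' {v : Vec ℓ Γ | ∀ j, |v.1 j| ≤ 16 * L j})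
    ((Vec.finite_box Φ _).image _)
  replace hrank : ∀ x, ∀ v : Vec ℓ Γ, (∀ j, |v.1 j| ≤ 16 * L j) →
      n (Φ.φ v • x) = n x → Φ.φ v • x = x := fun x v hv => hrank x _ ⟨v, hv, rfl⟩
  obtain ⟨Y, hYM, hYsub, hYsep, hcov⟩ := exists_markers hS 𝒜 hXH hn hrank
  let V := {v : Vec ℓ Γ // ∀ j, |v.1 j| ≤ 16 * L j}
  have hV : Finite V := (Vec.finite_box Φ _).to_subtype
  let B : (V → Prop) × (V × Fin ℓ × Fin s → Prop) → (V → Option (Fin ℓ → Bool → ℤ)) →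
      Fin ℓ → Bool → ℤ → Prop := fun t p i σ r =>
    (σ = true → 2 * L i ≤ r ∧ r ≤ 3 * L i) ∧
    (σ = false → -(3 * L i) ≤ r ∧ r ≤ -(2 * L i)) ∧
    (∀ u, t.1 u → ∀ τ', p u = some τ' → ∀ σ', 4 * a i < |r - (u.1.1 i + τ' i σ')|) ∧
    (∀ d : V, ∀ t', (∀ j, |d.1.1 j| ≤ 12 * L j) → t.2 (d, i, t') →
      63 * (ℓ * k i) < |r - d.1.1 i|)
  let θ : X → (V → Prop) × (V × Fin ℓ × Fin s → Prop) := fun x =>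
    (fun u => Φ.φ u.1 • x ∈ Y, fun d => OnBoundary Φ (E d.2.2) k d.2.1 (Φ.φ d.1.1 • x))
  have hθ : 𝒜.Fibered θ := by
    refine LocalAlgebra.Fibered.prodMk (LocalAlgebra.fibered_pi fun u => ?_)
      (LocalAlgebra.fibered_pi fun d => ?_)
    · exact LocalAlgebra.fibered_prop (𝒜.smul _ hYM)
    · exact LocalAlgebra.fibered_prop (𝒜.pred_smul
        (OnBoundary.mem_algebra 𝒜 hXH (hEM d.2.2) k d.2.1) _)
  obtain ⟨τ, hτ, hrec⟩ := 𝒜.exists_recursive hn hθ (fun v : V => Φ.φ v.1)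
    (fun t p i σ => Classical.epsilon (B t p i σ))
  refine ⟨n, Y, τ, hn, hYM, hτ, ?_⟩
  have hB : ∀ y ∈ Y, ∀ i σ, B (θ y) (fun v => if n (Φ.φ v.1 • y) < n y then
      some (τ (Φ.φ v.1 • y)) else none) i σ (τ y i σ) := by
    intro y hy i σ
    rw [congrFun (congrFun (hrec y) i) σ]
    apply Classical.epsilon_spec
    obtain ⟨C₂, hC₂, hC₂'⟩ := exists_boundary_centers hS hE hF hFE hbox (hYsub y hy)
      (hb y (hYsub y hy)) i
    obtain ⟨idx, hidx⟩ := exists_cube_index (fun j => 16 * L j) L 64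
      (fun j => by have := hS.lin j; omega) (fun j => by push_cast; omega)
    obtain ⟨C₁, hC₁, hC₁'⟩ := exists_centers
      {u : V × Bool | Φ.φ u.1.1 • y ∈ Y}
      (fun u => u.1.1.1 i + τ (Φ.φ u.1.1 • y) i u.2)
      (fun u => (idx u.1.1.1, u.2)) 0 (by
        rintro ⟨u, σ₁⟩ hu ⟨u', σ₂⟩ hu' hkey
        simp only [Prod.mk.injEq] at hkey
        obtain ⟨h1, rfl⟩ := hkey
        have h2 := hidx _ _ u.2 u'.2 h1
        obtain ⟨w, hw, hw'⟩ := Chart.coord_rebase (hYsub _ hu) (d := u.1) (g := u'.1) rfl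
          (fun j => by have := hS.lin j; have := u.2 j; omega)
          (fun j => by have := hS.lin j; have := u'.2 j; omega)
          (fun j => by have := hS.lin j; have := h2 j; rw [abs_sub_comm] at this; omega)
        have hu'' : Φ.φ w • Φ.φ u.1 • y ∈ Y := by rw [← hw']; exact hu'
        have h3 := hYsep _ hu w (fun j => by
          have := hS.lin j
          have h4 := h2 j
          have h5 := hw j
          have h6 := abs_sub_abs_le_abs_sub (w.1 j) (u'.1.1 j - u.1.1 j)
          rw [abs_sub_comm] at h4
          omega) hu''
        rw [← hw'] at h3
        have h4 : u'.1 = u.1 := Chart.coord_inj (hYsub y hy)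
          (fun j => by have := hS.lin j; have := u'.2 j; omega)
          (fun j => by have := hS.lin j; have := u.2 j; omega) h3
        simp [h4])
    obtain ⟨r, hr1, hr2, hr3, hr4⟩ := exists_int_avoiding
      (if σ then 2 * L i else -(3 * L i)) (L i) C₁ C₂ (4 * a i)
      (63 * (ℓ * k i) + 5 * k i) (2 * 65 ^ ℓ) (b * ((48 * K + 1) ^ ℓ * 2 ^ ℓ))
      (by have := hS.lin i; omega) (by have := hS.lin i; omega)
      (by
        refine (Nat.cast_le.2 hC₁).trans (le_of_eq ?_)
        rw [Nat.card_prod, Nat.card_fun]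
        simp [mul_comm])
      (by exact_mod_cast hC₂) (hS.count i)
    refine ⟨r, ?_, ?_, ?_, ?_⟩
    · rintro rfl
      simp only [if_true] at hr1 hr2
      omega
    · rintro rfl
      simp only [Bool.false_eq_true, if_false] at hr1 hr2
      omega
    · intro u hu τ' hτ' σ'
      obtain ⟨c, hc, hc'⟩ := hC₁' (u, σ') hu
      have h1 : τ' = τ (Φ.φ u.1 • y) := by
        dsimp only at hτ'
        split_ifs at hτ'
        simpa using hτ'.symm
      have h2 : u.1.1 i + τ (Φ.φ u.1 • y) i σ' = c := by
        change |u.1.1 i + τ (Φ.φ u.1 • y) i σ' - c| ≤ 0 at hc'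
        have := abs_eq_zero.1 (le_antisymm hc' (abs_nonneg _))
        omega
      rw [h1, h2]
      exact hr3 c hc
    · intro d t' hd hbd
      obtain ⟨c, hc, hc'⟩ := hC₂' t' d.1 hd hbd
      have h1 := hr4 c hc
      have h2 := abs_sub_le r (d.1.1 i) c
      omega
  refine ⟨hYsub, hrank, hcov, fun y hy i => (hB y hy i true).1 rfl,
    fun y hy i => (hB y hy i false).2.1 rfl, ?_, ?_⟩
  · intro y hy u hu huY hlt i σ σ'
    exact (hB y hy i σ).2.2.1 ⟨u, hu⟩ huY _ (if_pos hlt) σ'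
  · intro y hy d hd t i σ hbd
    exact (hB y hy i σ).2.2.2 ⟨d, fun j => by have := hS.lin j; have := hd j; omega⟩ t hd hbd

end Markers

/-! ### The cells cut out by a marking -/

section Cells

variable {G : Type*} [Group G] {ℓ : ℕ} {Γ : Type*} [AddCommGroup Γ]
  {X : Type*} [MulAction G X]

/-- `x` lies in the box around `y` delimited by the levels of `y`. -/
def InBox (Φ : Chart G ℓ Γ) (L : Fin ℓ → ℤ) (τ : X → Fin ℓ → Bool → ℤ) (y x : X) : Prop :=
  ∃ v : Vec ℓ Γ, (∀ j, |v.1 j| ≤ 3 * L j) ∧ x = Φ.φ v • y ∧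
    ∀ i, τ y i false < v.1 i ∧ v.1 i ≤ τ y i true

/-- `y` is the marker of least rank whose box contains `x`. -/
def Owns (Φ : Chart G ℓ Γ) (L : Fin ℓ → ℤ) (n : X → ℕ) (Y : Set X)
    (τ : X → Fin ℓ → Bool → ℤ) (y x : X) : Prop :=
  y ∈ Y ∧ InBox Φ L τ y x ∧ ∀ y' ∈ Y, InBox Φ L τ y' x → n y ≤ n y'

/-- `x` lies above the `(i, σ)`-level of `y`. -/
def Above (Φ : Chart G ℓ Γ) (L : Fin ℓ → ℤ) (τ : X → Fin ℓ → Bool → ℤ) (y : X) (i : Fin ℓ)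
    (σ : Bool) (x : X) : Prop :=
  ∃ v : Vec ℓ Γ, (∀ j, |v.1 j| ≤ 11 * L j) ∧ x = Φ.φ v • y ∧ τ y i σ < v.1 i

/-- `x` and `x'` lie on the same side of each level of each marker near `y`. -/
def SamePattern (Φ : Chart G ℓ Γ) (L : Fin ℓ → ℤ) (Y : Set X) (τ : X → Fin ℓ → Bool → ℤ)
    (y x x' : X) : Prop :=
  ∀ u : Vec ℓ Γ, (∀ j, |u.1 j| ≤ 7 * L j) → Φ.φ u • y ∈ Y → ∀ i σ,
    (Above Φ L τ (Φ.φ u • y) i σ x ↔ Above Φ L τ (Φ.φ u • y) i σ x')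

/-- Two points are related if they have the same owner `y` and the same pattern relative to the
markers near `y`; cells not meeting `X^ℋ` are split into points. -/
def CellRel (Φ : Chart G ℓ Γ) (L : Fin ℓ → ℤ) (n : X → ℕ) (Y : Set X)
    (τ : X → Fin ℓ → Bool → ℤ) (x x' : X) : Prop :=
  x = x' ∨ ∃ y, Owns Φ L n Y τ y x ∧ Owns Φ L n Y τ y x' ∧ SamePattern Φ L Y τ y x x' ∧
    ∃ x'' ∈ XH Φ X, Owns Φ L n Y τ y x'' ∧ SamePattern Φ L Y τ y x x''

variable {Φ : Chart G ℓ Γ} {L : Fin ℓ → ℤ} {n : X → ℕ} {Y : Set X} {τ : X → Fin ℓ → Bool → ℤ}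

lemma SamePattern.symm {y x x' : X} (h : SamePattern Φ L Y τ y x x') :
    SamePattern Φ L Y τ y x' x := fun u hu huY i σ => (h u hu huY i σ).symm

lemma SamePattern.trans {y x x' x'' : X} (h : SamePattern Φ L Y τ y x x')
    (h' : SamePattern Φ L Y τ y x' x'') : SamePattern Φ L Y τ y x x'' :=
  fun u hu huY i σ => (h u hu huY i σ).trans (h' u hu huY i σ)

lemma CellRel.eqClass_eq_singleton {x : X}
    (hx : ¬ ∃ p ∈ eqClass (CellRel Φ L n Y τ) x, p ∈ XH Φ X) :
    eqClass (CellRel Φ L n Y τ) x = {x} := by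
  ext p
  refine ⟨?_, fun hp => Or.inl (Set.mem_singleton_iff.1 hp).symm⟩
  rintro (rfl | ⟨y, h1, -, -, q, hq, h2, h3⟩)
  · rfl
  · exact (hx ⟨q, Or.inr ⟨y, h1, h2, h3, q, hq, h2, h3⟩, hq⟩).elim

/-- Related points lie in a common orbit, at bounded distance. -/
lemma CellRel.exists_smul (Φ : Chart G ℓ Γ) (L : Fin ℓ → ℤ) (n : X → ℕ) (Y : Set X)
    (τ : X → Fin ℓ → Bool → ℤ) :
    ∃ S : Set G, S.Finite ∧ ∀ x x', CellRel Φ L n Y τ x x' → ∃ g ∈ S, x' = g • x := by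
  have hV := Vec.finite_box Φ fun j => 3 * L j
  refine ⟨_, ((hV.prod hV).image fun p => Φ.φ p.1 * (Φ.φ p.2)⁻¹).insert 1, ?_⟩
  rintro x x' (rfl | ⟨y, ⟨-, ⟨v, hv, rfl, -⟩, -⟩, ⟨-, ⟨w, hw, rfl, -⟩, -⟩, -⟩)
  · exact ⟨1, Set.mem_insert _ _, (one_smul _ _).symm⟩
  · exact ⟨_, Set.mem_insert_of_mem _ ⟨(w, v), ⟨hw, hv⟩, rfl⟩, by simp [mul_smul]⟩

lemma CellRel.finite_eqClass (x : X) : (eqClass (CellRel Φ L n Y τ) x).Finite := by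
  obtain ⟨S, hS, h⟩ := CellRel.exists_smul Φ L n Y τ
  refine (hS.image fun g => g • x).subset fun p hp => ?_
  obtain ⟨g, hg, rfl⟩ := h _ _ hp
  exact ⟨g, hg, rfl⟩

variable {s K b : ℕ} {E : Fin s → X → X → Prop} {a e k : Fin ℓ → ℤ}

lemma IsMarking.near_of_common (hS : Scales Φ K b a e k L) (hM : IsMarking Φ E a k L n Y τ)
    {y y' p : X} (hy : y ∈ Y) {v w : Vec ℓ Γ}
    (hv : ∀ j, |v.1 j| ≤ 3 * L j) (hw : ∀ j, |w.1 j| ≤ 3 * L j) (h : p = Φ.φ v • y)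
    (h' : p = Φ.φ w • y') : ∃ u : Vec ℓ Γ, (∀ j, |u.1 j| ≤ 7 * L j) ∧ y' = Φ.φ u • y := by
  have key : ∀ j, |v.1 j - w.1 j| ≤ 6 * L j := fun j => by
    have := abs_sub (v.1 j) (w.1 j); have := hv j; have := hw j; omega
  obtain ⟨u, hu, hu'⟩ := Chart.coord_common (hM.sub y hy) (h'.symm.trans h)
    (fun j => by have := hS.lin j; have := hw j; omega)
    (fun j => by have := hS.lin j; have := hv j; omega)
    (fun j => by have := hS.lin j; have := key j; omega)
  refine ⟨u, fun j => ?_, hu'⟩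
  have := hS.lin j
  have := key j
  have := hu j
  have := abs_sub_abs_le_abs_sub (u.1 j) (v.1 j - w.1 j)
  omega

lemma IsMarking.owner_unique (hS : Scales Φ K b a e k L) (hM : IsMarking Φ E a k L n Y τ)
    {y y' x : X} (h : Owns Φ L n Y τ y x) (h' : Owns Φ L n Y τ y' x) :
    y' = y := by
  obtain ⟨v, hv, hxv, -⟩ := h.2.1
  obtain ⟨w, hw, hxw, -⟩ := h'.2.1
  obtain ⟨u, hu, rfl⟩ := hM.near_of_common hS h.1 hv hw hxv hxw
  exact hM.rank_inj y u (fun j => by have := hS.lin j; have := hu j; omega)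
    (le_antisymm (h'.2.2 _ h.1 h.2.1) (h.2.2 _ h'.1 h'.2.1))

lemma IsMarking.exists_owner (hS : Scales Φ K b a e k L) (hM : IsMarking Φ E a k L n Y τ)
    {x : X} (hx : x ∈ XH Φ X) : ∃ y, Owns Φ L n Y τ y x := by
  have hne : {y | y ∈ Y ∧ InBox Φ L τ y x}.Nonempty := by
    obtain ⟨y, hy, v, hv, hxv⟩ := hM.cover x hx
    refine ⟨y, hy, v, fun j => ?_, hxv, fun j => ?_⟩
    · have := hS.lin j; have := hv j; omega
    · have := hM.upper y hy j; have := hM.lower y hy j; have := abs_lt.1 (hv j); omega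
  obtain ⟨y, hy, hmin⟩ := exists_minimalFor_of_wellFoundedLT _ n hne
  refine ⟨y, hy.1, hy.2, fun y' hy' h => ?_⟩
  by_contra hcon
  exact hcon (hmin ⟨hy', h⟩ (by omega))

lemma IsMarking.cellRel_equivalence (hS : Scales Φ K b a e k L) (hM : IsMarking Φ E a k L n Y τ) :
    Equivalence (CellRel Φ L n Y τ) := by
  refine ⟨fun x => Or.inl rfl, ?_, ?_⟩
  · rintro x x' (rfl | ⟨y, h1, h2, h3, p, hp, h4, h5⟩)
    · exact Or.inl rfl
    · exact Or.inr ⟨y, h2, h1, h3.symm, p, hp, h4, h3.symm.trans h5⟩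
  · rintro x x' x'' (rfl | ⟨y, h1, h2, h3, p, hp, h4, h5⟩) h
    · exact h
    · rcases h with rfl | ⟨y', h1', h2', h3', -⟩
      · exact Or.inr ⟨y, h1, h2, h3, p, hp, h4, h5⟩
      · obtain rfl := hM.owner_unique hS h2 h1'
        exact Or.inr ⟨_, h1, h2', h3.trans h3', p, hp, h4, h5⟩

/-- Comparison of a point near `y` with a level of a marker near `y`, in coordinates at `y`. -/
lemma IsMarking.compare (hS : Scales Φ K b a e k L) (hM : IsMarking Φ E a k L n Y τ)
    {y : X} {u v : Vec ℓ Γ} (hu : ∀ j, |u.1 j| ≤ 7 * L j)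
    (huY : Φ.φ u • y ∈ Y) (hv : ∀ j, |v.1 j| ≤ 3 * L j) :
    ∃ w : Vec ℓ Γ, (∀ j, |w.1 j| ≤ 11 * L j) ∧
      (∀ j, |w.1 j - (v.1 j - u.1 j)| ≤ (Φ.Z.radius j : ℤ)) ∧
      Φ.φ v • y = Φ.φ w • Φ.φ u • y ∧
      ∀ i σ, Above Φ L τ (Φ.φ u • y) i σ (Φ.φ v • y) ↔ τ (Φ.φ u • y) i σ < w.1 i := by
  have key : ∀ j, |v.1 j - u.1 j| ≤ 10 * L j := fun j => by
    have := abs_sub (v.1 j) (u.1 j); have := hv j; have := hu j; omega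
  obtain ⟨w, hw, hw'⟩ := Chart.coord_rebase (hM.sub _ huY) (d := u) (g := v) rfl
    (fun j => by have := hS.lin j; have := hu j; omega)
    (fun j => by have := hS.lin j; have := hv j; omega)
    (fun j => by have := hS.lin j; have := key j; omega)
  have hwL : ∀ j, |w.1 j| ≤ 11 * L j := fun j => by
    have := hS.lin j
    have := key j
    have := hw j
    have := abs_sub_abs_le_abs_sub (w.1 j) (v.1 j - u.1 j)
    omega
  refine ⟨w, hwL, hw, hw', fun i σ => ⟨?_, fun h => ⟨w, hwL, hw', h⟩⟩⟩
  rintro ⟨w', hw'L, hw'', h⟩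
  rwa [Chart.coord_inj (hM.sub _ huY)
    (fun j => by have := hS.lin j; have := hwL j; omega)
    (fun j => by have := hS.lin j; have := hw'L j; omega) (hw'.symm.trans hw'')]

/-- Distinct levels of markers near `y` have heights far apart. -/
lemma IsMarking.levels_apart (hS : Scales Φ K b a e k L) (hM : IsMarking Φ E a k L n Y τ)
    {y : X} (hy : y ∈ Y) {u u' : Vec ℓ Γ} {σ σ' : Bool}
    (hu : ∀ j, |u.1 j| ≤ 7 * L j) (huY : Φ.φ u • y ∈ Y)
    (hu' : ∀ j, |u'.1 j| ≤ 7 * L j) (huY' : Φ.φ u' • y ∈ Y) (hne : (u, σ) ≠ (u', σ'))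
    (j : Fin ℓ) :
    3 * a j + 2 * Φ.Z.radius j <
      |u.1 j + τ (Φ.φ u • y) j σ - (u'.1 j + τ (Φ.φ u' • y) j σ')| := by
  have hj := hS.lin j
  have aux : ∀ {u u' : Vec ℓ Γ} {σ σ' : Bool}, (∀ j, |u.1 j| ≤ 7 * L j) → Φ.φ u • y ∈ Y →
      (∀ j, |u'.1 j| ≤ 7 * L j) → Φ.φ u' • y ∈ Y → n (Φ.φ u' • y) < n (Φ.φ u • y) →
      3 * a j + 2 * Φ.Z.radius j <
        |u.1 j + τ (Φ.φ u • y) j σ - (u'.1 j + τ (Φ.φ u' • y) j σ')| := by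
    intro u u' σ σ' hu huY hu' huY' hlt
    have key : ∀ j, |u'.1 j - u.1 j| ≤ 14 * L j := fun j => by
      have := abs_sub (u'.1 j) (u.1 j); have := hu j; have := hu' j; omega
    obtain ⟨w, hw, hw'⟩ := Chart.coord_rebase (hM.sub _ huY) (d := u) (g := u') rfl
      (fun j => by have := hS.lin j; have := hu j; omega)
      (fun j => by have := hS.lin j; have := hu' j; omega)
      (fun j => by have := hS.lin j; have := key j; omega)
    have h1 := hM.sep _ huY w (fun j => by
      have := hS.lin j
      have := key j
      have := hw j
      have := abs_sub_abs_le_abs_sub (w.1 j) (u'.1 j - u.1 j)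
      omega) (hw' ▸ huY') (hw' ▸ hlt) j σ σ'
    rw [← hw'] at h1
    have h2 := hw j
    grind
  rcases lt_trichotomy (n (Φ.φ u' • y)) (n (Φ.φ u • y)) with h | h | h
  · exact aux hu huY hu' huY' h
  · have key : ∀ j, |u'.1 j - u.1 j| ≤ 14 * L j := fun j => by
      have := abs_sub (u'.1 j) (u.1 j); have := hu j; have := hu' j; omega
    obtain ⟨w, hw, hw'⟩ := Chart.coord_rebase (hM.sub _ huY) (d := u) (g := u') rfl
      (fun j => by have := hS.lin j; have := hu j; omega)
      (fun j => by have := hS.lin j; have := hu' j; omega)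
      (fun j => by have := hS.lin j; have := key j; omega)
    have h1 := hM.rank_inj _ w (fun j => by
      have := hS.lin j
      have := key j
      have := hw j
      have := abs_sub_abs_le_abs_sub (w.1 j) (u'.1 j - u.1 j)
      omega) (hw' ▸ h)
    rw [← hw'] at h1
    obtain rfl := Chart.coord_inj (hM.sub y hy)
      (fun j => by have := hS.lin j; have := hu' j; omega)
      (fun j => by have := hS.lin j; have := hu j; omega) h1
    have h2 := hM.upper _ huY j
    have h3 := hM.lower _ huY j
    cases σ <;> cases σ' <;> first | exact (hne rfl).elim | (rw [lt_abs]; omega)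
  · rw [abs_sub_comm]
    exact aux hu' huY' hu huY h

/-- The class of a point of `X^ℋ` with owner `y` is, up to a small error, a box whose sides are
levels of markers near `y`. -/
lemma IsMarking.exists_cell (hS : Scales Φ K b a e k L) (hM : IsMarking Φ E a k L n Y τ)
    {x y : X} (hxy : Owns Φ L n Y τ y x) (hx : x ∈ XH Φ X) :
    ∃ lo hi : Fin ℓ → ℤ,
      (∀ j, -(3 * L j) ≤ lo j ∧ lo j + 3 * a j ≤ hi j ∧ hi j ≤ 3 * L j) ∧
      (∀ v : Vec ℓ Γ, (∀ j, lo j + 3 * Φ.Z.radius j < v.1 j ∧ v.1 j ≤ hi j - 3 * Φ.Z.radius j) →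
        CellRel Φ L n Y τ x (Φ.φ v • y)) ∧
      (∀ p, CellRel Φ L n Y τ x p → ∃ v : Vec ℓ Γ, p = Φ.φ v • y ∧
        ∀ j, lo j - 3 * Φ.Z.radius j < v.1 j ∧ v.1 j ≤ hi j + 3 * Φ.Z.radius j) ∧
      (∀ j, ∃ u : Vec ℓ Γ, (∀ j, |u.1 j| ≤ 7 * L j) ∧ Φ.φ u • y ∈ Y ∧
        ∃ σ, lo j = u.1 j + τ (Φ.φ u • y) j σ) ∧
      (∀ j, ∃ u : Vec ℓ Γ, (∀ j, |u.1 j| ≤ 7 * L j) ∧ Φ.φ u • y ∈ Y ∧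
        ∃ σ, hi j = u.1 j + τ (Φ.φ u • y) j σ) := by
  classical
  obtain ⟨c, hc, rfl, hcτ⟩ := hxy.2.1
  have hy := hxy.1
  set x := Φ.φ c • y with hxc
  let T : Set (Vec ℓ Γ × Bool) := {p | (∀ j, |p.1.1 j| ≤ 7 * L j) ∧ Φ.φ p.1 • y ∈ Y}
  have hT : T.Finite := ((Vec.finite_box Φ fun j => 7 * L j).prod Set.finite_univ).subset
    fun p hp => ⟨hp.1, trivial⟩
  let ht : Fin ℓ → Vec ℓ Γ × Bool → ℤ := fun j p => p.1.1 j + τ (Φ.φ p.1 • y) j p.2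
  let ab : Fin ℓ → Vec ℓ Γ × Bool → X → Prop := fun j p q => Above Φ L τ (Φ.φ p.1 • y) j p.2 q
  have h0 : ∀ σ, ((0 : Vec ℓ Γ), σ) ∈ T := fun σ =>
    ⟨fun j => by have := hS.lin j; simp; omega, by simpa [Φ.φ_zero] using hy⟩
  have ht0 : ∀ j σ, ht j (0, σ) = τ y j σ := fun j σ => by simp [ht, Φ.φ_zero]
  have cmp : ∀ p ∈ T, ∀ v : Vec ℓ Γ, (∀ j, |v.1 j| ≤ 3 * L j) → ∀ j,
      (ab j p (Φ.φ v • y) → ht j p - Φ.Z.radius j < v.1 j) ∧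
      (¬ ab j p (Φ.φ v • y) → v.1 j ≤ ht j p + Φ.Z.radius j) := by
    intro p hp v hv j
    obtain ⟨w, -, hw, -, hab⟩ := hM.compare hS hp.1 hp.2 hv
    have h1 := abs_le.1 (hw j)
    simp only [ab, ht, hab]
    constructor <;> intro h <;> omega
  have ab0 : ∀ j σ, ab j (0, σ) x ↔ τ y j σ < c.1 j := by
    intro j σ
    simp only [ab, Φ.φ_zero, one_smul]
    constructor
    · rintro ⟨w, hw, hw', h⟩
      rwa [Chart.coord_inj (hM.sub y hy)
        (fun j => by have := hS.lin j; have := hc j; omega)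
        (fun j => by have := hS.lin j; have := hw j; omega) hw']
    · exact fun h => ⟨c, fun j => by have := hS.lin j; have := hc j; omega, hxc, h⟩
  have hlo : ∀ j, ∃ p ∈ {p | p ∈ T ∧ ab j p x}, ∀ p' ∈ {p | p ∈ T ∧ ab j p x},
      ht j p' ≤ ht j p := fun j =>
    Set.exists_max_image _ (ht j) (hT.subset fun p hp => hp.1)
      ⟨(0, false), h0 _, (ab0 j false).2 (hcτ j).1⟩
  have hhi : ∀ j, ∃ p ∈ {p | p ∈ T ∧ ¬ ab j p x}, ∀ p' ∈ {p | p ∈ T ∧ ¬ ab j p x},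
      ht j p ≤ ht j p' := fun j =>
    Set.exists_min_image _ (ht j) (hT.subset fun p hp => hp.1)
      ⟨(0, true), h0 _, by rw [ab0]; exact not_lt.2 (hcτ j).2⟩
  choose lo hlo hlo' using hlo
  choose hi hhi hhi' using hhi
  have hloτ : ∀ j, τ y j false ≤ ht j (lo j) := fun j => by
    rw [← ht0]; exact hlo' j _ ⟨h0 _, (ab0 j false).2 (hcτ j).1⟩
  have hhiτ : ∀ j, ht j (hi j) ≤ τ y j true := fun j => by
    rw [← ht0]; exact hhi' j _ ⟨h0 _, by rw [ab0]; exact not_lt.2 (hcτ j).2⟩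
  have hbd : ∀ j, -(3 * L j) ≤ ht j (lo j) ∧ ht j (lo j) + 3 * a j ≤ ht j (hi j) ∧
      ht j (hi j) ≤ 3 * L j := by
    intro j
    refine ⟨(hM.lower y hy j).1.trans (hloτ j), ?_, (hhiτ j).trans (hM.upper y hy j).2⟩
    have hne : ((lo j).1, (lo j).2) ≠ ((hi j).1, (hi j).2) := fun h => by
      have h' : lo j = hi j := h
      exact (hhi j).2 (h' ▸ (hlo j).2)
    have h1 := hM.levels_apart hS hy (hlo j).1.1 (hlo j).1.2 (hhi j).1.1 (hhi j).1.2 hne j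
    have h2 := (cmp _ (hlo j).1 c hc j).1 (hlo j).2
    have h3 := (cmp _ (hhi j).1 c hc j).2 (hhi j).2
    change 3 * a j + 2 * Φ.Z.radius j < |ht j (lo j) - ht j (hi j)| at h1
    rcases lt_abs.1 h1 with h | h <;> have := hS.lin j <;> omega
  refine ⟨fun j => ht j (lo j), fun j => ht j (hi j), hbd, ?_, ?_,
    fun j => ⟨_, (hlo j).1.1, (hlo j).1.2, _, rfl⟩,
    fun j => ⟨_, (hhi j).1.1, (hhi j).1.2, _, rfl⟩⟩
  · intro v hv
    dsimp only at hv
    have hvL : ∀ j, |v.1 j| ≤ 3 * L j := fun j => by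
      have := hbd j; have := hv j; have := hS.lin j; rw [abs_le]; omega
    have hpat : SamePattern Φ L Y τ y x (Φ.φ v • y) := by
      intro u hu huY i σ
      have hT' : (u, σ) ∈ T := ⟨hu, huY⟩
      have h1 := cmp _ hT' v hvL i
      have h2 := hv i
      have h3 := hS.lin i
      change ab i (u, σ) x ↔ ab i (u, σ) (Φ.φ v • y)
      by_cases h : ab i (u, σ) x
      · have h4 := hlo' i _ ⟨hT', h⟩
        refine iff_of_true h ?_
        by_contra hcon
        have := h1.2 hcon
        omega
      · have h4 := hhi' i _ ⟨hT', h⟩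
        refine iff_of_false h fun hcon => ?_
        have := h1.1 hcon
        omega
    refine Or.inr ⟨y, hxy, ⟨hy, ⟨v, hvL, rfl, fun j => ?_⟩, ?_⟩, hpat, x, hx, hxy,
      fun _ _ _ _ _ => Iff.rfl⟩
    · have := hloτ j; have := hhiτ j; have := hv j; have := hS.lin j; omega
    · rintro y' hy' ⟨w, hw, hvw, hwτ⟩
      obtain ⟨u, hu, rfl⟩ := hM.near_of_common hS hy hvL hw rfl hvw
      obtain ⟨w₁, hw₁, -, hw₁', hab₁⟩ := hM.compare hS hu hy' hvL
      obtain rfl : w = w₁ := Chart.coord_inj (hM.sub _ hy')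
        (fun j => by have := hS.lin j; have := hw j; omega)
        (fun j => by have := hS.lin j; have := hw₁ j; omega) (hvw.symm.trans hw₁')
      obtain ⟨w₂, -, -, hw₂', hab₂⟩ := hM.compare hS hu hy' hc
      have hτ : ∀ i, τ (Φ.φ u • y) i false < w₂.1 i ∧ w₂.1 i ≤ τ (Φ.φ u • y) i true := by
        intro i
        have h1 := (hab₂ i false).symm.trans ((hpat u hu hy' i false).trans (hab₁ i false))
        have h2 := (hab₂ i true).symm.trans ((hpat u hu hy' i true).trans (hab₁ i true))
        have := hwτ i
        constructor
        · exact h1.2 this.1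
        · exact not_lt.1 fun h => absurd (h2.1 h) (not_lt.2 this.2)
      refine hxy.2.2 _ hy' ⟨w₂, fun j => ?_, hw₂', hτ⟩
      have := hτ j; have := hM.upper _ hy' j; have := hM.lower _ hy' j
      rw [abs_le]; omega
  · intro p hp
    have main : ∃ v : Vec ℓ Γ, (∀ j, |v.1 j| ≤ 3 * L j) ∧ p = Φ.φ v • y ∧
        SamePattern Φ L Y τ y x p := by
      rcases hp with rfl | ⟨y', h1, h2, h3, -⟩
      · exact ⟨c, hc, hxc, fun _ _ _ _ _ => Iff.rfl⟩
      · obtain rfl := hM.owner_unique hS hxy h1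
        obtain ⟨v, hv, hv', -⟩ := h2.2.1
        exact ⟨v, hv, hv', h3⟩
    obtain ⟨v, hv, rfl, hpat⟩ := main
    refine ⟨v, rfl, fun j => ?_⟩
    have h1 := (cmp _ (hlo j).1 v hv j).1
      ((hpat _ (hlo j).1.1 (hlo j).1.2 j (lo j).2).1 (hlo j).2)
    have h2 := (cmp _ (hhi j).1 v hv j).2 fun h =>
      (hhi j).2 ((hpat _ (hhi j).1.1 (hhi j).1.2 j (hi j).2).2 h)
    have := hS.lin j
    constructor <;> dsimp only <;> omega

end Cells

section CellAlgebra

variable {G : Type*} [Group G] {ℓ : ℕ} {Γ : Type*} [AddCommGroup Γ]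
  {X : Type*} [MulAction G X] {𝒜 : LocalAlgebra G X} {Φ : Chart G ℓ Γ} {L : Fin ℓ → ℤ}
  {n : X → ℕ} {Y : Set X} {τ : X → Fin ℓ → Bool → ℤ}

lemma InBox.mem_algebra (hτ : 𝒜.Fibered τ) (g h : G) :
    𝒜.M {x | InBox Φ L τ (g • x) (h • x)} := by
  have := 𝒜.exists_mem (Vec.finite_box Φ fun j => 3 * L j) fun v _ =>
    𝒜.and (𝒜.smul_eq h (Φ.φ v * g)) ((hτ.comp_smul g).pred fun t =>
      ∀ i, t i false < v.1 i ∧ v.1 i ≤ t i true)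
  simp only [mul_smul] at this
  exact this

lemma Above.mem_algebra (hτ : 𝒜.Fibered τ) (i : Fin ℓ) (σ : Bool) (g h : G) :
    𝒜.M {x | Above Φ L τ (g • x) i σ (h • x)} := by
  have := 𝒜.exists_mem (Vec.finite_box Φ fun j => 11 * L j) fun v _ =>
    𝒜.and (𝒜.smul_eq h (Φ.φ v * g)) ((hτ.comp_smul g).pred fun t => t i σ < v.1 i)
  simp only [mul_smul] at this
  exact this

lemma Owns.mem_algebra (hn : 𝒜.Fibered n) (hY : 𝒜.M Y) (hτ : 𝒜.Fibered τ) (g h : G) :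
    𝒜.M {x | Owns Φ L n Y τ (g • x) (h • x)} := by
  have key : 𝒜.M {x | ∃ y, y ∈ Y ∧ InBox Φ L τ y (h • x) ∧ n y < n (g • x)} := by
    refine 𝒜.exists_near ((fun v => (Φ.φ v)⁻¹ * h) '' {v | ∀ j, |v.1 j| ≤ 3 * L j})
      ((Vec.finite_box Φ _).image _) ?_ fun g' => 𝒜.and (𝒜.smul g' hY)
        (𝒜.and (InBox.mem_algebra hτ g' h)
          ((hn.comp_smul g').pred₂ (hn.comp_smul g) fun r r' => r < r'))
    rintro x y ⟨-, ⟨v, hv, hxy, -⟩, -⟩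
    exact ⟨_, ⟨v, hv, rfl⟩, by simp [mul_smul, hxy]⟩
  have := 𝒜.and (𝒜.smul g hY) (𝒜.and (InBox.mem_algebra (L := L) (Φ := Φ) hτ g h)
    (𝒜.not key))
  simpa [Owns] using this

lemma SamePattern.mem_algebra (hY : 𝒜.M Y) (hτ : 𝒜.Fibered τ) (g h h' : G) :
    𝒜.M {x | SamePattern Φ L Y τ (g • x) (h • x) (h' • x)} := by
  have := 𝒜.forall_mem (Vec.finite_box Φ fun j => 7 * L j) fun u _ =>
    𝒜.imp (𝒜.smul (Φ.φ u * g) hY) (𝒜.forall_fin fun i => 𝒜.forall_fin fun σ =>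
      𝒜.iff (Above.mem_algebra (L := L) (Φ := Φ) hτ i σ (Φ.φ u * g) h)
        (Above.mem_algebra (L := L) (Φ := Φ) hτ i σ (Φ.φ u * g) h'))
  simp only [mul_smul] at this
  exact this

lemma CellRel.mem_algebra (hXH : 𝒜.M (XH Φ X)) (hn : 𝒜.Fibered n) (hY : 𝒜.M Y)
    (hτ : 𝒜.Fibered τ) (g : G) : 𝒜.M {x | CellRel Φ L n Y τ x (g • x)} := by
  have key : ∀ h : G, 𝒜.M {x | ∃ p, p ∈ XH Φ X ∧ Owns Φ L n Y τ (h • x) p ∧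
      SamePattern Φ L Y τ (h • x) x p} := by
    intro h
    refine 𝒜.exists_near ((fun v => Φ.φ v * h) '' {v | ∀ j, |v.1 j| ≤ 3 * L j})
      ((Vec.finite_box Φ _).image _) ?_ fun g' => 𝒜.and (𝒜.smul g' hXH)
        (𝒜.and (Owns.mem_algebra hn hY hτ h g')
          (by simpa using SamePattern.mem_algebra (L := L) (Φ := Φ) hY hτ h 1 g'))
    rintro x p ⟨-, ⟨-, ⟨v, hv, hxp, -⟩, -⟩, -⟩
    exact ⟨_, ⟨v, hv, rfl⟩, by simp [mul_smul, hxp]⟩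
  refine 𝒜.or (by simpa using 𝒜.smul_eq 1 g)
    (𝒜.exists_near ((fun v => (Φ.φ v)⁻¹) '' {v | ∀ j, |v.1 j| ≤ 3 * L j})
      ((Vec.finite_box Φ _).image _) ?_ fun h =>
      𝒜.and (by simpa using Owns.mem_algebra (L := L) (Φ := Φ) hn hY hτ h 1)
        (𝒜.and (Owns.mem_algebra hn hY hτ h g)
          (𝒜.and (by simpa using SamePattern.mem_algebra (L := L) (Φ := Φ) hY hτ h 1 g)
            (key h))))
  rintro x y ⟨⟨-, ⟨v, hv, hxy, -⟩, -⟩, -⟩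
  exact ⟨_, ⟨v, hv, rfl⟩, by simp [hxy]⟩

end CellAlgebra

section CellGeometry

variable {G : Type*} [Group G] {ℓ : ℕ} {Γ : Type*} [AddCommGroup Γ]
  {X : Type*} [MulAction G X] {Φ : Chart G ℓ Γ} {L : Fin ℓ → ℤ}
  {n : X → ℕ} {Y : Set X} {τ : X → Fin ℓ → Bool → ℤ}
  {s K b : ℕ} {E : Fin s → X → X → Prop} {a e k : Fin ℓ → ℤ}

/-- A boundary point of the cell relation is close to a level. -/
lemma IsMarking.exists_level_near (hS : Scales Φ K b a e k L) (hM : IsMarking Φ E a k L n Y τ)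
    {i : Fin ℓ} {x : X}
    (hx : OnBoundary Φ (CellRel Φ L n Y τ) k i x) :
    ∃ y ∈ Y, ∃ σ, ∃ w : Vec ℓ Γ, (∀ j, |w.1 j| ≤ 11 * L j) ∧ x = Φ.φ w • y ∧
      |w.1 i - τ y i σ| ≤ 2 * k i := by
  obtain ⟨y, hxy⟩ := hM.exists_owner hS hx.1
  obtain ⟨lo, hi, hbd, hin, hout, hlo, hhi⟩ := hM.exists_cell hS hxy hx.1
  have heq := hM.cellRel_equivalence hS
  have hU : IsRoughBox Φ a e (eqClass (CellRel Φ L n Y τ) x) y (fun j => (lo j + hi j) / 2)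
      (fun j => (hi j - lo j) / 2 - 3 * Φ.Z.radius j - 1)
      (fun j => (hi j - lo j) / 2 + 3 * Φ.Z.radius j + 1) := by
    refine ⟨hM.sub y hxy.1, fun v hv => hin v fun j => ?_, fun p hp => ?_, fun j => ?_,
      fun j => ?_, fun j => ?_⟩
    · have := hbd j; have := abs_le.1 (hv j); omega
    · obtain ⟨v, hv, hv'⟩ := hout p hp
      refine ⟨v, fun j => ?_, hv⟩
      have := hv' j; rw [abs_le]; omega
    · have := hS.lin j; omega
    · have := hS.lin j; have := hbd j; omega
    · have := hS.lin j; have := hbd j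
      have : |(lo j + hi j) / 2| ≤ 3 * L j := by rw [abs_le]; omega
      omega
  obtain ⟨c, hc, hxc, -⟩ := hxy.2.1
  have hcO : ∀ j, |c.1 j - (lo j + hi j) / 2| ≤ (hi j - lo j) / 2 + 3 * Φ.Z.radius j + 1 := by
    obtain ⟨v, hv, hv'⟩ := hU.outer x (heq.refl x)
    rwa [Chart.coord_inj (hM.sub y hxy.1)
      (fun j => by have := hS.lin j; have := hc j; omega)
      (fun j => by
        have := hU.dom j
        have := hv j
        have := abs_sub_abs_le_abs_sub (v.1 j) ((lo j + hi j) / 2)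
        have := hS.lin j
        have := hbd j
        omega) (hxc.symm.trans hv')]
  have hface := hx.near_face hS hU
    (fun p hp p' hp' => heq.trans (heq.symm hp) hp') hcO hxc
  have hlev : ∃ u : Vec ℓ Γ, (∀ j, |u.1 j| ≤ 7 * L j) ∧ Φ.φ u • y ∈ Y ∧
      ∃ σ, |c.1 i - (u.1 i + τ (Φ.φ u • y) i σ)| ≤ k i + 8 * Φ.Z.radius i + 4 := by
    have h1 := abs_le.1 (hcO i)
    have := hS.lin i
    have := hbd i
    rcases lt_abs.1 hface with h | h
    · obtain ⟨u, hu, huY, σ, hσ⟩ := hhi i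
      refine ⟨u, hu, huY, σ, ?_⟩
      rw [← hσ, abs_le]
      omega
    · obtain ⟨u, hu, huY, σ, hσ⟩ := hlo i
      refine ⟨u, hu, huY, σ, ?_⟩
      rw [← hσ, abs_le]
      omega
  obtain ⟨u, hu, huY, σ, hσ⟩ := hlev
  obtain ⟨w, hw, hwz, hw', -⟩ := hM.compare hS hu huY hc
  refine ⟨_, huY, σ, w, hw, hxc.trans hw', ?_⟩
  have h1 := abs_le.1 (hwz i)
  have h2 := abs_le.1 hσ
  have := hS.lin i
  rw [abs_le]
  omega

lemma IsMarking.boundaries_apart (hS : Scales Φ K b a e k L) (hM : IsMarking Φ E a k L n Y τ)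
    {t : Fin s} {i : Fin ℓ} {x x' : X} {p p' : Vec ℓ Γ}
    (hx : OnBoundary Φ (E t) k i x) (hx' : OnBoundary Φ (CellRel Φ L n Y τ) k i x')
    (hp : ∀ j, |p.1 j| ≤ 30 * (ℓ * k j)) (hp' : ∀ j, |p'.1 j| ≤ 30 * (ℓ * k j))
    (h : Φ.φ p • x = Φ.φ p' • x') : False := by
  obtain ⟨y, hy, σ, w, hw, rfl, hwσ⟩ := hM.exists_level_near hS hx'
  have key : ∀ j, |p'.1 j - p.1 j| ≤ 60 * (ℓ * k j) := fun j => by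
    have := abs_sub (p'.1 j) (p.1 j); have := hp j; have := hp' j; omega
  obtain ⟨r, hr, hr'⟩ := Chart.coord_common hx'.1 h
    (fun j => by have := hS.lin j; have := hp j; omega)
    (fun j => by have := hS.lin j; have := hp' j; omega)
    (fun j => by have := hS.lin j; have := key j; omega)
  have hr2 : ∀ j, |r.1 j| ≤ 60 * (ℓ * k j) + Φ.Z.radius j := fun j => by
    have := key j
    have := hr j
    have := abs_sub_abs_le_abs_sub (r.1 j) (p'.1 j - p.1 j)
    omega
  obtain ⟨d, hd, hd'⟩ := Chart.coord_mul (hM.sub y hy) (r := r) (s := w)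
    (fun j => by have := hS.lin j; have := hr2 j; omega)
    (fun j => by have := hS.lin j; have := hw j; omega)
    (fun j => by
      have := hS.lin j; have := hr2 j; have := hw j; have := abs_add_le (r.1 j) (w.1 j); omega)
  have h1 := hM.avoid y hy d (fun j => by
    have := hS.lin j
    have := hr2 j
    have := hw j
    have := abs_add_le (r.1 j) (w.1 j)
    have := hd j
    have := abs_sub_abs_le_abs_sub (d.1 j) (r.1 j + w.1 j)
    omega) t i σ (by rw [← hd', ← hr']; exact hx)
  have h2 := abs_le.1 (hr2 i)
  have h3 := abs_le.1 (hd i)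
  have h4 := abs_le.1 hwσ
  have := hS.lin i
  rcases lt_abs.1 h1 with h | h <;> omega

end CellGeometry

/-! ### Passing between rectangles and integer inequalities -/

namespace Rect

variable {ℓ : ℕ}

lemma cast_smul_radius (A : Rect ℓ) {r : ℝ} (hr : 0 ≤ r) (j : Fin ℓ) :
    ((smul r A).radius j : ℤ) = ⌊r * A.radius j⌋ := by
  simp only [smul, Int.toNat_of_nonneg (Int.floor_nonneg.2 (mul_nonneg hr (Nat.cast_nonneg _)))]

lemma smul_natCast_radius (A : Rect ℓ) (m : ℕ) (j : Fin ℓ) :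
    (smul (m : ℝ) A).radius j = m * A.radius j := by
  have h := A.cast_smul_radius (Nat.cast_nonneg m) j
  rw [← Nat.cast_mul, Int.floor_natCast] at h
  exact_mod_cast h

lemma smul_two_pow_radius (A : Rect ℓ) (m : ℕ) (j : Fin ℓ) :
    (smul ((2 : ℝ) ^ m) A).radius j = 2 ^ m * A.radius j := by
  have := A.smul_natCast_radius (2 ^ m) j
  push_cast at this
  exact this

lemma carrier_subset_iff {B D : Rect ℓ} {Γ : Type*} [AddCommGroup Γ] (hD : D.IsCentered) :
    B.carrier Γ ⊆ D.carrier Γ ↔ ∀ j, |B.center j| + B.radius j ≤ D.radius j := by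
  have hD' : ∀ j, D.center j = 0 := fun j => congrFun hD j
  constructor
  · intro h j
    have h1 := h (a := (fun j => B.center j + B.radius j, 0)) (fun j => by simp) j
    have h2 := h (a := (fun j => B.center j - B.radius j, 0)) (fun j => by simp) j
    simp only [hD', sub_zero, abs_le] at h1 h2
    rcases abs_cases (B.center j) with h3 | h3 <;> omega
  · intro h v hv j
    have h1 := h j
    have h2 := hv j
    have h3 := abs_sub_abs_le_abs_sub (v.1 j) (B.center j)
    rw [hD', sub_zero]
    omega

lemma mem_carrier_of_isCentered_s16 {B : Rect ℓ} {Γ : Type*} (hB : B.IsCentered) {v : Vec ℓ Γ} :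
    v ∈ B.carrier Γ ↔ ∀ j, |v.1 j| ≤ (B.radius j : ℤ) := by
  have hB' : ∀ j, B.center j = 0 := fun j => congrFun hB j
  simp only [carrier, Set.mem_ofPred_eq, hB', sub_zero]

lemma mem_faceRect_iff {B : Rect ℓ} {Γ : Type*} (hB : B.IsCentered) {i : Fin ℓ} {σ : ℤ}
    {v : Vec ℓ Γ} :
    v ∈ (B.faceRect i σ).carrier Γ ↔ OnFace (fun j => (B.radius j : ℤ)) i σ v := by
  have hB' : ∀ j, B.center j = 0 := fun j => congrFun hB j
  simp only [carrier, faceRect, Set.mem_ofPred_eq, OnFace]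
  constructor
  · intro h
    refine ⟨?_, fun j hj => ?_⟩
    · have := h i
      simp only [Function.update_self, hB', Nat.cast_zero, abs_nonpos_iff] at this
      omega
    · simpa [Function.update_of_ne hj, hB'] using h j
  · rintro ⟨h1, h2⟩ j
    by_cases hj : j = i
    · subst hj
      simp [hB', h1]
    · simpa [Function.update_of_ne hj, hB'] using h2 j hj

end Rect

section Interface

variable {G : Type*} [Group G] {ℓ : ℕ} {Γ : Type*} [AddCommGroup Γ] {Φ : Chart G ℓ Γ}
  {X : Type*} [MulAction G X]

lemma mem_bdry_iff {E : X → X → Prop} (hE : Equivalence E) {B : Rect ℓ} (hB : B.IsCentered)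
    {i : Fin ℓ} {x : X} :
    x ∈ bdry Φ E B i ↔ OnBoundary Φ E (fun j => (B.radius j : ℤ)) i x := by
  refine and_congr_right fun _ => ?_
  rw [Set.disjoint_left]
  constructor
  · intro h v w hv hw hvw
    exact h ⟨_, ⟨v, (Rect.mem_faceRect_iff hB).2 hv, rfl⟩, hvw⟩
      ⟨_, ⟨w, (Rect.mem_faceRect_iff hB).2 hw, rfl⟩, hE.refl _⟩
  · rintro h p ⟨_, ⟨v, hv, rfl⟩, hvp⟩ ⟨_, ⟨w, hw, rfl⟩, hwp⟩
    exact h v w ((Rect.mem_faceRect_iff hB).1 hv) ((Rect.mem_faceRect_iff hB).1 hw)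
      (hE.trans hvp (hE.symm hwp))

lemma IsRectangular.exists_isRoughBox (hℓ : 1 ≤ ℓ) {A : Rect ℓ} {ε : ℝ} {F : X → X → Prop}
    (hF : Equivalence F) (h : IsRectangular Φ A ε F) {x : X} (hx : x ∈ XH Φ X) :
    ∃ y m I O, IsRoughBox Φ (fun j => (A.radius j : ℤ))
      (fun j => ((Rect.smul ε A).radius j : ℤ)) (eqClass F x) y m I O := by
  obtain ⟨δ, B, hδ0, ⟨y, -, hδ1, hy, -, -, hin, hout⟩, hAB, hBD, hδB⟩ :=
    h.2.2.2.2 x ⟨x, hF.refl x, hx⟩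
  rw [Rect.carrier_subset_iff Φ.D_centered] at hBD
  refine ⟨y, B.center, fun j => ((Rect.smul (1 - δ) B).radius j : ℤ),
    fun j => ((Rect.smul (1 + δ) B).radius j : ℤ), hy,
    fun v hv => hin ⟨v, hv, rfl⟩, fun p hp => ?_, fun j => ?_, fun j => ?_, fun j => ?_⟩
  · obtain ⟨v, hv, rfl⟩ := hout hp
    exact ⟨v, hv, rfl⟩
  · have h1 : ((Rect.smul (2 * δ) B).radius j : ℤ) ≤ (Rect.smul ε A).radius j :=
      Nat.cast_le.2 (hδB j)
    rw [B.cast_smul_radius (by positivity)] at h1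
    rw [B.cast_smul_radius (by linarith), B.cast_smul_radius (by linarith)]
    have h2 := Int.le_floor_add_floor ((1 - δ) * B.radius j) (2 * δ * B.radius j)
    rw [show (1 - δ) * (B.radius j : ℝ) + 2 * δ * B.radius j = (1 + δ) * B.radius j by ring] at h2
    omega
  · have h1 : (A.radius j : ℤ) ≤ B.radius j := Nat.cast_le.2 (hAB j)
    refine h1.trans ?_
    rw [B.cast_smul_radius (by linarith), Int.le_floor]
    push_cast
    nlinarith [(Nat.cast_nonneg (B.radius j) : (0 : ℝ) ≤ B.radius j)]
  · have h1 := hBD j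
    have h2 : ((Rect.smul (1 + δ) B).radius j : ℤ) ≤ 2 * B.radius j := by
      rw [B.cast_smul_radius (by linarith), Int.floor_le_iff]
      push_cast
      nlinarith [(Nat.cast_nonneg (B.radius j) : (0 : ℝ) ≤ B.radius j)]
    have h4 : 2 ^ 3 * B.radius j ≤ 2 ^ (22 * ℓ) * B.radius j :=
      Nat.mul_le_mul_right _ (Nat.pow_le_pow_right (by norm_num) (by omega))
    rw [Rect.smul_two_pow_radius] at h1
    change |B.center j| + _ ≤ _ at h1
    omega

lemma radius_le_of_smul_two_pow_subset {B : Rect ℓ} {m : ℕ}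
    (h : (Rect.smul ((2 : ℝ) ^ m) B).carrier Γ ⊆ Φ.D.carrier Γ) (j : Fin ℓ) :
    2 ^ m * (B.radius j : ℤ) ≤ Φ.D.radius j := by
  have h1 := (Rect.carrier_subset_iff Φ.D_centered).1 h j
  rw [Rect.smul_two_pow_radius] at h1
  push_cast at h1
  have := abs_nonneg ((Rect.smul ((2 : ℝ) ^ m) B).center j)
  omega

lemma scales_of_bounds {A : Rect ℓ} {ε q : ℝ} {b : ℕ} (hε0 : 0 < ε)
    (hq0 : 0 < q) (hb : 0 < b) (hℓ : 1 ≤ ℓ)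
    (hdom : (Rect.smul ((2 : ℝ) ^ (40 * ℓ)) A).carrier Γ ⊆ Φ.D.carrier Γ)
    (hZ : (Rect.smul ((2 * 36 ^ 2 * 2 ^ (14 * ℓ) : ℕ) : ℝ) Φ.Z).le (Rect.smul ε A))
    (hq1 : 8 * ε < q)
    (hq2 : q < 1 / 4 * (306 : ℝ)⁻¹ * (ℓ : ℝ)⁻¹ * (b : ℝ)⁻¹ * ((2 : ℝ) ^ (22 * ℓ ^ 2))⁻¹) :
    Scales Φ (2 ^ (7 * ℓ + 5)) b (fun j => (A.radius j : ℤ))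
      (fun j => ((Rect.smul ε A).radius j : ℤ)) (fun j => ((Rect.smul q A).radius j : ℤ))
      (fun j => 2 ^ (7 * ℓ + 5) * (A.radius j : ℤ)) := by
  have hz : ∀ j, 2592 * 2 ^ (14 * ℓ) * Φ.Z.radius j ≤ (Rect.smul ε A).radius j := by
    intro j
    have := hZ j
    rwa [Rect.smul_natCast_radius, show 2 * 36 ^ 2 = 2592 by norm_num] at this
  have hD := radius_le_of_smul_two_pow_subset hdom
  have hk : ∀ j, 1224 * (ℓ * (b * 2 ^ (22 * ℓ ^ 2))) * (Rect.smul q A).radius j ≤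
      A.radius j := by
    intro j
    have h1 : ((Rect.smul q A).radius j : ℝ) ≤ q * A.radius j := by
      have h := A.cast_smul_radius hq0.le j
      have h' := Int.floor_le (q * A.radius j)
      rw [← h] at h'
      exact_mod_cast h'
    have h2 : (1224 * (ℓ * (b * 2 ^ (22 * ℓ ^ 2))) : ℝ) * q ≤ 1 := by
      have hpos : (0 : ℝ) < 1224 * (ℓ * (b * 2 ^ (22 * ℓ ^ 2))) := by
        have : (0 : ℝ) < ℓ := by exact_mod_cast hℓ
        positivity
      have h3 : 1 / 4 * (306 : ℝ)⁻¹ * (ℓ : ℝ)⁻¹ * (b : ℝ)⁻¹ * ((2 : ℝ) ^ (22 * ℓ ^ 2))⁻¹ =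
          (1224 * (ℓ * (b * 2 ^ (22 * ℓ ^ 2))) : ℝ)⁻¹ := by
        rw [mul_inv, mul_inv, mul_inv]
        ring
      rw [h3] at hq2
      calc _ ≤ (1224 * (ℓ * (b * 2 ^ (22 * ℓ ^ 2))) : ℝ) *
            (1224 * (ℓ * (b * 2 ^ (22 * ℓ ^ 2))) : ℝ)⁻¹ :=
            mul_le_mul_of_nonneg_left hq2.le hpos.le
        _ = 1 := mul_inv_cancel₀ hpos.ne'
    have h3 : (1224 * (ℓ * (b * 2 ^ (22 * ℓ ^ 2))) : ℝ) * (Rect.smul q A).radius j ≤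
        A.radius j := by
      calc _ ≤ (1224 * (ℓ * (b * 2 ^ (22 * ℓ ^ 2))) : ℝ) * (q * A.radius j) := by gcongr
        _ = ((1224 * (ℓ * (b * 2 ^ (22 * ℓ ^ 2))) : ℝ) * q) * A.radius j := by ring
        _ ≤ 1 * A.radius j := by gcongr
        _ = A.radius j := one_mul _
    exact_mod_cast h3
  have hek : ∀ j, 8 * (Rect.smul ε A).radius j ≤ (Rect.smul q A).radius j := by
    intro j
    have h : (8 * (Rect.smul ε A).radius j : ℤ) ≤ (Rect.smul q A).radius j := by
      rw [A.cast_smul_radius hε0.le, A.cast_smul_radius hq0.le, Int.le_floor]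
      push_cast
      have := Int.floor_le (ε * A.radius j)
      nlinarith [(Nat.cast_nonneg (A.radius j) : (0 : ℝ) ≤ A.radius j)]
    exact_mod_cast h
  have hze : ∀ j, 1000 * Φ.Z.radius j ≤ (Rect.smul ε A).radius j := fun j =>
    (Nat.mul_le_mul_right _ (by have := Nat.one_le_two_pow (n := 14 * ℓ); omega)).trans (hz j)
  have hkℓ : ∀ j, (Rect.smul q A).radius j ≤ ℓ * (Rect.smul q A).radius j := fun j =>
    Nat.le_mul_of_pos_left _ hℓ
  have hb2 : 1 ≤ b * 2 ^ (22 * ℓ ^ 2) := Nat.mul_pos hb (by positivity)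
  have hka : ∀ j, 1000 * (ℓ * (Rect.smul q A).radius j) ≤ A.radius j := fun j => by
    refine le_trans ?_ (hk j)
    calc _ ≤ 1224 * (ℓ * 1) * (Rect.smul q A).radius j := by nlinarith [hkℓ j]
      _ ≤ _ := by gcongr
  refine ⟨fun j => by exact_mod_cast Φ.Z_pos j, fun j => by exact_mod_cast hze j,
    fun j => by exact_mod_cast hek j, fun j => by exact_mod_cast hkℓ j,
    fun j => by exact_mod_cast hka j, fun j => ?_, fun j => by push_cast; rfl, fun j => ?_,
    fun j => ?_⟩
  · have : (2 : ℤ) ^ 12 ≤ 2 ^ (7 * ℓ + 5) := pow_le_pow_right₀ (by norm_num) (by omega)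
    nlinarith [(Nat.cast_nonneg (A.radius j) : (0 : ℤ) ≤ A.radius j)]
  · refine le_trans ?_ (hD j)
    have : (2 : ℤ) ^ 7 * 2 ^ (7 * ℓ + 5) ≤ 2 ^ (40 * ℓ) := by
      rw [← pow_add]
      exact pow_le_pow_right₀ (by norm_num) (by omega)
    have h2 : (0 : ℤ) < 2 ^ (7 * ℓ + 5) := by positivity
    have h3 : (0 : ℤ) ≤ A.radius j := Nat.cast_nonneg _
    calc 100 * (2 ^ (7 * ℓ + 5) * (A.radius j : ℤ))
        = 100 * 2 ^ (7 * ℓ + 5) * (A.radius j : ℤ) := by ring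
      _ ≤ _ := mul_le_mul_of_nonneg_right (by omega) h3
  · have hk1 : 1 ≤ (Rect.smul q A).radius j := by
      have := hek j; have := hze j; have := Φ.Z_pos j; omega
    have ha1 : 1 ≤ A.radius j := by have := hka j; have := hkℓ j; omega
    have hp1 : 65 ^ ℓ ≤ 2 ^ (7 * ℓ) := by
      rw [pow_mul]
      exact Nat.pow_le_pow_left (by norm_num) _
    have hp2 : (48 * 2 ^ (7 * ℓ + 5) + 1) ^ ℓ * 2 ^ ℓ ≤ 2 ^ (22 * ℓ ^ 2) := by
      have h1 : 48 * 2 ^ (7 * ℓ + 5) + 1 ≤ 2 ^ (7 * ℓ + 11) := by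
        have : 2 ^ (7 * ℓ + 11) = 64 * 2 ^ (7 * ℓ + 5) := by rw [pow_add, pow_add]; ring
        have := Nat.one_le_two_pow (n := 7 * ℓ + 5)
        omega
      calc _ ≤ (2 ^ (7 * ℓ + 11)) ^ ℓ * 2 ^ ℓ := by gcongr
        _ = 2 ^ ((7 * ℓ + 11) * ℓ + ℓ) := by rw [← pow_mul, ← pow_add]
        _ ≤ 2 ^ (22 * ℓ ^ 2) := Nat.pow_le_pow_right (by norm_num) (by nlinarith)
    have h1 : (2 * (4 * A.radius j) + 1) * (2 * 65 ^ ℓ) ≤ 18 * 2 ^ (7 * ℓ) * A.radius j := by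
      calc _ ≤ (9 * A.radius j) * (2 * 2 ^ (7 * ℓ)) := by gcongr; omega
        _ = _ := by ring
    have h2 : (2 * (63 * (ℓ * (Rect.smul q A).radius j) + 5 * (Rect.smul q A).radius j) + 1) *
        (b * ((48 * 2 ^ (7 * ℓ + 5) + 1) ^ ℓ * 2 ^ ℓ)) ≤ A.radius j := by
      refine le_trans ?_ (hk j)
      calc _ ≤ (1224 * (ℓ * (Rect.smul q A).radius j)) * (b * 2 ^ (22 * ℓ ^ 2)) := by
            gcongr
            have := hkℓ j
            omega
        _ = _ := by ring
    have h3 : (2 * (4 * A.radius j) + 1) * (2 * 65 ^ ℓ) +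
        (2 * (63 * (ℓ * (Rect.smul q A).radius j) + 5 * (Rect.smul q A).radius j) + 1) *
        (b * ((48 * 2 ^ (7 * ℓ + 5) + 1) ^ ℓ * 2 ^ ℓ)) ≤ 2 ^ (7 * ℓ + 5) * A.radius j := by
      have h4 : 18 * 2 ^ (7 * ℓ) * A.radius j + A.radius j ≤ 2 ^ (7 * ℓ + 5) * A.radius j := by
        have h5 := Nat.one_le_two_pow (n := 7 * ℓ)
        rw [pow_add]
        nlinarith [Nat.mul_le_mul_right (A.radius j) h5]
      omega
    exact_mod_cast h3

end Interface

section Construction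

variable {G : Type*} [Group G] {ℓ : ℕ} {Γ : Type*} [AddCommGroup Γ] {Φ : Chart G ℓ Γ}
  {X : Type*} [MulAction G X]

/-- A box with integer sides `lo < v ≤ hi`, known up to an error of three chart errors, is a rough
rectangle. -/
lemma exists_rect_of_sides {K : ℕ} {A : Rect ℓ} {ε : ℝ} (hε0 : 0 < ε) (hε1 : ε < 1) {U : Set X}
    {y : X} {lo hi : Fin ℓ → ℤ} (hy : y ∈ XH Φ X) (hℓ : 1 ≤ ℓ) (hK : 0 < K)
    (hA1 : ∀ j, 1 ≤ A.radius j)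
    (hz : ∀ j, 60 * K * Φ.Z.radius j ≤ (Rect.smul ε A).radius j)
    (hD : ∀ j, 3 * K * (2 ^ (22 * ℓ) + 1) * (A.radius j : ℤ) ≤ Φ.D.radius j)
    (hbd : ∀ j, -(3 * (K * (A.radius j : ℤ))) ≤ lo j ∧ lo j + 3 * A.radius j ≤ hi j ∧
      hi j ≤ 3 * (K * (A.radius j : ℤ)))
    (hin : ∀ v : Vec ℓ Γ, (∀ j, lo j + 3 * Φ.Z.radius j < v.1 j ∧
      v.1 j ≤ hi j - 3 * Φ.Z.radius j) → Φ.φ v • y ∈ U)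
    (hout : ∀ p ∈ U, ∃ v : Vec ℓ Γ, p = Φ.φ v • y ∧
        ∀ j, lo j - 3 * Φ.Z.radius j < v.1 j ∧ v.1 j ≤ hi j + 3 * Φ.Z.radius j) :
    ∃ (δ : ℝ) (B : Rect ℓ), 0 < δ ∧ Roughly Φ B δ U ∧ A.le B ∧
      (Rect.smul ((2 : ℝ) ^ (22 * ℓ)) B).carrier Γ ⊆ Φ.D.carrier Γ ∧
      (Rect.smul (2 * δ) B).le (Rect.smul ε A) := by
  have hK' : (1 : ℝ) ≤ K := by exact_mod_cast hK
  have hδ0 : 0 < ε / (6 * K) := by positivity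
  have hδ1 : ε / (6 * K) < 1 := by
    rw [div_lt_one (by positivity)]
    linarith
  let B : Rect ℓ := ⟨fun j => (lo j + hi j) / 2, fun j => ((hi j - lo j) / 2).toNat⟩
  set δ := ε / (6 * K) with hδ
  have hr : ∀ j, (B.radius j : ℤ) = (hi j - lo j) / 2 := fun j =>
    Int.toNat_of_nonneg (by have := hbd j; omega)
  have hrA : ∀ j, A.radius j ≤ B.radius j := fun j => by
    have := hbd j; have := hr j; have := hA1 j; omega
  have hrK : ∀ j, (B.radius j : ℤ) ≤ 3 * (K * (A.radius j : ℤ)) := fun j => by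
    have := hbd j; have := hr j; omega
  have hm : ∀ j, |B.center j| ≤ 3 * (K * (A.radius j : ℤ)) := fun j => by
    have := hbd j
    change |(lo j + hi j) / 2| ≤ _
    rw [abs_le]
    omega
  have hδr : ∀ j, (10 * Φ.Z.radius j : ℝ) ≤ δ * B.radius j := by
    intro j
    have h1 : ((Rect.smul ε A).radius j : ℝ) ≤ ε * A.radius j := by
      have h' := Int.floor_le (ε * A.radius j)
      rw [← A.cast_smul_radius hε0.le] at h'
      exact_mod_cast h'
    have h2 : (60 * K * Φ.Z.radius j : ℝ) ≤ (Rect.smul ε A).radius j := by exact_mod_cast hz j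
    have h3 : (A.radius j : ℝ) ≤ B.radius j := by exact_mod_cast hrA j
    have h4 : ε * A.radius j ≤ ε * B.radius j := by gcongr
    rw [hδ, div_mul_eq_mul_div, le_div_iff₀ (by positivity)]
    linarith
  have hz1 : ∀ j, 1 ≤ Φ.Z.radius j := Φ.Z_pos
  have hbig : ∀ j, 3 * (K * (A.radius j : ℤ)) + 2 ^ (22 * ℓ) * (3 * (K * (A.radius j : ℤ))) ≤
      Φ.D.radius j := fun j => by linarith [hD j]
  refine ⟨δ, B, hδ0, ⟨y, hδ0, hδ1, hy, ?_, fun j => ?_, ?_, ?_⟩, hrA, ?_, fun j => ?_⟩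
  · rw [Rect.carrier_subset_iff Φ.D_centered]
    intro j
    have h1 := B.smul_natCast_radius 2 j
    push_cast at h1
    rw [h1]
    have h2 := hbig j
    have h3 : (2 : ℤ) ^ 1 * (3 * (K * (A.radius j : ℤ))) ≤
        2 ^ (22 * ℓ) * (3 * (K * (A.radius j : ℤ))) := by
      gcongr
      · norm_num
      · omega
    have h4 := hm j
    have h5 := hrK j
    change |B.center j| + _ ≤ _
    push_cast
    linarith
  · have h1 := Φ.Z.smul_natCast_radius 2 j
    push_cast at h1
    rw [h1]
    have h2 : (2 * Φ.Z.radius j : ℤ) ≤ (Rect.smul δ B).radius j := by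
      rw [B.cast_smul_radius hδ0.le, Int.le_floor]
      push_cast
      linarith [hδr j, (Nat.cast_nonneg (Φ.Z.radius j) : (0 : ℝ) ≤ Φ.Z.radius j)]
    exact_mod_cast h2
  · rintro _ ⟨v, hv, rfl⟩
    refine hin v fun j => ?_
    have h1 : |v.1 j - (lo j + hi j) / 2| ≤ _ := hv j
    have h2 : ((Rect.smul (1 - δ) B).radius j : ℤ) ≤ B.radius j - 10 * Φ.Z.radius j := by
      rw [B.cast_smul_radius (by linarith), ← Int.cast_le (R := ℝ)]
      push_cast
      linarith [Int.floor_le ((1 - δ) * B.radius j), hδr j]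
    have h3 := abs_le.1 h1
    have := hr j
    have := hz1 j
    omega
  · intro p hp
    obtain ⟨v, rfl, hv⟩ := hout p hp
    refine ⟨v, fun j => ?_, rfl⟩
    change |v.1 j - (lo j + hi j) / 2| ≤ _
    have h2 : (B.radius j + 10 * Φ.Z.radius j : ℤ) ≤ (Rect.smul (1 + δ) B).radius j := by
      rw [B.cast_smul_radius (by linarith), Int.le_floor]
      push_cast
      linarith [hδr j]
    have := hv j
    have := hr j
    have := hz1 j
    rw [abs_le]
    omega
  · rw [Rect.carrier_subset_iff Φ.D_centered]
    intro j
    rw [Rect.smul_two_pow_radius]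
    change |B.center j| + _ ≤ _
    have h1 : (2 : ℤ) ^ (22 * ℓ) * B.radius j ≤ 2 ^ (22 * ℓ) * (3 * (K * (A.radius j : ℤ))) := by
      gcongr
      exact hrK j
    push_cast
    linarith [hbig j, hm j]
  · have h1 : ((Rect.smul (2 * δ) B).radius j : ℤ) ≤ (Rect.smul ε A).radius j := by
      rw [B.cast_smul_radius (by positivity), A.cast_smul_radius hε0.le]
      apply Int.floor_le_floor
      have h2 : (B.radius j : ℝ) ≤ 3 * (K * A.radius j) := by exact_mod_cast hrK j
      calc 2 * δ * B.radius j ≤ 2 * δ * (3 * (K * A.radius j)) := by gcongr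
        _ = ε * A.radius j := by rw [hδ]; field_simp; ring
    exact_mod_cast h1

/-- The construction, relative to a local algebra of sets. -/
theorem exists_orthogonal_rectangular (𝒜 : LocalAlgebra G X) (hXH : 𝒜.M (XH Φ X))
    {A : Rect ℓ} (hA : A.IsCentered) {ε q : ℝ} {b : ℕ} (hε0 : 0 < ε) (hq0 : 0 < q) (hb : 0 < b)
    (hdom : (Rect.smul ((2 : ℝ) ^ (40 * ℓ)) A).carrier Γ ⊆ Φ.D.carrier Γ)
    (hZ : (Rect.smul ((2 * 36 ^ 2 * 2 ^ (14 * ℓ) : ℕ) : ℝ) Φ.Z).le (Rect.smul ε A))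
    (hq1 : 8 * ε < q)
    (hq2 : q < 1 / 4 * (306 : ℝ)⁻¹ * (ℓ : ℝ)⁻¹ * (b : ℝ)⁻¹ * ((2 : ℝ) ^ (22 * ℓ ^ 2))⁻¹)
    {s : ℕ} {E : Fin s → X → X → Prop} (hEeq : ∀ t, Equivalence (E t))
    (hEM : ∀ t, ∀ g : G, 𝒜.M {x | E t x (g • x)})
    (hEsub : ∀ t, IsSubRectangular Φ A ε (E t))
    (hbound : ∀ x ∈ XH Φ X,
      Set.ncard {t : Fin s |
        ¬ chartImg Φ ((Rect.smul ((8 * 2 ^ (14 * ℓ) : ℕ) : ℝ) A).carrier Γ) x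
            ⊆ eqClass (E t) x} ≤ b) :
    ∃ F : X → X → Prop, Equivalence F ∧ (∀ x : X, (eqClass F x).Finite) ∧
      (∀ x x', F x x' → ∃ g : G, x' = g • x) ∧ (∀ g : G, 𝒜.M {x | F x (g • x)}) ∧
      IsRectangular Φ A ε F ∧ ∀ t, ChartOrthogonal Φ (Rect.smul q A) F (E t) := by
  have hℓ : 1 ≤ ℓ := by
    by_contra hcon
    obtain rfl : ℓ = 0 := by omega
    simp at hq2
    linarith
  have hS := scales_of_bounds hε0 hq0 hb hℓ hdom hZ hq1 hq2
  choose F hFeq hFE hFrect using hEsub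
  have hqA : (Rect.smul q A).IsCentered := hA
  obtain ⟨n, Y, τ, hn, hY, hτ, hM⟩ := exists_marking hS 𝒜 hXH hEeq hEM hFeq hFE
    (fun t x hx => (hFrect t).exists_isRoughBox hℓ (hFeq t) hx) (by
      intro y hy
      refine le_trans ?_ (hbound y hy)
      rw [← Nat.card_coe_set_eq]
      refine Nat.card_le_card_of_injective (fun t => ⟨t.1, fun hsub => ?_⟩)
        fun t t' h => Subtype.ext (congrArg (fun r => r.1) h)
      obtain ⟨t, v, hv, hne⟩ := t
      have hcA : (Rect.smul ((8 * 2 ^ (14 * ℓ) : ℕ) : ℝ) A).IsCentered := hA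
      refine hne (hsub ⟨v, (Rect.mem_carrier_of_isCentered_s16 hcA).2 fun j => ?_, rfl⟩)
      rw [Rect.smul_natCast_radius]
      refine (hv j).trans ?_
      have h1 : (16 : ℤ) * 2 ^ (7 * ℓ + 5) ≤ 8 * 2 ^ (14 * ℓ) := by
        have : (2 : ℤ) ^ (4 + (7 * ℓ + 5)) ≤ 2 ^ (3 + 14 * ℓ) :=
          pow_le_pow_right₀ (by norm_num) (by omega)
        rw [pow_add, pow_add 2 3] at this
        linarith
      push_cast
      rw [← mul_assoc]
      exact mul_le_mul_of_nonneg_right h1 (Nat.cast_nonneg _))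
  have heq := hM.cellRel_equivalence hS
  have hε1 : ε < 1 := by
    have h1 : 1 / 4 * (306 : ℝ)⁻¹ * (ℓ : ℝ)⁻¹ * (b : ℝ)⁻¹ * ((2 : ℝ) ^ (22 * ℓ ^ 2))⁻¹ ≤
        1 / 4 * (306 : ℝ)⁻¹ * 1 * 1 * 1 := by
      gcongr
      · exact inv_le_one_of_one_le₀ (by exact_mod_cast hℓ)
      · exact inv_le_one_of_one_le₀ (by exact_mod_cast hb)
      · exact inv_le_one_of_one_le₀ (one_le_pow₀ (by norm_num))
    linarith
  refine ⟨_, heq, CellRel.finite_eqClass, ?_, CellRel.mem_algebra hXH hn hY hτ,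
    ⟨hA, hε0, hε1, fun x => CellRel.eqClass_eq_singleton, ?_⟩, fun t => ⟨hqA, ?_, fun i => ?_⟩⟩
  · intro x x' h
    obtain ⟨S, -, hS'⟩ := CellRel.exists_smul Φ _ n Y τ
    obtain ⟨g, -, hg⟩ := hS' _ _ h
    exact ⟨g, hg⟩
  · rintro x ⟨p, hp, hpX⟩
    have hcl : eqClass (CellRel Φ _ n Y τ) x = eqClass (CellRel Φ _ n Y τ) p :=
      Set.ext fun r => ⟨fun h => heq.trans (heq.symm hp) h, fun h => heq.trans hp h⟩
    obtain ⟨y, hpy⟩ := hM.exists_owner hS hpX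
    obtain ⟨lo, hi, hbd, hin, hout, -, -⟩ := hM.exists_cell hS hpy hpX
    rw [hcl]
    refine exists_rect_of_sides (K := 2 ^ (7 * ℓ + 5)) hε0 hε1 (hM.sub y hpy.1) hℓ
      (by positivity) (fun j => ?_) (fun j => ?_) (fun j => ?_) (by push_cast; exact hbd) hin hout
    · have := hS.lin j
      omega
    · refine le_trans (Nat.mul_le_mul_right _ ?_) (Rect.smul_natCast_radius _ _ _ ▸ hZ j)
      have h1 : 2 ^ (7 * ℓ) ≤ 2 ^ (14 * ℓ) := Nat.pow_le_pow_right (by norm_num) (by omega)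
      rw [pow_add]
      omega
    · refine le_trans (mul_le_mul_of_nonneg_right ?_ (Nat.cast_nonneg _))
        (radius_le_of_smul_two_pow_subset hdom j)
      have h1 : (1 : ℤ) ≤ 2 ^ (22 * ℓ) := one_le_pow₀ (by norm_num)
      have h2 : (2 : ℤ) ^ (22 * ℓ) * 2 ^ (7 * ℓ + 5) * 2 ^ 3 ≤ 2 ^ (40 * ℓ) := by
        rw [← pow_add, ← pow_add]
        exact pow_le_pow_right₀ (by norm_num) (by omega)
      have h3 : (0 : ℤ) < 2 ^ (7 * ℓ + 5) := by positivity
      push_cast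
      nlinarith
  · rw [Rect.carrier_subset_iff Φ.D_centered]
    intro j
    have h1 : |(Rect.smul ((30 * ℓ : ℕ) : ℝ) (Rect.smul q A)).center j| = 0 :=
      abs_eq_zero.2 (congrFun hA j)
    rw [h1, Rect.smul_natCast_radius]
    have := hS.lin j
    push_cast
    rw [mul_assoc]
    omega
  · rw [Set.disjoint_left]
    intro r hr hr'
    simp only [chartImgSet, Set.mem_iUnion] at hr hr'
    obtain ⟨x', hx', p', hp', rfl⟩ := hr
    obtain ⟨x, hx, p, hp, hpp⟩ := hr'
    rw [mem_bdry_iff heq hqA] at hx'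
    rw [mem_bdry_iff (hEeq t) hqA] at hx
    have hcA : (Rect.smul ((30 * ℓ : ℕ) : ℝ) (Rect.smul q A)).IsCentered := hA
    rw [Rect.mem_carrier_of_isCentered_s16 hcA] at hp hp'
    simp only [Rect.smul_natCast_radius] at hp hp'
    simp only [Nat.cast_mul, Nat.cast_ofNat, mul_assoc] at hp hp'
    exact hM.boundaries_apart hS hx hx' hp hp' hpp

end Construction

/-! ### The Borel and the clopen algebra -/

section Algebras

variable {G X : Type*} [Group G] [TopologicalSpace X] [MulAction G X]

/-- A sequence enumerating a basis separates points from finite sets. -/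
lemma exists_seq_basis_separating [T1Space X] {ℬ : Set (Set X)}
    (hℬ : TopologicalSpace.IsTopologicalBasis ℬ) (hc : ℬ.Countable) (hempty : ∅ ∈ ℬ) :
    ∃ U : ℕ → Set X, (∀ n, U n ∈ ℬ) ∧
      ∀ (x : X) (T : Set X), T.Finite → x ∉ T → ∃ n, x ∈ U n ∧ Disjoint (U n) T := by
  obtain ⟨U, rfl⟩ := hc.exists_eq_range ⟨∅, hempty⟩
  refine ⟨U, fun n => ⟨n, rfl⟩, fun x T hT hx => ?_⟩
  obtain ⟨_, ⟨n, rfl⟩, hxn, hn⟩ :=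
    hℬ.exists_subset_of_mem_open (show x ∈ Tᶜ from hx) hT.isClosed.isOpen_compl
  exact ⟨n, hxn, Set.disjoint_left.2 fun y hy => hn hy⟩

/-- The Borel sets of a Borel action on a Polish space. -/
def LocalAlgebra.borel [PolishSpace X] [MeasurableSpace X] [BorelSpace X]
    (hBorel : ∀ g : G, Measurable fun x : X => g • x) : LocalAlgebra G X where
  M s := MeasurableSet s
  univ := .univ
  compl h := h.compl
  inter h h' := h.inter h'
  smul g _ h := hBorel g h
  glue P B _ hcover hB := by
    have : B = ⋃ n, B ∩ P n := by
      rw [← Set.inter_iUnion, Set.iUnion_eq_univ_iff.2 hcover, Set.inter_univ]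
    exact this ▸ MeasurableSet.iUnion hB
  fixed g := measurableSet_eq_fun (hBorel g) measurable_id
  separates := by
    have hB := TopologicalSpace.isBasis_countableBasis X
    obtain ⟨U, hU, hsep⟩ := exists_seq_basis_separating (hB.insert_empty)
      ((TopologicalSpace.countable_countableBasis X).insert ∅) (Set.mem_insert _ _)
    refine ⟨U, fun n => ?_, hsep⟩
    rcases hU n with h | h
    · exact h ▸ .empty
    · exact (hB.isOpen h).measurableSet

/-- The clopen sets of a free continuous action on a zero-dimensional Polish space. -/
def LocalAlgebra.clopen [PolishSpace X]
    (hbasis : TopologicalSpace.IsTopologicalBasis {U : Set X | IsClopen U})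
    (hcont : ∀ g : G, Continuous fun x : X => g • x)
    (hfree : ∀ (g : G) (x : X), g • x = x → g = 1) : LocalAlgebra G X where
  M s := IsClopen s
  univ := isClopen_univ
  compl h := h.compl
  inter h h' := h.inter h'
  smul g _ h := h.preimage (hcont g)
  glue P B hP hcover hB := by
    have h1 : B = ⋃ n, B ∩ P n := by
      rw [← Set.inter_iUnion, Set.iUnion_eq_univ_iff.2 hcover, Set.inter_univ]
    have h2 : Bᶜ = ⋃ n, P n \ (B ∩ P n) := by
      ext x
      obtain ⟨n, hn⟩ := hcover x
      simp only [Set.mem_compl_iff, Set.mem_iUnion, Set.mem_sdiff, Set.mem_inter_iff, not_and]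
      exact ⟨fun h => ⟨n, hn, fun h' => absurd h' h⟩, fun ⟨m, hm, h⟩ h' => h h' hm⟩
    refine ⟨isOpen_compl_iff.1 (h2 ▸ isOpen_iUnion fun n => ((hP n).diff (hB n)).isOpen),
      h1 ▸ isOpen_iUnion fun n => (hB n).isOpen⟩
  fixed g := by
    by_cases hg : g = 1
    · simp [hg, isClopen_univ]
    · have : {x : X | g • x = x} = ∅ :=
        Set.eq_empty_of_forall_notMem fun x hx => hg (hfree g x hx)
      exact this ▸ isClopen_empty
  separates := by
    obtain ⟨ℬ, hsub, hc, hℬ⟩ := hbasis.exists_countable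
    obtain ⟨U, hU, hsep⟩ := exists_seq_basis_separating (hℬ.insert_empty) (hc.insert ∅)
      (Set.mem_insert _ _)
    refine ⟨U, fun n => ?_, hsep⟩
    rcases hU n with h | h
    · exact h ▸ isClopen_empty
    · exact hsub h

variable {ℓ : ℕ} {Γ : Type*} [AddCommGroup Γ] (Φ : Chart G ℓ Γ)

lemma measurableSet_XH [Countable G] [PolishSpace X] [MeasurableSpace X] [BorelSpace X]
    (hBorel : ∀ g : G, Measurable fun x : X => g • x) : MeasurableSet (XH Φ X) := by
  have : XH Φ X = ⋃ H ∈ Φ.H, ⋂ g : G, {x | g • x = x ↔ g ∈ H} := by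
    ext x
    simp only [XH, Set.mem_ofPred_eq, Set.mem_iUnion, Set.mem_iInter, exists_prop]
    refine ⟨fun h => ⟨_, h, fun g => Iff.rfl⟩, fun ⟨H, hH, h⟩ => ?_⟩
    obtain rfl : MulAction.stabilizer G x = H := Subgroup.ext h
    exact hH
  rw [this]
  refine Finset.measurableSet_biUnion _ fun H _ => MeasurableSet.iInter fun g => ?_
  exact MeasurableSet.iff (measurableSet_eq_fun (hBorel g) measurable_id) (.const _)

lemma XH_eq_univ {X : Type*} [MulAction G X]
    (hfree : ∀ (g : G) (x : X), g • x = x → g = 1)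
    (hH : Φ.H = {(⊥ : Subgroup G)}) : XH Φ X = Set.univ := by
  refine Set.eq_univ_of_forall fun x => ?_
  rw [XH, Set.mem_ofPred_eq, hH, Finset.mem_singleton, eq_bot_iff]
  exact fun g hg => hfree g x hg

/-- A relation contained in the orbit relation of a countable group is Borel as soon as each of
its sections along a group element is. -/
lemma measurableSet_rel_of_sections [Countable G] [PolishSpace X] [MeasurableSpace X]
    [BorelSpace X] (hBorel : ∀ g : G, Measurable fun x : X => g • x) {F : X → X → Prop}
    (horb : ∀ x x', F x x' → ∃ g : G, x' = g • x)
    (hF : ∀ g : G, MeasurableSet {x | F x (g • x)}) : MeasurableSet {p : X × X | F p.1 p.2} := by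
  have : {p : X × X | F p.1 p.2} =
      ⋃ g : G, {p | p.2 = g • p.1} ∩ Prod.fst ⁻¹' {x | F x (g • x)} := by
    ext ⟨x, x'⟩
    simp only [Set.mem_ofPred_eq, Set.mem_iUnion, Set.mem_inter_iff, Set.mem_preimage]
    refine ⟨fun h => ?_, ?_⟩
    · obtain ⟨g, rfl⟩ := horb _ _ h
      exact ⟨g, rfl, h⟩
    · rintro ⟨g, rfl, h⟩
      exact h
  rw [this]
  exact MeasurableSet.iUnion fun g =>
    (measurableSet_eq_fun measurable_snd ((hBorel g).comp measurable_fst)).inter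
      (measurable_fst (hF g))

end Algebras

/-- **Lemma 6.3 (main construction of an orthogonal rectangular equivalence relation).**
Let `G` act in a Borel fashion on a Polish space `X`, let `Φ = (ℓ, φ, 𝒵, Γ, ℋ)` be a chart
for `G`, let `A` be a centered rectangle, and let `ε, q ∈ ℝ`, `b ∈ ℕ` be positive with
`2^{40ℓ}·A ⊆ dom(φ)`, `2·36²·2^{14ℓ}·𝒵 ⊑ ε·A`, and
`8ε < q < (1/4)·306⁻¹·ℓ⁻¹·b⁻¹·2^{−22ℓ²}`. Let `E_1, …, E_s` be Borel
`(Φ, A, ε)`-sub-rectangular equivalence relations such that for every `x ∈ X^ℋ` there are at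
most `b` indices `t` with `φ(8·2^{14ℓ}·A)·x ⊄ [x]_{E_t}`. Then there is a finite Borel
`(Φ, A, ε)`-rectangular equivalence relation `F` which is `(Φ, q·A)`-orthogonal to each
`E_t`; and if moreover `X` is zero-dimensional, the action is continuous and free,
`ℋ = 𝟙`, and each `E_t` is `G`-clopen, then `F` may additionally be chosen `G`-clopen. -/
theorem main_construction {G X : Type*} [Group G] [Countable G]
    [TopologicalSpace X] [PolishSpace X] [MeasurableSpace X] [BorelSpace X] [MulAction G X]
    (hBorel : ∀ g : G, Measurable fun x : X => g • x)
    {ℓ : ℕ} {Γ : Type*} [AddCommGroup Γ] (Φ : Chart G ℓ Γ)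
    (A : Rect ℓ) (hA : A.IsCentered)
    (ε q : ℝ) (b : ℕ) (hε0 : 0 < ε) (hq0 : 0 < q) (hb : 0 < b)
    (hdom : (Rect.smul ((2 : ℝ) ^ (40 * ℓ)) A).carrier Γ ⊆ Φ.D.carrier Γ)
    (hZ : (Rect.smul ((2 * 36 ^ 2 * 2 ^ (14 * ℓ) : ℕ) : ℝ) Φ.Z).le (Rect.smul ε A))
    (hq1 : 8 * ε < q)
    (hq2 : q < 1 / 4 * (306 : ℝ)⁻¹ * (ℓ : ℝ)⁻¹ * (b : ℝ)⁻¹ * ((2 : ℝ) ^ (22 * ℓ ^ 2))⁻¹)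
    (s : ℕ) (E : Fin s → X → X → Prop)
    (hEeq : ∀ t, Equivalence (E t))
    (hEBorel : ∀ t, MeasurableSet {p : X × X | E t p.1 p.2})
    (hEsub : ∀ t, IsSubRectangular Φ A ε (E t))
    (hbound : ∀ x ∈ XH Φ X,
      Set.ncard {t : Fin s |
        ¬ chartImg Φ ((Rect.smul ((8 * 2 ^ (14 * ℓ) : ℕ) : ℝ) A).carrier Γ) x
            ⊆ eqClass (E t) x} ≤ b) :
    (∃ F : X → X → Prop, Equivalence F ∧
      (∀ x : X, (eqClass F x).Finite) ∧
      MeasurableSet {p : X × X | F p.1 p.2} ∧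
      IsRectangular Φ A ε F ∧
      (∀ t, ChartOrthogonal Φ (Rect.smul q A) F (E t))) ∧
    ((TopologicalSpace.IsTopologicalBasis {U : Set X | IsClopen U}) →
     (∀ g : G, Continuous fun x : X => g • x) →
     (∀ (g : G) (x : X), g • x = x → g = 1) →
     Φ.H = {(⊥ : Subgroup G)} →
     (∀ t, ∀ g : G, IsClopen {x : X | E t x (g • x)}) →
     ∃ F : X → X → Prop, Equivalence F ∧
       (∀ x : X, (eqClass F x).Finite) ∧
       MeasurableSet {p : X × X | F p.1 p.2} ∧
       IsRectangular Φ A ε F ∧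
       (∀ t, ChartOrthogonal Φ (Rect.smul q A) F (E t)) ∧
       (∀ g : G, IsClopen {x : X | F x (g • x)})) := by
  refine ⟨?_, fun hbasis hcont hfree hH hEclopen => ?_⟩
  · obtain ⟨F, hFeq, hfin, horb, hFM, hrect, horth⟩ := exists_orthogonal_rectangular
      (LocalAlgebra.borel hBorel) (measurableSet_XH Φ hBorel) hA hε0 hq0 hb hdom hZ hq1 hq2 hEeq
      (fun t g => (measurable_id.prodMk (hBorel g)) (hEBorel t)) hEsub hbound
    exact ⟨F, hFeq, hfin, measurableSet_rel_of_sections hBorel horb hFM, hrect, horth⟩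
  · obtain ⟨F, hFeq, hfin, horb, hFM, hrect, horth⟩ := exists_orthogonal_rectangular
      (LocalAlgebra.clopen hbasis hcont hfree) (XH_eq_univ Φ hfree hH ▸ isClopen_univ) hA hε0 hq0
      hb hdom hZ hq1 hq2 hEeq hEclopen hEsub hbound
    exact ⟨F, hFeq, hfin, measurableSet_rel_of_sections hBorel horb
      fun g => (hFM g).2.measurableSet, hrect, horth, hFM⟩
end
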